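/- For any positive integers $r$ and $\Delta$ and any bipartite $\Delta$-bounded graph sequence $\mathcal{F}=\{F_1,F_2,\dots\}$, there exists a constant $C_r$ depending only on $r$ such that every $r$-edge-colouring of every complete graph $K_n$ admits a monochromatic $\mathcal{F}$-tiling of size at most $\exp(C_r\Delta)$. -/

import Mathlib

namespace Tiling
open Finset Classical

/-- Recursive notion of a partial tuple having too many bad extensions. -/
def lost {V : Type*} (Y : Finset V) (e : ℕ) (g0 : Finset V → Prop) : ℕ → Finset V → Prop
  | 0, P => ¬ g0 P
  | k+1, P => e < #{y ∈ Y | lost Y e g0 k (insert y P)}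

def Good {V : Type*} (Y : Finset V) (e : ℕ) (g0 : Finset V → Prop) (K : ℕ) (P : Finset V) : Prop :=
  ¬ lost Y e g0 (K - #P) P

lemma good_ext {V : Type*} {Y : Finset V} {e : ℕ} {g0 : Finset V → Prop} {K : ℕ} {P : Finset V}
    (hP : #P < K) (h : Good Y e g0 K P) : #{y ∈ Y | ¬ Good Y e g0 K (insert y P)} ≤ e := by
  have h' := h
  unfold Good at h
  obtain ⟨k, hk⟩ : ∃ k, K - #P = k + 1 := ⟨K - #P - 1, by omega⟩
  rw [hk] at h
  simp only [lost, not_lt] at h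
  refine le_trans (card_le_card ?_) h
  intro y hy
  simp only [mem_filter] at hy ⊢
  refine ⟨hy.1, ?_⟩
  by_cases hyP : y ∈ P
  · rw [insert_eq_of_mem hyP] at hy
    exact absurd h' hy.2
  · have := hy.2
    unfold Good at this
    rw [card_insert_of_notMem hyP] at this
    have e1 : K - (#P + 1) = k := by omega
    rw [e1] at this
    exact not_not.mp this

lemma not_lost_final {V : Type*} {Y : Finset V} {e : ℕ} {g0 : Finset V → Prop}
    (anti : ∀ P Q, P ⊆ Q → g0 Q → g0 P) (he : e < #Y) :
    ∀ (k : ℕ) (P : Finset V), ¬ lost Y e g0 k P → g0 P := by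
  intro k
  induction k with
  | zero => intro P h; simpa [lost] using h
  | succ k ih =>
    intro P h
    simp only [lost, not_lt] at h
    have : ∃ y ∈ Y, ¬ lost Y e g0 k (insert y P) := by
      by_contra hc
      push Not at hc
      rw [filter_true_of_mem hc] at h
      omega
    obtain ⟨y, hy, hl⟩ := this
    exact anti _ _ (subset_insert y P) (ih _ hl)

lemma good_final {V : Type*} {Y : Finset V} {e : ℕ} {g0 : Finset V → Prop} {K : ℕ}
    (anti : ∀ P Q, P ⊆ Q → g0 Q → g0 P) (he : e < #Y) {P : Finset V} (h : Good Y e g0 K P) : g0 P :=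
  not_lost_final anti he _ _ h

lemma lost_count {V : Type*} {Y : Finset V} {e e1 : ℕ} {g0 : Finset V → Prop}
    (ok : ℕ → Finset V → Prop)
    (hok : ∀ k P, ok (k+1) P → #{y ∈ Y | ¬ ok k (insert y P)} ≤ e1) :
    ∀ (k : ℕ) (P : Finset V), ok k P → lost Y e g0 k P →
      (e + 1 - e1) ^ k ≤ #{q ∈ Fintype.piFinset (fun _ : Fin k => Y) |
        ok 0 (P ∪ univ.image q) ∧ ¬ g0 (P ∪ univ.image q)} := by
  intro k
  induction k with
  | zero =>
    intro P h1 h2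
    simp only [lost] at h2
    simp [h1, h2]
  | succ k ih =>
    intro P h1 h2
    simp only [lost] at h2
    set A := {y ∈ Y | lost Y e g0 k (insert y P)} with hA
    set A' := A.filter (fun y => ok k (insert y P)) with hA'
    have hA'card : e + 1 - e1 ≤ #A' := by
      have h3 := hok k P h1
      have h4 : #A ≤ #A' + #{y ∈ Y | ¬ ok k (insert y P)} := by
        rw [hA', ← card_filter_add_card_filter_not (s := A) (fun y => ok k (insert y P))]
        gcongr
        exact filter_subset _ _
      omega
    have key : ∀ y ∈ A', (e + 1 - e1) ^ k ≤ #{q ∈ Fintype.piFinset (fun _ : Fin k => Y) |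
        ok 0 (insert y P ∪ univ.image q) ∧ ¬ g0 (insert y P ∪ univ.image q)} := by
      intro y hy
      simp only [hA', hA, mem_filter] at hy
      exact ih _ hy.2 hy.1.2
    calc (e + 1 - e1) ^ (k+1) = (e + 1 - e1) * (e + 1 - e1) ^ k := by ring
      _ ≤ #A' * (e + 1 - e1) ^ k := by gcongr
      _ = ∑ y ∈ A', (e + 1 - e1) ^ k := by simp
      _ ≤ ∑ y ∈ A', #{q ∈ Fintype.piFinset (fun _ : Fin k => Y) |
        ok 0 (insert y P ∪ univ.image q) ∧ ¬ g0 (insert y P ∪ univ.image q)} := sum_le_sum key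
      _ = #(A'.sigma fun y => {q ∈ Fintype.piFinset (fun _ : Fin k => Y) |
        ok 0 (insert y P ∪ univ.image q) ∧ ¬ g0 (insert y P ∪ univ.image q)}) := by rw [card_sigma]
      _ ≤ _ := by
        apply card_le_card_of_injOn (fun x => (Fin.cons x.1 x.2 : Fin (k+1) → V))
        · rintro ⟨y, q⟩ hx
          simp only [coe_sigma, Set.mem_sigma_iff, mem_coe, mem_filter, Fintype.mem_piFinset, hA', hA] at hx ⊢
          have e2 : P ∪ univ.image (Fin.cons y q : Fin (k+1) → V) = insert y P ∪ univ.image q := by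
            ext z
            simp only [mem_union, mem_image, mem_univ, true_and, mem_insert, Fin.exists_fin_succ,
              Fin.cons_zero, Fin.cons_succ]
            tauto
          rw [e2]
          refine ⟨?_, hx.2.2⟩
          intro a
          refine Fin.cases ?_ ?_ a
          · simpa using hx.1.1.1
          · intro i; simpa using hx.2.1 i
        · rintro ⟨y, q⟩ _ ⟨y', q'⟩ _ h
          simp only at h
          rw [Fin.cons_inj] at h
          obtain ⟨h1, h2⟩ := h
          subst h1; subst h2; rfl

end Tiling

namespace Tiling
open Finset Classical

variable {V ι : Type*}

/-- image of the already embedded neighbours of `w` -/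
noncomputable def pt (F : SimpleGraph ι) (D : Finset ι) (σ : ι → V) (w : ι) : Finset V :=
  (D.filter (F.Adj w)).image σ

def DegLe [Fintype ι] (F : SimpleGraph ι) (Δ : ℕ) : Prop :=
  ∀ w, #(univ.filter (F.Adj w)) ≤ Δ

lemma update_image {D : Finset ι} {σ : ι → V} {v : ι} {y : V} (hv : v ∉ D) :
    D.image (Function.update σ v y) = D.image σ := by
  apply image_congr
  intro u hu
  have : u ≠ v := by rintro rfl; exact hv hu
  simp [this]

lemma pt_insert_adj {F : SimpleGraph ι} {D : Finset ι} {σ : ι → V} {v w : ι} {y : V}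
    (hv : v ∉ D) (h : F.Adj w v) :
    pt F (insert v D) (Function.update σ v y) w = insert y (pt F D σ w) := by
  unfold pt
  rw [filter_insert, if_pos h, image_insert, Function.update_self,
    update_image (by simp [hv])]

lemma pt_insert_nadj {F : SimpleGraph ι} {D : Finset ι} {σ : ι → V} {v w : ι} {y : V}
    (hv : v ∉ D) (h : ¬ F.Adj w v) :
    pt F (insert v D) (Function.update σ v y) w = pt F D σ w := by
  unfold pt
  rw [filter_insert, if_neg h, update_image (by simp [hv])]

lemma pt_congr {F : SimpleGraph ι} {D : Finset ι} {σ τ : ι → V} {w : ι}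
    (h : ∀ u ∈ D, σ u = τ u) : pt F D σ w = pt F D τ w := by
  unfold pt
  apply image_congr
  intro u hu
  simp at hu
  exact h u hu.1

lemma pt_card_lt [Fintype ι] {F : SimpleGraph ι} {Δ : ℕ} (hF : DegLe F Δ) {D : Finset ι} {σ : ι → V}
    {v w : ι} (hv : v ∉ D) (h : F.Adj w v) : #(pt F D σ w) < Δ := by
  unfold pt
  refine lt_of_le_of_lt card_image_le (lt_of_lt_of_le (card_lt_card ?_) (hF w))
  rw [ssubset_iff_of_subset (filter_subset_filter _ (subset_univ D))]
  exact ⟨v, by simp [h], by simp [hv]⟩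

lemma pt_card_le [Fintype ι] {F : SimpleGraph ι} {Δ : ℕ} (hF : DegLe F Δ) {D : Finset ι} {σ : ι → V}
    {w : ι} : #(pt F D σ w) ≤ Δ := by
  unfold pt
  exact card_image_le.trans ((card_le_card (filter_subset_filter _ (subset_univ D))).trans (hF w))

/-- valid partial embedding of the right side -/
def State (F : SimpleGraph ι) (Gr : ι → Finset V) (good : ι → Finset V → Prop)
    (D : Finset ι) (σ : ι → V) : Prop :=
  Set.InjOn σ D ∧ (∀ u ∈ D, σ u ∈ Gr u) ∧ ∀ w, good w (pt F D σ w)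

noncomputable def Allowed (F : SimpleGraph ι) (Gr : ι → Finset V) (good : ι → Finset V → Prop)
    (D : Finset ι) (σ : ι → V) (v : ι) : Finset V :=
  (Gr v).filter (fun y => y ∉ D.image σ ∧ ∀ w, F.Adj w v → good w (insert y (pt F D σ w)))

lemma mem_Allowed {F : SimpleGraph ι} {Gr : ι → Finset V} {good : ι → Finset V → Prop}
    {D : Finset ι} {σ : ι → V} {v : ι} {y : V} : y ∈ Allowed F Gr good D σ v ↔
    y ∈ Gr v ∧ y ∉ D.image σ ∧ ∀ w, F.Adj w v → good w (insert y (pt F D σ w)) := by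
  unfold Allowed; rw [mem_filter]

lemma allowed_card [Fintype ι] {F : SimpleGraph ι} {Δ e : ℕ} (hF : DegLe F Δ) {Gr : ι → Finset V}
    {good : ι → Finset V → Prop}
    {D : Finset ι} {σ : ι → V} {v : ι} (hv : v ∉ D)
    (hext : ∀ w, F.Adj w v → ∀ P, #P < Δ → good w P →
      #{y ∈ Gr v | ¬ good w (insert y P)} ≤ e)
    (hS : State F Gr good D σ) :
    #(Gr v) ≤ #(Allowed F Gr good D σ v) + #D + Δ * e := by
  have hsub : Gr v ⊆ (Allowed F Gr good D σ v ∪ D.image σ) ∪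
      (univ.filter (F.Adj v)).biUnion (fun w => {y ∈ Gr v | ¬ good w (insert y (pt F D σ w))}) := by
    intro y hy
    by_cases h1 : y ∈ D.image σ
    · simp only [mem_union]; tauto
    by_cases h2 : ∀ w, F.Adj w v → good w (insert y (pt F D σ w))
    · have : y ∈ Allowed F Gr good D σ v := by
        exact mem_Allowed.2 ⟨hy, h1, h2⟩
      simp only [mem_union]; tauto
    · push Not at h2
      obtain ⟨w, hw, hg⟩ := h2
      apply mem_union_right
      rw [mem_biUnion]
      exact ⟨w, by simp [hw.symm], by rw [mem_filter]; exact ⟨hy, hg⟩⟩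
  have h3 : #((univ.filter (F.Adj v)).biUnion
      (fun w => {y ∈ Gr v | ¬ good w (insert y (pt F D σ w))})) ≤ Δ * e := by
    refine (card_biUnion_le_card_mul _ _ e ?_).trans (Nat.mul_le_mul_right _ (hF v))
    intro w hw
    simp at hw
    exact hext w hw.symm _ (pt_card_lt hF hv hw.symm) (hS.2.2 w)
  have := (card_le_card hsub).trans (card_union_le _ _)
  have h4 := card_union_le (Allowed F Gr good D σ v) (D.image σ)
  have h5 : #(D.image σ) ≤ #D := card_image_le
  omega

lemma state_step {F : SimpleGraph ι} {Gr : ι → Finset V} {good : ι → Finset V → Prop}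
    {D : Finset ι} {σ : ι → V} {v : ι} {y : V} (hv : v ∉ D) (hS : State F Gr good D σ)
    (hy : y ∈ Allowed F Gr good D σ v) :
    State F Gr good (insert v D) (Function.update σ v y) := by
  unfold Allowed at hy
  rw [mem_filter] at hy
  obtain ⟨hy1, hy2, hy3⟩ := hy
  have hne : ∀ u ∈ D, u ≠ v := by rintro u hu rfl; exact hv hu
  refine ⟨?_, ?_, ?_⟩
  · intro a ha b hb hab
    simp only [coe_insert, Set.mem_insert_iff, mem_coe] at ha hb
    rcases ha with rfl | ha <;> rcases hb with rfl | hb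
    · rfl
    · rw [Function.update_self, Function.update_of_ne (hne b hb)] at hab
      exact absurd (mem_image.2 ⟨b, hb, hab.symm⟩) hy2
    · rw [Function.update_self, Function.update_of_ne (hne a ha)] at hab
      exact absurd (mem_image.2 ⟨a, ha, hab⟩) hy2
    · rw [Function.update_of_ne (hne a ha), Function.update_of_ne (hne b hb)] at hab
      exact hS.1 ha hb hab
  · intro u hu
    rcases mem_insert.1 hu with rfl | hu
    · simpa using hy1
    · rw [Function.update_of_ne (hne u hu)]; exact hS.2.1 u hu
  · intro w
    by_cases h : F.Adj w v
    · rw [pt_insert_adj hv h]; exact hy3 w h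
    · rw [pt_insert_nadj hv h]; exact hS.2.2 w

lemma seq_embed {F : SimpleGraph ι} {Gr : ι → Finset V} {good : ι → Finset V → Prop}
    {D0 : Finset ι} {σ0 : ι → V} (hS : State F Gr good D0 σ0)
    (W : Finset ι → (ι → V) → ℝ) {ρ : ℝ} (hρ : 0 ≤ ρ) (K : Finset ι) (hK : Disjoint D0 K)
    (hstep : ∀ D σ v, D0 ⊆ D → D ⊆ D0 ∪ K → v ∈ K → v ∉ D → State F Gr good D σ →
      (Allowed F Gr good D σ v).Nonempty ∧
      ∑ y ∈ Allowed F Gr good D σ v, W (insert v D) (Function.update σ v y)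
        ≤ ρ * #(Allowed F Gr good D σ v) * W D σ) :
    ∃ σ, (∀ u ∈ D0, σ u = σ0 u) ∧ State F Gr good (D0 ∪ K) σ ∧ W (D0 ∪ K) σ ≤ ρ ^ #K * W D0 σ0 := by
  induction K using Finset.induction_on with
  | empty => exact ⟨σ0, fun _ _ => rfl, by simpa using hS, by simp⟩
  | insert v K hv ih =>
    have hK' : Disjoint D0 K := hK.mono_right (subset_insert _ _)
    have hsub : D0 ∪ K ⊆ D0 ∪ insert v K := union_subset_union_right (subset_insert _ _)
    obtain ⟨σ, h1, h2, h3⟩ := ih hK' (fun D σ u a b c d e =>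
      hstep D σ u a (b.trans hsub) (mem_insert_of_mem c) d e)
    have hv0 : v ∉ D0 := fun h => (disjoint_left.1 hK h (mem_insert_self _ _))
    have hvD : v ∉ D0 ∪ K := by simp [hv0, hv]
    obtain ⟨hne, hsum⟩ := hstep (D0 ∪ K) σ v subset_union_left hsub (mem_insert_self _ _) hvD h2
    have : ∃ y ∈ Allowed F Gr good (D0 ∪ K) σ v,
        W (insert v (D0 ∪ K)) (Function.update σ v y) ≤ ρ * W (D0 ∪ K) σ := by
      apply exists_le_of_sum_le hne
      rw [sum_const, nsmul_eq_mul]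
      linarith
    obtain ⟨y, hy, hW⟩ := this
    refine ⟨Function.update σ v y, ?_, ?_, ?_⟩
    · intro u hu
      have : u ≠ v := by rintro rfl; exact hv0 hu
      rw [Function.update_of_ne this, h1 u hu]
    · rw [union_insert]
      exact state_step hvD h2 hy
    · rw [union_insert, card_insert_of_notMem hv, pow_succ]
      calc _ ≤ ρ * W (D0 ∪ K) σ := hW
        _ ≤ ρ * (ρ ^ #K * W D0 σ0) := by gcongr
        _ = _ := by ring

/-- greedy embedding without potential -/
lemma greedy_embed [Fintype ι] {F : SimpleGraph ι} {Δ e : ℕ} (hF : DegLe F Δ) {Gr : ι → Finset V}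
    {good : ι → Finset V → Prop}
    {D0 : Finset ι} {σ0 : ι → V} (hS : State F Gr good D0 σ0)
    (hext : ∀ u w, u ∉ D0 → F.Adj w u → ∀ P, #P < Δ → good w P →
      #{y ∈ Gr u | ¬ good w (insert y P)} ≤ e)
    (hcard : ∀ u ∉ D0, Fintype.card ι + Δ * e < #(Gr u)) :
    ∃ σ, (∀ u ∈ D0, σ u = σ0 u) ∧ State F Gr good univ σ := by
  obtain ⟨σ, h1, h2, -⟩ := seq_embed hS (fun _ _ => 0) (zero_le_one) (univ \ D0) disjoint_sdiff (by
    intro D σ v h0 _ hv hvD hS'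
    have hv0 : v ∉ D0 := by simpa using hv
    have := allowed_card (e := e) hF hvD (fun w hw => hext v w hv0 hw) hS'
    have h4 := hcard v hv0
    have h5 : #D ≤ Fintype.card ι := card_le_univ D
    refine ⟨card_pos.1 (by omega), by simp⟩)
  refine ⟨σ, h1, ?_⟩
  rwa [union_sdiff_of_subset (subset_univ _)] at h2

/-- sequential embedding with tests -/
lemma test_embed [Fintype ι] {F : SimpleGraph ι} {Δ e g : ℕ} (hF : DegLe F Δ) {Y : Finset V}
    {good : Finset V → Prop} (hg : 0 < g)
    {D0 : Finset ι} {σ0 : ι → V} (hS : State F (fun _ => Y) (fun _ => good) D0 σ0)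
    (hext : ∀ P, #P < Δ → good P → #{y ∈ Y | ¬ good (insert y P)} ≤ e)
    (K : Finset ι) (hK : Disjoint D0 K) (hcard : #D0 + #K + Δ * e + g ≤ #Y)
    {τ : Type*} (T : Finset τ) (test : τ → Finset V → Prop)
    (htest : ∀ i ∈ T, ∀ P, #P < Δ → test i P → #{y ∈ Y | ¬ test i (insert y P)} ≤ e)
    (M : ℝ) (hM : ∑ i ∈ T, (2:ℝ) ^ #{w | ¬ test i (pt F D0 σ0 w)} ≤ M) :
    ∃ σ, (∀ u ∈ D0, σ u = σ0 u) ∧ State F (fun _ => Y) (fun _ => good) (D0 ∪ K) σ ∧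
      ∀ i ∈ T, (2:ℝ) ^ #{w | ¬ test i (pt F (D0 ∪ K) σ w)} ≤ (1 + Δ * e * 2 ^ Δ / g) ^ #K * M := by
  set W : Finset ι → (ι → V) → ℝ := fun D σ => ∑ i ∈ T, (2:ℝ) ^ #{w | ¬ test i (pt F D σ w)} with hW
  have hgR : (0:ℝ) < g := by exact_mod_cast hg
  obtain ⟨σ, h1, h2, h3⟩ := seq_embed hS W (ρ := 1 + Δ * e * 2 ^ Δ / g) (by positivity) K hK (by
    intro D σ v h0 h01 hv hvD hS'
    have hc := allowed_card (e := e) hF hvD (fun w hw => hext) hS'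
    set Ω := Allowed F (fun _ => Y) (fun _ => good) D σ v with hΩ
    have hDc : #D ≤ #D0 + #K := (card_le_card h01).trans (card_union_le _ _)
    have hgΩ : g ≤ #Ω := by omega
    refine ⟨card_pos.1 (by omega), ?_⟩
    simp only [hW]
    rw [sum_comm, mul_sum]
    apply sum_le_sum
    intro i hi
    set f := #{w | ¬ test i (pt F D σ w)} with hf
    -- bad choices
    set Bad := (univ.filter (F.Adj v)).biUnion
      (fun w => if test i (pt F D σ w) then {y ∈ Y | ¬ test i (insert y (pt F D σ w))} else ∅) with hBad
    have hBadc : #Bad ≤ Δ * e := by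
      refine (card_biUnion_le_card_mul _ _ e ?_).trans (Nat.mul_le_mul_right _ (hF v))
      intro w hw
      simp at hw
      split_ifs with ht
      · exact htest i hi _ (pt_card_lt hF hvD hw.symm) ht
      · simp
    have hgood : ∀ y ∈ Ω, y ∉ Bad →
        #{w | ¬ test i (pt F (insert v D) (Function.update σ v y) w)} ≤ f := by
      intro y hy hyB
      apply card_le_card
      intro w hw
      simp only [mem_filter, mem_univ, true_and] at hw ⊢
      intro ht
      apply hw
      by_cases hadj : F.Adj w v
      · rw [pt_insert_adj hvD hadj]
        by_contra hcon
        apply hyB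
        rw [hBad, mem_biUnion]
        refine ⟨w, by simp [hadj.symm], ?_⟩
        rw [if_pos ht, mem_filter]
        refine ⟨?_, hcon⟩
        exact (mem_Allowed.1 hy).1
      · rw [pt_insert_nadj hvD hadj]; exact ht
    have hall : ∀ y ∈ Ω, 
        #{w | ¬ test i (pt F (insert v D) (Function.update σ v y) w)} ≤ f + Δ := by
      intro y hy
      refine le_trans (card_le_card (t := univ.filter (fun w => ¬ test i (pt F D σ w)) ∪ univ.filter (F.Adj v)) ?_)
        ((card_union_le _ _).trans (Nat.add_le_add_left (hF v) _))
      intro w hw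
      simp only [mem_filter, mem_univ, true_and, mem_union] at hw ⊢
      by_cases hadj : F.Adj w v
      · right; exact hadj.symm
      · left; rwa [pt_insert_nadj hvD hadj] at hw
    have hb : ∀ y ∈ Ω, (2:ℝ) ^ #{w | ¬ test i (pt F (insert v D) (Function.update σ v y) w)} ≤
        2 ^ f + (if y ∈ Bad then 2 ^ (f + Δ) else 0) := by
      intro y hy
      split_ifs with h
      · have := pow_le_pow_right₀ (one_le_two : (1:ℝ) ≤ 2) (hall y hy)
        have h2 : (0:ℝ) < 2 ^ f := by positivity
        linarith
      · have := pow_le_pow_right₀ (one_le_two : (1:ℝ) ≤ 2) (hgood y hy h)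
        simpa using this
    refine (sum_le_sum hb).trans ?_
    rw [sum_add_distrib, sum_const, nsmul_eq_mul, ← sum_filter, sum_const, nsmul_eq_mul]
    have h6 : (#(Ω.filter (· ∈ Bad)) : ℝ) ≤ Δ * e := by
      have : #(Ω.filter (· ∈ Bad)) ≤ #Bad := card_le_card (fun y hy => (mem_filter.1 hy).2)
      exact_mod_cast this.trans hBadc
    have h7 : (Δ * e : ℝ) ≤ Δ * e / g * #Ω := by
      rw [div_mul_eq_mul_div, le_div_iff₀ hgR]
      have : (g:ℝ) ≤ #Ω := by exact_mod_cast hgΩ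
      gcongr
    calc (#Ω * 2 ^ f + #(Ω.filter (· ∈ Bad)) * 2 ^ (f + Δ) : ℝ)
        ≤ #Ω * 2 ^ f + (Δ * e / g * #Ω) * 2 ^ (f + Δ) := by gcongr; exact h6.trans h7
      _ = _ := by rw [pow_add]; ring)
  refine ⟨σ, h1, h2, ?_⟩
  intro i hi
  calc _ ≤ W (D0 ∪ K) σ := by
        simp only [hW]
        exact single_le_sum (f := fun i => (2:ℝ) ^ #{w | ¬ test i (pt F (D0 ∪ K) σ w)})
          (fun _ _ => by positivity) hi
    _ ≤ _ := h3
    _ ≤ _ := by gcongr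

end Tiling

namespace Tiling
open Finset Classical

variable {V ι : Type*}

lemma hall_finset (J : Finset ι) (N : ι → Finset V) (base : ι → V)
    (h : ∀ A ⊆ J, #A ≤ #(A.biUnion N)) :
    ∃ f : ι → V, Set.InjOn f J ∧ (∀ j ∈ J, f j ∈ N j) ∧ ∀ j ∉ J, f j = base j := by
  have h1 : ∀ s : Finset J, #s ≤ #(s.biUnion (fun j => N j.1)) := by
    intro s
    have := h (s.image Subtype.val) (by intro x hx; simp at hx; exact hx.1)
    rw [card_image_of_injective _ Subtype.val_injective, image_biUnion] at this
    exact this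
  rw [Finset.all_card_le_biUnion_card_iff_exists_injective] at h1
  obtain ⟨f, hf, hfm⟩ := h1
  refine ⟨fun j => if hj : j ∈ J then f ⟨j, hj⟩ else base j, ?_, ?_, ?_⟩
  · intro a ha b hb hab
    simp only [mem_coe] at ha hb
    simp only [ha, hb, dite_true] at hab
    simpa using hf hab
  · intro j hj
    simp only [hj, dite_true]
    exact hfm ⟨j, hj⟩
  · intro j hj; simp [hj]

lemma exists_indep (S : Finset ι) (rel : ι → ι → Prop) (hrefl : ∀ a, rel a a)
    (hsymm : ∀ a b, rel a b → rel b a)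
    (D : ℕ) (hD : ∀ a ∈ S, #{b ∈ S | rel a b} ≤ D) :
    ∃ J ⊆ S, (∀ a ∈ J, ∀ b ∈ J, rel a b → a = b) ∧ #S ≤ #J * D := by
  induction S using Finset.strongInduction with
  | _ S ih =>
    by_cases hS : S = ∅
    · exact ⟨∅, by simp, by simp, by simp [hS]⟩
    obtain ⟨a, ha⟩ := nonempty_iff_ne_empty.2 hS
    set S' := S.filter (fun b => ¬ (rel a b)) with hS'
    have hsub : S' ⊂ S := by
      rw [ssubset_iff_of_subset (filter_subset _ _)]
      exact ⟨a, ha, by simp [hS', hrefl a]⟩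
    obtain ⟨J, hJ, hJi, hJc⟩ := ih S' hsub
      (fun b hb => (card_le_card (filter_subset_filter _ hsub.1)).trans (hD b (hsub.1 hb)))
    have haJ : ∀ b ∈ J, ¬ rel a b := fun b hb => (mem_filter.1 (hJ hb)).2
    have haJ' : a ∉ J := fun h => haJ a h (hrefl a)
    refine ⟨insert a J, insert_subset ha (hJ.trans hsub.1), ?_, ?_⟩
    · intro x hx y hy hxy
      rcases mem_insert.1 hx with hx | hx <;> rcases mem_insert.1 hy with hy | hy
      · rw [hx, hy]
      · rw [hx] at hxy; exact absurd hxy (haJ y hy)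
      · rw [hy] at hxy; exact absurd (hsymm _ _ hxy) (haJ x hx)
      · exact hJi x hx y hy hxy
    · rw [card_insert_of_notMem haJ']
      have h1 := card_filter_add_card_filter_not (s := S) (fun b => rel a b)
      have h2 := hD a ha
      rw [add_mul]
      simp only [← hS'] at h1
      omega

/-- common neighbour relation -/
def rel2 (F : SimpleGraph ι) (a b : ι) : Prop := a = b ∨ ∃ u, F.Adj a u ∧ F.Adj b u

def rel4 (F : SimpleGraph ι) (a b : ι) : Prop := ∃ c, rel2 F a c ∧ rel2 F c b

lemma rel2_symm {F : SimpleGraph ι} {a b : ι} (h : rel2 F a b) : rel2 F b a := by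
  rcases h with h | ⟨u, h1, h2⟩
  · exact Or.inl h.symm
  · exact Or.inr ⟨u, h2, h1⟩

lemma rel2_card [Fintype ι] {F : SimpleGraph ι} {Δ : ℕ} (hF : DegLe F Δ) (a : ι) :
    #{b | rel2 F a b} ≤ Δ * Δ + 1 := by
  have : (univ.filter (fun b => rel2 F a b)) ⊆ insert a ((univ.filter (F.Adj a)).biUnion
      (fun u => univ.filter (F.Adj u))) := by
    intro b hb
    simp only [mem_filter, mem_univ, true_and] at hb
    rcases hb with h | ⟨u, h1, h2⟩
    · simp [h]
    · apply mem_insert_of_mem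
      rw [mem_biUnion]
      exact ⟨u, by simp [h1], by simp [h2.symm]⟩
  refine (card_le_card this).trans ((card_insert_le _ _).trans ?_)
  gcongr
  refine (card_biUnion_le_card_mul _ _ Δ (fun u _ => hF u)).trans (Nat.mul_le_mul_right _ (hF a))

lemma rel4_card [Fintype ι] {F : SimpleGraph ι} {Δ : ℕ} (hF : DegLe F Δ) (a : ι) :
    #{b | rel4 F a b} ≤ (Δ * Δ + 1) * (Δ * Δ + 1) := by
  have : (univ.filter (fun b => rel4 F a b)) ⊆ ((univ.filter (rel2 F a)).biUnion
      (fun u => univ.filter (rel2 F u))) := by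
    intro b hb
    simp only [mem_filter, mem_univ, true_and] at hb
    obtain ⟨u, h1, h2⟩ := hb
    rw [mem_biUnion]
    exact ⟨u, by simp [h1], by simp [h2]⟩
  refine (card_le_card this).trans ?_
  exact (card_biUnion_le_card_mul _ _ _ (fun u _ => rel2_card hF u)).trans
    (Nat.mul_le_mul_right _ (rel2_card hF a))

def Indep2 (F : SimpleGraph ι) (J : Finset ι) : Prop :=
  ∀ a ∈ J, ∀ b ∈ J, rel2 F a b → a = b

lemma exists_indep2 [Fintype ι] {F : SimpleGraph ι} {Δ : ℕ} (hF : DegLe F Δ) (S : Finset ι) (m : ℕ)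
    (hm : m * (Δ * Δ + 1) ≤ #S) : ∃ J ⊆ S, #J = m ∧ Indep2 F J := by
  obtain ⟨J, h1, h2, h3⟩ := exists_indep S (rel2 F) (fun a => Or.inl rfl) (fun a b => rel2_symm)
    (Δ * Δ + 1) (fun a _ => (card_le_card (filter_subset_filter _ (subset_univ S))).trans (rel2_card hF a))
  have : m ≤ #J := Nat.le_of_mul_le_mul_right (hm.trans h3) (by omega)
  obtain ⟨J', h4, h5⟩ := exists_subset_card_eq this
  exact ⟨J', h4.trans h1, h5, fun a ha b hb => h2 a (h4 ha) b (h4 hb)⟩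

lemma exists_indep4 [Fintype ι] {F : SimpleGraph ι} {Δ : ℕ} (hF : DegLe F Δ) (m : ℕ)
    (hm : m * ((Δ * Δ + 1) * (Δ * Δ + 1)) ≤ Fintype.card ι) : ∃ J : Finset ι, #J = m ∧
      ∀ a ∈ J, ∀ b ∈ J, rel4 F a b → a = b := by
  obtain ⟨J, h1, h2, h3⟩ := exists_indep univ (rel4 F) (fun a => ⟨a, Or.inl rfl, Or.inl rfl⟩)
    (fun a b ⟨c, h1, h2⟩ => ⟨c, rel2_symm h2, rel2_symm h1⟩)
    ((Δ * Δ + 1) * (Δ * Δ + 1)) (fun a _ => rel4_card hF a)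
  have : m ≤ #J := Nat.le_of_mul_le_mul_right (hm.trans h3) (by positivity)
  obtain ⟨J', h4, h5⟩ := exists_subset_card_eq this
  exact ⟨J', h5, fun a ha b hb => h2 a (h4 ha) b (h4 hb)⟩

/-- gadgets: every `x` sees many of the `w ∈ J` completely -/
lemma gadget_embed [Fintype ι] {F : SimpleGraph ι} {Δ e : ℕ} (hF : DegLe F Δ) {Y X : Finset V}
    {good : Finset V → Prop} (σ0 : ι → V) (h0 : good ∅)
    (hext : ∀ P, #P < Δ → good P → #{y ∈ Y | ¬ good (insert y P)} ≤ e)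
    {J K : Finset ι} (hJ : Indep2 F J) (hK : K = J.biUnion (fun w => univ.filter (F.Adj w)))
    (hcard : #K + Δ * e < #Y) (G : V → V → Prop) {η : ℝ} (hη0 : 0 < η) (hη1 : η ≤ 1)
    (hη : ∀ Ω ⊆ Y, #Y ≤ #Ω + #K + Δ * e → ∀ x ∈ X, η * #Ω ≤ #{y ∈ Ω | G x y}) :
    ∃ σ : ι → V, State F (fun _ => Y) (fun _ => good) K σ ∧
      ∀ x ∈ X, (1/2:ℝ) ^ #{w ∈ J | ∀ z ∈ pt F K σ w, G x z} ≤ #X * (1 - η ^ Δ / 2) ^ #J := by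
  set fx : V → ι → Finset ι → (ι → V) → ℝ := fun x w D σ =>
    if ∀ z ∈ pt F D σ w, G x z then 1 - η ^ #((univ.filter (F.Adj w)) \ D) / 2 else 1 with hfx
  have hpow : ∀ k : ℕ, η ^ k ≤ 1 := fun k => pow_le_one₀ hη0.le hη1
  have hpow0 : ∀ k : ℕ, 0 < η ^ k := fun k => pow_pos hη0 k
  have hfx0 : ∀ x w D σ, 0 ≤ fx x w D σ := by
    intro x w D σ
    simp only [hfx]
    split_ifs
    · have := hpow #((univ.filter (F.Adj w)) \ D); linarith
    · norm_num
  set W : Finset ι → (ι → V) → ℝ := fun D σ => ∑ x ∈ X, ∏ w ∈ J, fx x w D σ with hW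
  have hS : State F (fun _ => Y) (fun _ => good) ∅ σ0 := by
    refine ⟨by simp, by simp, ?_⟩
    intro w; simpa [pt] using h0
  obtain ⟨σ, -, h2, h3⟩ := seq_embed hS W (zero_le_one) K (by simp) (by
    intro D σ v _ h01 hv hvD hS'
    have hc := allowed_card (e := e) hF hvD (fun w hw => hext) hS'
    set Ω := Allowed F (fun _ => Y) (fun _ => good) D σ v with hΩ
    have hDc : #D ≤ #K := by simpa using card_le_card h01
    have hΩY : Ω ⊆ Y := fun y hy => (mem_Allowed.1 hy).1
    refine ⟨card_pos.1 (by omega), ?_⟩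
    simp only [hW]
    rw [sum_comm, one_mul, mul_sum]
    apply sum_le_sum
    intro x hx
    rw [hK, mem_biUnion] at hv
    obtain ⟨w0, hw0, hv0⟩ := hv
    simp only [mem_filter, mem_univ, true_and] at hv0
    have hother : ∀ w ∈ J.erase w0, ∀ y, fx x w (insert v D) (Function.update σ v y) = fx x w D σ := by
      intro w hw y
      have hadj : ¬ F.Adj w v := by
        intro h
        exact (mem_erase.1 hw).1 (hJ w (mem_erase.1 hw).2 w0 hw0 (Or.inr ⟨v, h, hv0⟩))
      simp only [hfx]
      rw [pt_insert_nadj hvD hadj]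
      have : (univ.filter (F.Adj w)) \ insert v D = (univ.filter (F.Adj w)) \ D := by
        ext z
        simp only [mem_sdiff, mem_filter, mem_univ, true_and, mem_insert]
        constructor
        · rintro ⟨a, b⟩; exact ⟨a, fun h => b (Or.inr h)⟩
        · rintro ⟨a, b⟩; refine ⟨a, ?_⟩
          rintro (rfl | h)
          · exact hadj a
          · exact b h
      rw [this]
    have hsplit : ∀ y, ∏ w ∈ J, fx x w (insert v D) (Function.update σ v y) =
        fx x w0 (insert v D) (Function.update σ v y) * ∏ w ∈ J.erase w0, fx x w D σ := by
      intro y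
      rw [← mul_prod_erase J _ hw0]
      congr 1
      exact prod_congr rfl (fun w hw => hother w hw y)
    simp_rw [hsplit]
    rw [← sum_mul, ← mul_prod_erase J _ hw0, ← mul_assoc]
    have hpn : 0 ≤ ∏ w ∈ J.erase w0, fx x w D σ := prod_nonneg (fun w _ => hfx0 x w D σ)
    apply mul_le_mul_of_nonneg_right _ hpn
    obtain ⟨k, hk⟩ : ∃ k, #((univ.filter (F.Adj w0)) \ D) = k + 1 ∧
        #((univ.filter (F.Adj w0)) \ insert v D) = k := by
      have hm : v ∈ (univ.filter (F.Adj w0)) \ D := by simp [hv0, hvD]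
      have : (univ.filter (F.Adj w0)) \ insert v D = ((univ.filter (F.Adj w0)) \ D).erase v := by
        ext z; simp only [mem_sdiff, mem_filter, mem_univ, true_and, mem_insert, mem_erase]; tauto
      rw [this, card_erase_of_mem hm]
      have := card_pos.2 ⟨v, hm⟩
      exact ⟨_, by omega, rfl⟩
    by_cases hP : ∀ z ∈ pt F D σ w0, G x z
    · have h4 : ∀ y ∈ Ω, fx x w0 (insert v D) (Function.update σ v y) =
          1 - (if G x y then η ^ k / 2 else 0) := by
        intro y _
        simp only [hfx]
        rw [pt_insert_adj hvD hv0, hk.2]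
        by_cases hg : G x y
        · rw [if_pos, if_pos hg]
          intro z hz
          rcases mem_insert.1 hz with rfl | hz
          · exact hg
          · exact hP z hz
        · rw [if_neg, if_neg hg, sub_zero]
          intro h
          exact hg (h y (mem_insert_self _ _))
      rw [sum_congr rfl h4, sum_sub_distrib, ← sum_filter, sum_const, sum_const, nsmul_eq_mul,
        nsmul_eq_mul, mul_one]
      simp only [hfx]
      rw [if_pos hP, hk.1, pow_succ]
      have h5 := hη Ω hΩY (by omega) x hx
      have h6 := hpow0 k
      have : η * #Ω * η ^ k ≤ #{y ∈ Ω | G x y} * η ^ k := by gcongr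
      nlinarith
    · have h4 : ∀ y ∈ Ω, fx x w0 (insert v D) (Function.update σ v y) = 1 := by
        intro y _
        simp only [hfx]
        rw [pt_insert_adj hvD hv0, if_neg]
        intro h
        exact hP (fun z hz => h z (mem_insert_of_mem hz))
      rw [sum_congr rfl h4]
      simp only [hfx]
      rw [if_neg hP]
      simp)
  rw [empty_union] at h2 h3
  refine ⟨σ, h2, ?_⟩
  intro x hx
  have hfin : ∏ w ∈ J, fx x w K σ = (1/2:ℝ) ^ #{w ∈ J | ∀ z ∈ pt F K σ w, G x z} := by
    rw [← prod_const, prod_filter]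
    apply prod_congr rfl
    intro w hw
    simp only [hfx]
    have : (univ.filter (F.Adj w)) \ K = ∅ := by
      rw [sdiff_eq_empty_iff_subset, hK]
      intro z hz
      exact mem_biUnion.2 ⟨w, hw, hz⟩
    rw [this]
    norm_num
  have hini : ∀ x, ∏ w ∈ J, fx x w ∅ σ0 ≤ (1 - η ^ Δ / 2) ^ #J := by
    intro x
    rw [← prod_const]
    apply prod_le_prod
    · intro w _; exact hfx0 x w _ _
    · intro w _
      simp only [hfx]
      rw [if_pos (by simp [pt])]
      have : η ^ Δ ≤ η ^ #((univ.filter (F.Adj w)) \ ∅) := by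
        apply pow_le_pow_of_le_one hη0.le hη1
        simpa using hF w
      linarith
  rw [← hfin]
  calc _ ≤ W K σ := single_le_sum (f := fun x => ∏ w ∈ J, fx x w K σ)
          (fun x _ => prod_nonneg (fun w _ => hfx0 x w _ _)) hx
    _ ≤ W ∅ σ0 := by simpa using h3
    _ ≤ ∑ x ∈ X, (1 - η ^ Δ / 2) ^ #J := sum_le_sum (fun x _ => hini x)
    _ = _ := by simp

/-- exact embedding of the right side -/
lemma engine [Fintype ι] {F : SimpleGraph ι} {Δ e g h : ℕ} (hF : DegLe F Δ) {Y : Finset V}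
    {good : Finset V → Prop} (hg : 0 < g)
    {D0 : Finset ι} {σ0 : ι → V} (hS : State F (fun _ => Y) (fun _ => good) D0 σ0)
    (hY : #Y = Fintype.card ι)
    (hext : ∀ P, #P ≤ Δ → good P → #{y ∈ Y | ¬ good (insert y P)} ≤ e)
    (hsing : ∀ y ∈ Y, good {y})
    {J : Finset ι} (hJ : Indep2 F J) (hJD : Disjoint D0 J)
    (hge : g + Δ * e ≤ #J) (hhe : h + Δ * e ≤ #J)
    {τ : Type*} (T : Finset τ) (test : τ → Finset V → Prop)
    (htest : ∀ i ∈ T, ∀ P, #P < Δ → test i P → #{y ∈ Y | ¬ test i (insert y P)} ≤ e)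
    (htest0 : ∀ i ∈ T, test i ∅)
    (hM : (1 + Δ * e * 2 ^ Δ / g : ℝ) ^ (Fintype.card ι) *
      ((#T + Fintype.card ι) * 2 ^ (Δ * #D0)) ≤ 2 ^ h) :
    ∃ σ, (∀ u ∈ D0, σ u = σ0 u) ∧ State F (fun _ => Y) (fun _ => good) univ σ ∧
      ∀ i ∈ T, #{w | ¬ test i (pt F univ σ w)} ≤ h + Δ * #J := by
  set K := (univ \ D0) \ J with hKdef
  have hK : Disjoint D0 K := by
    rw [disjoint_left]; intro a ha hb; simp [hKdef, ha] at hb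
  have hDK : D0 ∪ K = univ \ J := by
    ext a; simp only [mem_union, hKdef, mem_sdiff, mem_univ, true_and]
    constructor
    · rintro (h | h)
      · exact disjoint_left.1 hJD h
      · exact h.2
    · intro h; by_cases h2 : a ∈ D0 <;> tauto
  have hcJ : #(D0 ∪ K) + #J = Fintype.card ι := by
    rw [hDK, card_sdiff_add_card_eq_card (subset_univ J), card_univ]
  have hcDK : #(D0 ∪ K) = #D0 + #K := card_union_of_disjoint hK
  set test' : τ ⊕ V → Finset V → Prop := fun s P => Sum.elim (fun i => test i P)
    (fun y => good (insert y P)) s with htest'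
  have hfail0 : ∀ s ∈ T.disjSum Y, #{w | ¬ test' s (pt F D0 σ0 w)} ≤ Δ * #D0 := by
    intro s hs
    have : (univ.filter (fun w => ¬ test' s (pt F D0 σ0 w))) ⊆
        D0.biUnion (fun u => univ.filter (F.Adj u)) := by
      intro w hw
      simp only [mem_filter, mem_univ, true_and] at hw
      by_contra hcon
      apply hw
      have hpt : pt F D0 σ0 w = ∅ := by
        unfold pt
        rw [image_eq_empty, filter_eq_empty_iff]
        intro u hu hadj
        exact hcon (mem_biUnion.2 ⟨u, hu, by simp [hadj.symm]⟩)
      rw [hpt]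
      rcases mem_disjSum.1 hs with ⟨i, hi, rfl⟩ | ⟨y, hy, rfl⟩
      · exact htest0 i hi
      · exact hsing y hy
    refine (card_le_card this).trans ((card_biUnion_le_card_mul _ _ Δ (fun u _ => hF u)).trans ?_)
    rw [mul_comm]
  obtain ⟨σ, h1, h2, h3⟩ := test_embed hF hg hS (fun P hP => hext P hP.le) K hK (by omega)
    (T.disjSum Y) test' (by
      intro s hs P hP ht
      rcases mem_disjSum.1 hs with ⟨i, hi, rfl⟩ | ⟨y, hy, rfl⟩
      · exact htest i hi P hP ht
      · have := hext (insert y P) ((card_insert_le _ _).trans hP) ht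
        simp only [htest', Sum.elim_inr]
        simp_rw [insert_comm y]
        exact this)
    ((#T + Fintype.card ι) * 2 ^ (Δ * #D0)) (by
      calc _ ≤ ∑ s ∈ T.disjSum Y, (2:ℝ) ^ (Δ * #D0) := by
            apply sum_le_sum
            intro s hs
            exact pow_le_pow_right₀ one_le_two (hfail0 s hs)
        _ = _ := by rw [sum_const, card_disjSum, nsmul_eq_mul, hY]; push_cast; ring)
  have hKle : #K ≤ Fintype.card ι := card_le_univ K
  have h4 : ∀ s ∈ T.disjSum Y, #{w | ¬ test' s (pt F (D0 ∪ K) σ w)} ≤ h := by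
    intro s hs
    have := h3 s hs
    have h5 : (1 + Δ * e * 2 ^ Δ / g : ℝ) ^ #K * ((#T + Fintype.card ι) * 2 ^ (Δ * #D0)) ≤ 2 ^ h := by
      refine le_trans ?_ hM
      gcongr
      have : (0:ℝ) ≤ Δ * e * 2 ^ Δ / g := by positivity
      linarith
    have h6 := this.trans h5
    exact (pow_le_pow_iff_right₀ (one_lt_two : (1:ℝ) < 2)).1 h6
  set D := D0 ∪ K with hD
  set Yr := Y \ D.image σ with hYr
  have hYrc : #Yr = #J := by
    have hi : D.image σ ⊆ Y := by
      intro y hy; obtain ⟨u, hu, rfl⟩ := mem_image.1 hy; exact h2.2.1 u hu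
    rw [hYr, card_sdiff_of_subset hi, card_image_of_injOn h2.1]
    omega
  set N : ι → Finset V := fun j => {y ∈ Yr | ∀ w, F.Adj w j → good (insert y (pt F D σ w))} with hN
  have hJnD : ∀ j ∈ J, j ∉ D := by intro j hj; rw [hDK]; simp [hj]
  have hdegj : ∀ j ∈ J, #J ≤ #(N j) + Δ * e := by
    intro j hj
    have hc := allowed_card (e := e) hF (hJnD j hj) (fun w hw P hP => hext P hP.le) h2
    have : Allowed F (fun _ => Y) (fun _ => good) D σ j = N j := by
      ext y
      rw [mem_Allowed]
      simp only [hN, hYr, mem_filter, mem_sdiff]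
      tauto
    rw [this] at hc
    omega
  obtain ⟨f, hf1, hf2, hf3⟩ := hall_finset J N σ (by
    intro A hA
    by_cases hAe : A = ∅
    · simp [hAe]
    obtain ⟨j0, hj0⟩ := nonempty_iff_ne_empty.2 hAe
    by_cases hAh : #A ≤ h
    · have h5 := hdegj j0 (hA hj0)
      have h6 : #(N j0) ≤ #(A.biUnion N) := card_le_card (subset_biUnion_of_mem N hj0)
      omega
    · have : Yr ⊆ A.biUnion N := by
        intro y hy
        by_contra hcon
        have hyY : y ∈ Y := (mem_sdiff.1 hy).1
        have h5 := h4 (Sum.inr y) (by simp [hyY])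
        -- every j in A gives a failing w
        have h6 : ∀ j ∈ A, ∃ w, F.Adj w j ∧ ¬ good (insert y (pt F D σ w)) := by
          intro j hj
          by_contra hc
          push Not at hc
          apply hcon
          rw [mem_biUnion]
          exact ⟨j, hj, by simp only [hN, mem_filter]; exact ⟨hy, hc⟩⟩
        choose! ww hw1 hw2 using h6
        have h7 : #A ≤ #{w | ¬ test' (Sum.inr y) (pt F D σ w)} := by
          apply card_le_card_of_injOn ww
          · intro j hj
            simp only [coe_filter, mem_univ, true_and, Set.mem_ofPred_eq]
            exact hw2 j hj
          · intro j hj j' hj' hjj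
            refine hJ j (hA hj) j' (hA hj') (Or.inr ⟨ww j, (hw1 j hj).symm, ?_⟩)
            rw [hjj]; exact (hw1 j' hj').symm
        omega
      calc #A ≤ #J := card_le_card hA
        _ = #Yr := hYrc.symm
        _ ≤ _ := card_le_card this)
  have hfD : ∀ u ∈ D, f u = σ u := by
    intro u hu
    exact hf3 u (fun hj => hJnD u hj hu)
  have hDJ : ∀ u, u ∈ D ∨ u ∈ J := by intro u; rw [hDK]; simp; tauto
  have hptJ : ∀ w j, j ∈ J → F.Adj w j → pt F univ f w = insert (f j) (pt F D σ w) := by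
    intro w j hj hadj
    rw [← pt_congr (F := F) (w := w) hfD]
    ext z
    simp only [pt, mem_image, mem_filter, mem_univ, true_and, mem_insert]
    constructor
    · rintro ⟨u, hu, rfl⟩
      rcases hDJ u with h | h
      · right; exact ⟨u, ⟨h, hu⟩, rfl⟩
      · left; rw [hJ u h j hj (Or.inr ⟨w, hu.symm, hadj.symm⟩)]
    · rintro (rfl | ⟨u, hu, rfl⟩)
      · exact ⟨j, hadj, rfl⟩
      · exact ⟨u, hu.2, rfl⟩
  have hptN : ∀ w, (∀ j ∈ J, ¬ F.Adj w j) → pt F univ f w = pt F D σ w := by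
    intro w hw
    rw [← pt_congr (F := F) (w := w) hfD]
    ext z
    simp only [pt, mem_image, mem_filter, mem_univ, true_and]
    constructor
    · rintro ⟨u, hu, rfl⟩
      rcases hDJ u with h | h
      · exact ⟨u, ⟨h, hu⟩, rfl⟩
      · exact absurd hu (hw u h)
    · rintro ⟨u, hu, rfl⟩; exact ⟨u, hu.2, rfl⟩
  refine ⟨f, ?_, ⟨?_, ?_, ?_⟩, ?_⟩
  · intro u hu
    rw [hfD u (by simp [hD, hu]), h1 u hu]
  · have hcross : ∀ a b, a ∈ D → b ∈ J → f a ≠ f b := by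
      intro a b ha hb hab
      have h5 := hf2 b hb
      simp only [hN, hYr, mem_filter, mem_sdiff] at h5
      apply h5.1.2
      rw [← hab, hfD a ha]
      exact mem_image_of_mem _ ha
    intro a _ b _ hab
    rcases hDJ a with ha | ha <;> rcases hDJ b with hb | hb
    · rw [hfD a ha, hfD b hb] at hab
      exact h2.1 ha hb hab
    · exact absurd hab (hcross a b ha hb)
    · exact absurd hab.symm (hcross b a hb ha)
    · exact hf1 ha hb hab
  · intro u _
    rcases hDJ u with h | h
    · rw [hfD u h]; exact h2.2.1 u h
    · have h5 := hf2 u h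
      simp only [hN, hYr, mem_filter, mem_sdiff] at h5
      exact h5.1.1
  · intro w
    by_cases hw : ∃ j ∈ J, F.Adj w j
    · obtain ⟨j, hj, hadj⟩ := hw
      rw [hptJ w j hj hadj]
      have h5 := hf2 j hj
      simp only [hN, mem_filter] at h5
      exact h5.2 w hadj
    · push Not at hw
      rw [hptN w hw]
      exact h2.2.2 w
  · intro i hi
    have h5 := h4 (Sum.inl i) (by simp [hi])
    have : (univ.filter (fun w => ¬ test i (pt F univ f w))) ⊆
        (univ.filter (fun w => ¬ test' (Sum.inl i) (pt F D σ w))) ∪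
        J.biUnion (fun u => univ.filter (F.Adj u)) := by
      intro w hw
      simp only [mem_filter, mem_univ, true_and, mem_union, mem_biUnion] at hw ⊢
      by_cases hw' : ∃ j ∈ J, F.Adj j w
      · right; exact hw'
      · left
        push Not at hw'
        rw [hptN w (fun j hj hadj => hw' j hj hadj.symm)] at hw
        exact hw
    refine (card_le_card this).trans ((card_union_le _ _).trans (Nat.add_le_add h5 ?_))
    rw [mul_comm]
    exact card_biUnion_le_card_mul _ _ Δ (fun u _ => hF u)

end Tiling

namespace Tiling
open Finset Classical

variable {V ι : Type*}

/-- common neighbourhood of `P` in `X` -/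
noncomputable def cn (G : V → V → Prop) (X : Finset V) (P : Finset V) : Finset V :=
  X.filter (fun x => ∀ z ∈ P, G x z)

lemma mem_cn {G : V → V → Prop} {X P : Finset V} {x : V} : x ∈ cn G X P ↔ x ∈ X ∧ ∀ z ∈ P, G x z := by
  unfold cn; rw [mem_filter]

lemma cn_insert {G : V → V → Prop} {X P : Finset V} {y : V} :
    cn G X (insert y P) = (cn G X P).filter (fun x => G x y) := by
  ext x; simp only [mem_cn, mem_filter, mem_insert, forall_eq_or_imp]; tauto

lemma cn_empty {G : V → V → Prop} {X : Finset V} : cn G X ∅ = X := by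
  ext x; simp [mem_cn]

lemma cn_anti {G : V → V → Prop} {X P Q : Finset V} (h : P ⊆ Q) : cn G X Q ⊆ cn G X P := by
  intro x hx; rw [mem_cn] at hx ⊢; exact ⟨hx.1, fun z hz => hx.2 z (h hz)⟩

def LowReg (G : V → V → Prop) (X Y : Finset V) (R k0 : ℕ) : Prop :=
  ∀ X' ⊆ X, k0 ≤ #X' → #{y ∈ Y | R * #{x ∈ X' | G x y} < #X'} ≤ k0

lemma lr_lost {G : V → V → Prop} {X Y : Finset V} {R k0 K e : ℕ} (hR : 0 < R)
    (hLR : LowReg G X Y R k0) {U : Finset V} (hUX : U ⊆ X) (hU : k0 * R ^ K ≤ #U)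
    {g0 : Finset V → Prop} {k : ℕ} {P : Finset V} (hk : k ≤ K) (hP : #U ≤ R ^ (K - k) * #(cn G U P))
    (hl : lost Y e g0 k P) (bad : (Fin k → V) → Prop)
    (hbad : ∀ q, #U ≤ R ^ K * #(cn G U (P ∪ univ.image q)) → ¬ g0 (P ∪ univ.image q) → bad q) :
    (e + 1 - k0) ^ k ≤ #{q ∈ Fintype.piFinset (fun _ : Fin k => Y) | bad q} := by
  obtain ⟨ok, hok⟩ : ∃ ok : ℕ → Finset V → Prop, ∀ k P, ok k P ↔
    (k ≤ K ∧ #U ≤ R ^ (K - k) * #(cn G U P)) := ⟨_, fun _ _ => Iff.rfl⟩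
  refine (lost_count ok (e1 := k0) ?_ k P ((hok _ _).2 ⟨hk, hP⟩) hl).trans ?_
  · intro k P hkP
    obtain ⟨hk, hP⟩ := (hok _ _).1 hkP
    have hc : k0 ≤ #(cn G U P) := by
      have h1 : R ^ (K - (k+1)) ≤ R ^ K := Nat.pow_le_pow_right hR (by omega)
      have h2 : k0 * R ^ K ≤ #(cn G U P) * R ^ K := by
        calc _ ≤ _ := hU
          _ ≤ _ := hP
          _ ≤ R ^ K * #(cn G U P) := Nat.mul_le_mul_right _ h1
          _ = _ := mul_comm _ _
      exact Nat.le_of_mul_le_mul_right h2 (by positivity)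
    refine le_trans (card_le_card ?_) (hLR (cn G U P) ((filter_subset _ _).trans hUX) hc)
    intro y hy
    rw [mem_filter] at hy ⊢
    refine ⟨hy.1, ?_⟩
    by_contra hcon
    apply hy.2
    refine (hok _ _).2 ⟨by omega, ?_⟩
    rw [cn_insert]
    have e1 : K - k = (K - (k+1)) + 1 := by omega
    rw [e1, pow_succ, mul_assoc]
    exact hP.trans (Nat.mul_le_mul_left _ (not_lt.1 hcon))
  · apply card_le_card
    intro q hq
    rw [mem_filter] at hq ⊢
    refine ⟨hq.1, hbad q ?_ hq.2.2⟩
    have := ((hok _ _).1 hq.2.1).2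
    simpa using this

/-- averaging over tuples of `U` -/
lemma exists_hitting {G : V → V → Prop} {U Y : Finset V} {K s R : ℕ} (hR : 0 < R) (hU : 0 < #U) :
    ∃ S ∈ Fintype.piFinset (fun _ : Fin s => U), ∀ bad : (Fin K → V) → Prop,
      (∀ q, bad q → #U ≤ R ^ K * #(cn G U (univ.image q)) ∧ ¬ ∃ i, ∀ z ∈ univ.image q, G (S i) z) →
      (#{q ∈ Fintype.piFinset (fun _ : Fin K => Y) | bad q} : ℝ) ≤
      (#Y) ^ K * (1 - 1 / R ^ K) ^ s := by
  obtain ⟨miss, hmiss⟩ : ∃ miss : (Fin s → V) → (Fin K → V) → Prop, ∀ S q, miss S q ↔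
    ¬ ∃ i, ∀ z ∈ univ.image q, G (S i) z := ⟨_, fun _ _ => Iff.rfl⟩
  set Q := (Fintype.piFinset (fun _ : Fin K => Y)).filter
    (fun q => #U ≤ R ^ K * #(cn G U (univ.image q))) with hQ
  set Ss := Fintype.piFinset (fun _ : Fin s => U) with hSs
  have hSc : #Ss = #U ^ s := by simp [hSs]
  have hne : Ss.Nonempty := card_pos.1 (by rw [hSc]; positivity)
  have hUR : (0:ℝ) < #U := by exact_mod_cast hU
  have hRR : (0:ℝ) < R ^ K := by positivity
  suffices hsuff : ∃ S ∈ Ss, (#{q ∈ Q | miss S q} : ℝ) ≤ (#Y) ^ K * (1 - 1 / R ^ K) ^ s by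
    obtain ⟨S, hS, hle⟩ := hsuff
    refine ⟨S, hS, fun bad hbad => le_trans ?_ hle⟩
    have : #{q ∈ Fintype.piFinset (fun _ : Fin K => Y) | bad q} ≤ #{q ∈ Q | miss S q} := by
      apply card_le_card
      intro q hq
      rw [mem_filter] at hq ⊢
      obtain ⟨h1, h2⟩ := hbad q hq.2
      exact ⟨mem_filter.2 ⟨hq.1, h1⟩, (hmiss _ _).2 h2⟩
    exact_mod_cast this
  apply exists_le_of_sum_le hne
  have hdc : ∑ S ∈ Ss, (#{q ∈ Q | miss S q} : ℝ) =
      ∑ q ∈ Q, (#{S ∈ Ss | miss S q} : ℝ) := by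
    have := sum_card_bipartiteAbove_eq_sum_card_bipartiteBelow (s := Ss) (t := Q)
      miss
    unfold bipartiteAbove bipartiteBelow at this
    exact_mod_cast this
  rw [hdc]
  have hq : ∀ q ∈ Q, (#{S ∈ Ss | miss S q} : ℝ) ≤
      #U ^ s * (1 - 1 / R ^ K) ^ s := by
    intro q hq
    have h1 : {S ∈ Ss | miss S q} ⊆
        Fintype.piFinset (fun _ : Fin s => U \ cn G U (univ.image q)) := by
      intro S hS
      rw [mem_filter] at hS
      rw [Fintype.mem_piFinset]
      intro i
      rw [mem_sdiff]
      have hSi := Fintype.mem_piFinset.1 hS.1 i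
      refine ⟨hSi, ?_⟩
      intro hc
      exact (hmiss _ _).1 hS.2 ⟨i, (mem_cn.1 hc).2⟩
    have h2 := card_le_card h1
    rw [Fintype.card_piFinset_const] at h2
    have h3 : #(U \ cn G U (univ.image q)) + #(cn G U (univ.image q)) = #U :=
      card_sdiff_add_card_eq_card (filter_subset _ _)
    have h4 : #U ≤ R ^ K * #(cn G U (univ.image q)) := (mem_filter.1 hq).2
    have h5 : (#(U \ cn G U (univ.image q)) : ℝ) ≤ #U * (1 - 1 / R ^ K) := by
      have h3' : (#(U \ cn G U (univ.image q)) : ℝ) + #(cn G U (univ.image q)) = #U := by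
        exact_mod_cast h3
      have h4' : (#U : ℝ) ≤ R ^ K * #(cn G U (univ.image q)) := by exact_mod_cast h4
      have : (#U : ℝ) / R ^ K ≤ #(cn G U (univ.image q)) := by
        rw [div_le_iff₀ hRR]; linarith
      have e1 : (#U : ℝ) * (1 - 1 / R ^ K) = #U - #U / R ^ K := by ring
      linarith
    calc (#{S ∈ Ss | miss S q} : ℝ)
        ≤ (#(U \ cn G U (univ.image q)) : ℝ) ^ s := by exact_mod_cast h2
      _ ≤ (#U * (1 - 1 / R ^ K)) ^ s := by gcongr
      _ = _ := mul_pow _ _ _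
  have h1R : (1:ℝ) / R ^ K ≤ 1 := by
    rw [div_le_one hRR]
    exact one_le_pow₀ (by exact_mod_cast hR)
  have h01 : (0:ℝ) ≤ 1 - 1 / R ^ K := by linarith
  calc _ ≤ ∑ q ∈ Q, (#U ^ s * (1 - 1 / R ^ K) ^ s : ℝ) := sum_le_sum hq
    _ = #Q * (#U ^ s * (1 - 1 / R ^ K) ^ s) := by rw [sum_const, nsmul_eq_mul]
    _ ≤ (#Y) ^ K * (#U ^ s * (1 - 1 / R ^ K) ^ s) := by
        gcongr
        have : #Q ≤ #Y ^ K := by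
          refine (card_le_card (filter_subset _ _)).trans ?_
          simp
        exact_mod_cast this
    _ = ∑ S ∈ Ss, _ := by
        rw [sum_const, nsmul_eq_mul, hSc]; push_cast; ring

lemma spanning_core [Fintype ι] {F : SimpleGraph ι} {Δ : ℕ} (hF : DegLe F Δ) {X Y : Finset V}
    {t R K k0 m q k3 h g s : ℕ} (hK : Δ < K) (hR : 0 < R)
    (ht : Fintype.card ι = t) (hX : #X = t) (hY : #Y = t) (ht0 : 0 < t)
    {G : V → V → Prop} (hLR : LowReg G X Y R k0)
    (hdx : ∀ x ∈ X, t ≤ R * #{y ∈ Y | G x y}) (hdy : ∀ y ∈ Y, t ≤ R * #{x ∈ X | G x y})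
    (ha' : k0 * R ^ K ≤ k3) (hk3 : 0 < k3) (hk3t : k3 ≤ t) (h2k : 2 * k0 < t)
    (hb : m * (Δ * Δ + 1) ≤ t)
    (hc : 2 * R * (Δ * m + Δ * (2 * k0)) ≤ t) (hc' : Δ * m + Δ * (2 * k0) < t)
    (hd : (t:ℝ) * (1 - (1 / (2 * R)) ^ Δ / 2) ^ m < (1/2) ^ k3)
    (he : q * (Δ * Δ + 1) + Δ * m ≤ t)
    (hg : 0 < g) (hf : g + Δ * (2 * k0) ≤ q) (hf' : h + Δ * (2 * k0) ≤ q)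
    (hM : (1 + Δ * (2 * k0) * 2 ^ Δ / g : ℝ) ^ t * ((t ^ s + t) * 2 ^ (Δ * (Δ * m))) ≤ 2 ^ h)
    (hh : (h + Δ * q) * R ^ K < t)
    (hi : (t:ℝ) ^ K * (1 - 1 / R ^ K) ^ s < (k0 + 1) ^ K) :
    ∃ lam σ : ι → V, Function.Injective lam ∧ Function.Injective σ ∧ (∀ u, lam u ∈ X) ∧
      (∀ u, σ u ∈ Y) ∧ ∀ u v, F.Adj u v → G (lam u) (σ v) := by
  have ha : k0 * R ^ K ≤ #X := by omega
  set e := 2 * k0 with hedef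
  set g0 : Finset V → Prop := fun P => t ≤ R ^ K * #(cn G X P) with hg0
  set good := Good Y e g0 K with hgood
  have hext : ∀ P, #P ≤ Δ → good P → #{y ∈ Y | ¬ good (insert y P)} ≤ e :=
    fun P hP hgP => good_ext (by omega) hgP
  have hnl : ∀ k P, k ≤ K → #X ≤ R ^ (K - k) * #(cn G X P) → ¬ lost Y e g0 k P := by
    intro k P hk hP hl
    have := lr_lost hR hLR (subset_refl X) ha hk hP hl (fun _ => False) (by
      intro q h1 h2
      apply h2
      simp only [hg0]; omega)
    simp only [filter_false, card_empty] at this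
    have : 0 < (e + 1 - k0) ^ k := by
      apply Nat.pow_pos; omega
    omega
  have hgood0 : good ∅ := by
    simp only [hgood, Good, card_empty, Nat.sub_zero]
    apply hnl K ∅ le_rfl
    simp [cn_empty]
  have hsing : ∀ y ∈ Y, good {y} := by
    intro y hy
    simp only [hgood, Good, card_singleton]
    apply hnl (K-1) {y} (by omega)
    have e1 : K - (K - 1) = 1 := by omega
    have e2 : cn G X {y} = {x ∈ X | G x y} := by ext x; simp [mem_cn]
    rw [e1, e2, pow_one, hX]
    exact hdy y hy
  have hne : Nonempty V := by
    have : Y.Nonempty := card_pos.1 (by omega)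
    exact ⟨this.choose⟩
  have hRR : (0:ℝ) < R := by exact_mod_cast hR
  have hR1 : (1:ℝ) ≤ R := by exact_mod_cast hR
  -- gadgets
  obtain ⟨Jg, -, hJgc, hJg⟩ := exists_indep2 hF univ m (by rw [card_univ, ht]; exact hb)
  set D0 := Jg.biUnion (fun w => univ.filter (F.Adj w)) with hD0
  have hD0c : #D0 ≤ Δ * m := by
    rw [hD0, ← hJgc, mul_comm]
    exact card_biUnion_le_card_mul _ _ Δ (fun u _ => hF u)
  obtain ⟨σg, hSg, hgad⟩ := gadget_embed hF (X := X) (fun _ => hne.some) hgood0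
    (fun P hP => hext P hP.le) hJg hD0 (by omega) G (η := 1 / (2 * R)) (by positivity)
    (by rw [div_le_one (by positivity)]; linarith) (by
      intro Ω hΩ hΩc x hx
      have h1 := hdx x hx
      have h2 : #{y ∈ Y | G x y} ≤ #{y ∈ Ω | G x y} + #(Y \ Ω) := by
        rw [← card_union_of_disjoint]
        · apply card_le_card
          intro y hy
          simp only [mem_filter, mem_union, mem_sdiff] at hy ⊢
          tauto
        · rw [disjoint_left]; intro y hy hy'
          simp only [mem_filter, mem_sdiff] at hy hy'
          exact hy'.2 hy.1
      have h3 : #(Y \ Ω) + #Ω = #Y := card_sdiff_add_card_eq_card hΩ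
      have h4 : t ≤ 2 * R * #{y ∈ Ω | G x y} := by
        have h5 : #(Y \ Ω) ≤ Δ * m + Δ * e := by omega
        have h6 : 2 * R * #(Y \ Ω) ≤ t := (Nat.mul_le_mul_left _ h5).trans hc
        have h7 : R * #{y ∈ Y | G x y} ≤ R * #{y ∈ Ω | G x y} + R * #(Y \ Ω) := by
          rw [← mul_add]; exact Nat.mul_le_mul_left _ h2
        nlinarith
      rw [div_mul_eq_mul_div, one_mul, div_le_iff₀ (by positivity)]
      have h8 : #Ω ≤ t := by omega
      have h9 : (#Ω : ℝ) ≤ t := by exact_mod_cast h8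
      have h10 : (t:ℝ) ≤ 2 * R * #{y ∈ Ω | G x y} := by exact_mod_cast h4
      linarith)
  have hgad' : ∀ x ∈ X, k3 ≤ #{w ∈ Jg | ∀ z ∈ pt F D0 σg w, G x z} := by
    intro x hx
    have h1 := hgad x hx
    rw [hX, hJgc] at h1
    have h2 := h1.trans_lt hd
    rw [pow_lt_pow_iff_right_of_lt_one₀ (by norm_num) (by norm_num)] at h2
    exact h2.le
  -- remaining vertices
  obtain ⟨J, hJsub, hJc, hJ⟩ := exists_indep2 hF (univ \ D0) q (by
    rw [card_sdiff_of_subset (subset_univ _), card_univ, ht]; omega)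
  have hJD : Disjoint D0 J := by
    rw [disjoint_left]; intro a ha hb; have := hJsub hb; simp [ha] at this
  set gS : (Fin s → V) → Finset V → Prop := fun S P => ∃ i, ∀ z ∈ P, G (S i) z with hgS
  set T := (Fintype.piFinset (fun _ : Fin s => X)).filter (fun S => Good Y e (gS S) K ∅) with hT
  have hTc : #T ≤ t ^ s := by
    refine (card_le_card (filter_subset _ _)).trans ?_
    simp [hX]
  obtain ⟨σ, hσ0, hσS, hσT⟩ := engine hF hg hSg (by omega) hext hsing hJ hJD (by rw [hJc]; exact hf)
    (by rw [hJc]; exact hf') T (fun S => Good Y e (gS S) K) (by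
      intro S _ P hP hgP
      exact good_ext (by omega) hgP) (fun S hS => (mem_filter.1 hS).2) (by
      rw [ht]
      refine le_trans ?_ hM
      have : (#T : ℝ) ≤ t ^ s := by exact_mod_cast hTc
      rw [hedef]
      push_cast
      gcongr
      · norm_num)
  rw [hJc] at hσT
  have hpt : ∀ w ∈ Jg, pt F univ σ w = pt F D0 σg w := by
    intro w hw
    rw [← pt_congr (F := F) (w := w) hσ0]
    unfold pt
    congr 1
    ext u
    simp only [mem_filter, mem_univ, true_and]
    constructor
    · intro h; exact ⟨mem_biUnion.2 ⟨w, hw, by simp [h]⟩, h⟩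
    · exact fun h => h.2
  set N : ι → Finset V := fun w => cn G X (pt F univ σ w) with hN
  have hNdeg : ∀ w, t ≤ R ^ K * #(N w) := by
    intro w
    have := good_final (g0 := g0) (by
      intro P Q hPQ hQ
      simp only [hg0] at hQ ⊢
      exact hQ.trans (Nat.mul_le_mul_left _ (card_le_card (cn_anti hPQ)))) (by omega) (hσS.2.2 w)
    exact this
  obtain ⟨lam, hl1, hl2, -⟩ := hall_finset (univ : Finset ι) N (fun _ => hne.some) (by
    intro Q _
    by_contra hcon
    push Not at hcon
    set U := X \ Q.biUnion N with hU
    have hNX : Q.biUnion N ⊆ X := by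
      intro x hx; obtain ⟨w, _, hx⟩ := mem_biUnion.1 hx; exact (mem_cn.1 hx).1
    have hUc : #U + #(Q.biUnion N) = t := by rw [hU, card_sdiff_add_card_eq_card hNX, hX]
    have hQt : #Q ≤ t := by rw [← ht]; exact card_le_univ Q
    have hUpos : 0 < #U := by omega
    obtain ⟨x, hx⟩ := card_pos.1 hUpos
    have hQne : Q.Nonempty := card_pos.1 (by omega)
    obtain ⟨w0, hw0⟩ := hQne
    have h1 : t ≤ R ^ K * #Q := by
      refine (hNdeg w0).trans (Nat.mul_le_mul_left _ ?_)
      exact (card_le_card (subset_biUnion_of_mem N hw0)).trans hcon.le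
    have hUk3 : k3 ≤ #U := by
      have h2 := hgad' x (mem_sdiff.1 hx).1
      have h3 : Disjoint Q {w ∈ Jg | ∀ z ∈ pt F D0 σg w, G x z} := by
        rw [disjoint_left]
        intro w hw hw'
        rw [mem_filter] at hw'
        apply (mem_sdiff.1 hx).2
        refine mem_biUnion.2 ⟨w, hw, mem_cn.2 ⟨(mem_sdiff.1 hx).1, ?_⟩⟩
        rw [hpt w hw'.1]; exact hw'.2
      have h4 := card_union_of_disjoint h3
      have h5 := card_le_univ (Q ∪ {w ∈ Jg | ∀ z ∈ pt F D0 σg w, G x z})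
      omega
    obtain ⟨S, hS, hScount⟩ := exists_hitting (G := G) (Y := Y) (K := K) (s := s) hR hUpos
    have hSU : ∀ i, S i ∈ U := Fintype.mem_piFinset.1 hS
    have hST : S ∈ T := by
      rw [hT, mem_filter]
      refine ⟨Fintype.mem_piFinset.2 (fun i => (mem_sdiff.1 (hSU i)).1), ?_⟩
      simp only [Good, card_empty, Nat.sub_zero]
      intro hl
      have h6 := lr_lost hR hLR (U := U) sdiff_subset (ha'.trans hUk3) (le_refl K)
        (by simp [cn_empty]) hl (fun q => #U ≤ R ^ K * #(cn G U (univ.image q)) ∧ ¬ gS S (univ.image q))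
        (by intro q h1 h2; rw [empty_union] at h1 h2; exact ⟨h1, h2⟩)
      have h6' := hScount (fun q => #U ≤ R ^ K * #(cn G U (univ.image q)) ∧ ¬ gS S (univ.image q))
        (fun q hq => hq)
      have h7 : e + 1 - k0 = k0 + 1 := by omega
      rw [h7] at h6
      have h8 : ((k0 + 1 : ℝ)) ^ K ≤ (t:ℝ) ^ K * (1 - 1 / R ^ K) ^ s := by
        rw [← hY]
        refine le_trans ?_ h6'
        exact_mod_cast h6
      linarith
    have h9 := hσT S hST
    have h10 : Q ⊆ univ.filter (fun w => ¬ Good Y e (gS S) K (pt F univ σ w)) := by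
      intro w hw
      simp only [mem_filter, mem_univ, true_and]
      intro hgd
      have := good_final (g0 := gS S) (by
        rintro P P' hPP ⟨i, hi⟩
        exact ⟨i, fun z hz => hi z (hPP hz)⟩) (by omega) hgd
      obtain ⟨i, hi⟩ := this
      have h11 := mem_sdiff.1 (hSU i)
      exact h11.2 (mem_biUnion.2 ⟨w, hw, mem_cn.2 ⟨h11.1, hi⟩⟩)
    have h12 := (card_le_card h10).trans h9
    have h13 : R ^ K * #Q ≤ (h + Δ * q) * R ^ K := by
      rw [mul_comm]; exact Nat.mul_le_mul_right _ h12
    omega)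
  refine ⟨lam, σ, ?_, ?_, ?_, ?_, ?_⟩
  · intro a b hab; exact hl1 (by simp) (by simp) hab
  · intro a b hab; exact hσS.1 (by simp) (by simp) hab
  · intro u; exact (mem_cn.1 (hl2 u (mem_univ _))).1
  · intro u; exact hσS.2.1 u (mem_univ _)
  · intro u v huv
    refine (mem_cn.1 (hl2 u (mem_univ _))).2 _ ?_
    unfold pt
    exact mem_image.2 ⟨v, by simp [huv], rfl⟩

end Tiling

namespace Tiling
open Finset Classical

variable {V ι : Type*}

structure ZOK (Δ R K Z : ℕ) : Prop where
  big : 1000 ≤ Z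
  Rpos : 0 < R
  Kgt : Δ < K
  RK : R ^ K ≤ Z
  R1 : R ≤ Z
  R2 : 2 * (2 * R) ^ Δ ≤ Z
  D2 : 4 * (Δ * 2 ^ Δ) ≤ Z
  DD : 16 * (Δ * Δ + Δ + 1) ≤ Z
  K10 : 10 * K ≤ Z

lemma log_small {Z t : ℕ} (hZ : 1000 ≤ Z) (ht : Z ^ 16 ≤ t) :
    Real.log t ≤ 2 * (t * (1 / (Z:ℝ)) ^ 8) := by
  have hZ0 : (0:ℝ) < Z := by exact_mod_cast (by omega : 0 < Z)
  have ht' : (Z:ℝ) ^ 16 ≤ t := by exact_mod_cast ht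
  have ht0 : (0:ℝ) < t := lt_of_lt_of_le (by positivity) ht'
  have hs : (Z:ℝ) ^ 8 ≤ √t := by
    apply Real.le_sqrt_of_sq_le
    rw [← pow_mul]; exact ht'
  have hs0 : 0 < √(t:ℝ) := Real.sqrt_pos.2 ht0
  have h1 := Real.log_le_sub_one_of_pos hs0
  have h2 : Real.log t = 2 * Real.log √t := by
    rw [Real.log_sqrt ht0.le]; ring
  have h3 : √(t:ℝ) ≤ t * (1 / (Z:ℝ)) ^ 8 := by
    rw [one_div, inv_pow, ← div_eq_mul_inv, le_div_iff₀ (by positivity)]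
    calc √(t:ℝ) * Z ^ 8 ≤ √(t:ℝ) * √(t:ℝ) := by gcongr
      _ = t := Real.mul_self_sqrt ht0.le
  linarith

set_option maxHeartbeats 1000000 in
lemma spanning [Fintype ι] {F : SimpleGraph ι} {Δ : ℕ} (hF : DegLe F Δ) {X Y : Finset V}
    {t R K Z : ℕ} (hz : ZOK Δ R K Z)
    (ht : Fintype.card ι = t) (hX : #X = t) (hY : #Y = t) (htZ : Z ^ 16 ≤ t)
    {G : V → V → Prop} (hLR : LowReg G X Y R (t / Z ^ 10))
    (hdx : ∀ x ∈ X, t ≤ R * #{y ∈ Y | G x y}) (hdy : ∀ y ∈ Y, t ≤ R * #{x ∈ X | G x y}) :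
    ∃ lam σ : ι → V, Function.Injective lam ∧ Function.Injective σ ∧ (∀ u, lam u ∈ X) ∧
      (∀ u, σ u ∈ Y) ∧ ∀ u v, F.Adj u v → G (lam u) (σ v) := by
  obtain ⟨hbig, hRpos, hK, hRK, hR1, hR2, hD2, hDD, hK10⟩ := hz
  have hZ0 : 0 < Z := by omega
  have hZR : (1000:ℝ) ≤ Z := by exact_mod_cast hbig
  have hZR0 : (0:ℝ) < Z := by linarith
  set z : ℝ := 1 / Z with hzdef
  have hz0 : 0 < z := by positivity
  have hz1 : z ≤ 1 / 1000 := one_div_le_one_div_of_le (by norm_num) hZR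
  have hzZ : z * Z = 1 := by rw [hzdef]; field_simp
  have ht' : (Z:ℝ) ^ 16 ≤ t := by exact_mod_cast htZ
  have hfl : ∀ j, ((t / Z ^ j : ℕ) : ℝ) ≤ t * z ^ j := by
    intro j
    have : ((t / Z ^ j : ℕ) : ℝ) ≤ (t:ℝ) / ((Z ^ j : ℕ) : ℝ) := Nat.cast_div_le
    refine this.trans (le_of_eq ?_)
    rw [hzdef, one_div, inv_pow, Nat.cast_pow, div_eq_mul_inv]
  have hfl2 : ∀ j, t * z ^ j - 1 < ((t / Z ^ j : ℕ) : ℝ) := by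
    intro j
    have h1 : t < (t / Z ^ j + 1) * Z ^ j := by
      have := Nat.lt_mul_div_succ t (b := Z ^ j) (by positivity)
      rw [mul_comm]; exact this
    have h2 : (t:ℝ) < ((t / Z ^ j : ℕ) + 1) * (Z:ℝ) ^ j := by exact_mod_cast h1
    have h3 : (t:ℝ) * z ^ j < (((t / Z ^ j : ℕ) + 1) * (Z:ℝ) ^ j) * z ^ j := by
      apply mul_lt_mul_of_pos_right h2 (by positivity)
    rw [mul_assoc, ← mul_pow, mul_comm (Z:ℝ), hzZ, one_pow, mul_one] at h3
    linarith
  have hdm : ∀ j, t / Z ^ j * Z ^ j ≤ t := fun j => Nat.div_mul_le_self _ _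
  have hmono : ∀ i j, i ≤ j → t / Z ^ j ≤ t / Z ^ i := fun i j hij =>
    Nat.div_le_div_left (Nat.pow_le_pow_right hZ0 hij) (by positivity)
  have htpos : 0 < t := lt_of_lt_of_le (by positivity) htZ
  have htR : (0:ℝ) < t := by exact_mod_cast htpos
  have hlog := log_small hbig htZ
  rw [← hzdef] at hlog
  -- a generic lower bound for t z^j
  have hbigt : ∀ j ≤ 10, 1000 ≤ t * z ^ j := by
    intro j hj
    have h1 : (Z:ℝ) ^ 16 * z ^ j ≤ t * z ^ j := by gcongr
    have h2 : (Z:ℝ) ^ 16 * z ^ j = Z ^ (16 - j) := by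
      have : (Z:ℝ) ^ 16 = Z ^ (16 - j) * Z ^ j := by rw [← pow_add]; congr 1; omega
      rw [this, mul_assoc, ← mul_pow, mul_comm (Z:ℝ), hzZ, one_pow, mul_one]
    have h3 : (Z:ℝ) ^ 1 ≤ Z ^ (16 - j) := pow_le_pow_right₀ (by linarith) (by omega)
    linarith
  have hs : ∀ j, t * z ^ (j+1) ≤ t * z ^ j / 1000 := by
    intro j
    rw [pow_succ]
    have : 0 < (t:ℝ) * z ^ j := by positivity
    nlinarith
  have hfloor_pos : ∀ j ≤ 10, 0 < t / Z ^ j := by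
    intro j hj
    have := hfl2 j; have h2 := hbigt j hj
    have : (0:ℝ) < ((t / Z ^ j : ℕ) : ℝ) := by linarith
    exact_mod_cast this
  apply spanning_core hF (t := t) (R := R) (K := K) (k0 := t / Z ^ 10) (m := t / Z ^ 4) (q := t / Z ^ 2)
    (k3 := t / Z ^ 6) (h := t / Z ^ 3) (g := t / Z ^ 3) (s := Z ^ 4) hK hRpos ht hX hY htpos hLR hdx hdy
  · rw [Nat.le_div_iff_mul_le (by positivity)]
    calc t / Z ^ 10 * R ^ K * Z ^ 6 ≤ t / Z ^ 10 * Z * Z ^ 6 := by gcongr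
      _ = t / Z ^ 10 * Z ^ 7 := by ring
      _ ≤ t / Z ^ 10 * Z ^ 10 := by gcongr <;> omega
      _ ≤ t := hdm 10
  · exact hfloor_pos 6 (by norm_num)
  · exact Nat.div_le_self _ _
  · have h1 := hdm 10
    have h2 := hfloor_pos 10 (by norm_num)
    have h3 : t / Z ^ 10 * 3 ≤ t / Z ^ 10 * Z ^ 10 := by
      gcongr
      calc 3 ≤ Z ^ 1 := by rw [pow_one]; omega
        _ ≤ Z ^ 10 := Nat.pow_le_pow_right hZ0 (by norm_num)
    omega
  · calc t / Z ^ 4 * (Δ * Δ + 1) ≤ t / Z ^ 4 * Z ^ 4 := by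
          gcongr
          calc Δ * Δ + 1 ≤ Z ^ 1 := by rw [pow_one]; omega
            _ ≤ Z ^ 4 := Nat.pow_le_pow_right hZ0 (by norm_num)
      _ ≤ t := hdm 4
  · have h1 := hmono 4 10 (by norm_num)
    calc 2 * R * (Δ * (t / Z ^ 4) + Δ * (2 * (t / Z ^ 10)))
        ≤ 2 * R * (Δ * (t / Z ^ 4) + Δ * (2 * (t / Z ^ 4))) := by gcongr
      _ = t / Z ^ 4 * (R * (6 * Δ)) := by ring
      _ ≤ t / Z ^ 4 * (Z * Z) := by gcongr; omega
      _ ≤ t / Z ^ 4 * Z ^ 4 := by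
          gcongr
          calc Z * Z = Z ^ 2 := by ring
            _ ≤ Z ^ 4 := Nat.pow_le_pow_right hZ0 (by norm_num)
      _ ≤ t := hdm 4
  · have h1 := hmono 4 10 (by norm_num)
    have : 2 * (Δ * (t / Z ^ 4) + Δ * (2 * (t / Z ^ 10))) ≤ t := by
      calc 2 * (Δ * (t / Z ^ 4) + Δ * (2 * (t / Z ^ 10)))
          ≤ 2 * (Δ * (t / Z ^ 4) + Δ * (2 * (t / Z ^ 4))) := by gcongr
        _ = t / Z ^ 4 * ((6 * Δ)) := by ring
        _ ≤ t / Z ^ 4 * (Z ^ 1) := by rw [pow_one]; gcongr; omega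
        _ ≤ t / Z ^ 4 * Z ^ 4 := by gcongr <;> omega
        _ ≤ t := hdm 4
    omega
  · -- gadget inequality
    have hx : z ≤ (1 / (2 * (R:ℝ))) ^ Δ / 2 := by
      have h1 : (2 * (2 * (R:ℝ)) ^ Δ) ≤ Z := by exact_mod_cast hR2
      rw [hzdef, div_pow, one_pow, div_div, mul_comm]
      have hRR : (0:ℝ) < R := by exact_mod_cast hRpos
      exact one_div_le_one_div_of_le (by positivity) h1
    have hx1 : (1 / (2 * (R:ℝ))) ^ Δ ≤ 1 := by
      have hRR : (1:ℝ) ≤ R := by exact_mod_cast hRpos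
      apply pow_le_one₀ (by positivity)
      rw [div_le_one (by positivity)]; linarith
    have h1 : (1 - (1 / (2 * (R:ℝ))) ^ Δ / 2) ≤ Real.exp (-z) := by
      have := Real.add_one_le_exp (-z); linarith
    have h2 : (1 - (1 / (2 * (R:ℝ))) ^ Δ / 2) ^ (t / Z ^ 4) ≤ Real.exp (-z * (t / Z ^ 4 : ℕ)) := by
      rw [mul_comm (-z), Real.exp_nat_mul]
      gcongr
      linarith
    have h3 : Real.exp (-((t / Z ^ 6 : ℕ) : ℝ)) ≤ (1/2:ℝ) ^ (t / Z ^ 6) := by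
      have : -((t / Z ^ 6 : ℕ) : ℝ) = (t / Z ^ 6 : ℕ) * (-1) := by ring
      rw [this, Real.exp_nat_mul]
      gcongr
      rw [Real.exp_neg, ← one_div]
      apply one_div_le_one_div_of_le (by norm_num)
      have := Real.add_one_le_exp (1:ℝ); linarith
    refine lt_of_lt_of_le ?_ h3
    calc (t:ℝ) * (1 - (1 / (2 * (R:ℝ))) ^ Δ / 2) ^ (t / Z ^ 4)
        ≤ Real.exp (Real.log t) * Real.exp (-z * (t / Z ^ 4 : ℕ)) := by
          rw [Real.exp_log htR]; gcongr
      _ = Real.exp (Real.log t + -z * (t / Z ^ 4 : ℕ)) := by rw [← Real.exp_add]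
      _ < _ := by
          apply Real.exp_lt_exp.2
          have h4 := hfl2 4
          have h5 := hfl 6
          have h6 : z * (t * z ^ 4 - 1) ≤ z * (t / Z ^ 4 : ℕ) := by gcongr
          have h7 : z * (t * z ^ 4 - 1) = t * z ^ 5 - z := by ring
          have h8 := hs 5; have h9 := hs 6; have h10 := hs 7; have h11 := hbigt 5 (by norm_num)
          norm_num at h8 h9 h10
          linarith
  · have h1 := hmono 2 4 (by norm_num)
    calc t / Z ^ 2 * (Δ * Δ + 1) + Δ * (t / Z ^ 4) ≤ t / Z ^ 2 * (Δ * Δ + 1) + Δ * (t / Z ^ 2) := by gcongr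
      _ = t / Z ^ 2 * (Δ * Δ + Δ + 1) := by ring
      _ ≤ t / Z ^ 2 * Z ^ 2 := by
          gcongr
          calc Δ * Δ + Δ + 1 ≤ Z ^ 1 := by rw [pow_one]; omega
            _ ≤ Z ^ 2 := Nat.pow_le_pow_right hZ0 (by norm_num)
      _ ≤ t := hdm 2
  · exact hfloor_pos 3 (by norm_num)
  · have h1 := hmono 3 10 (by norm_num)
    rw [Nat.le_div_iff_mul_le (by positivity)]
    calc (t / Z ^ 3 + Δ * (2 * (t / Z ^ 10))) * Z ^ 2 ≤ (t / Z ^ 3 + Δ * (2 * (t / Z ^ 3))) * Z ^ 2 := by gcongr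
      _ = t / Z ^ 3 * (Z ^ 2 * (1 + 2 * Δ)) := by ring
      _ ≤ t / Z ^ 3 * (Z ^ 2 * Z) := by gcongr; omega
      _ = t / Z ^ 3 * Z ^ 3 := by ring
      _ ≤ t := hdm 3
  · have h1 := hmono 3 10 (by norm_num)
    rw [Nat.le_div_iff_mul_le (by positivity)]
    calc (t / Z ^ 3 + Δ * (2 * (t / Z ^ 10))) * Z ^ 2 ≤ (t / Z ^ 3 + Δ * (2 * (t / Z ^ 3))) * Z ^ 2 := by gcongr
      _ = t / Z ^ 3 * (Z ^ 2 * (1 + 2 * Δ)) := by ring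
      _ ≤ t / Z ^ 3 * (Z ^ 2 * Z) := by gcongr; omega
      _ = t / Z ^ 3 * Z ^ 3 := by ring
      _ ≤ t := hdm 3
  · -- engine inequality
    set h := t / Z ^ 3 with hh
    set k0 := t / Z ^ 10 with hk0
    set m := t / Z ^ 4 with hm
    have hh2 := hfl2 3
    rw [← hh] at hh2
    have hb3 := hbigt 3 (by norm_num)
    have hhlow : t * z ^ 3 / 2 ≤ (h:ℝ) := by linarith
    have hhpos : (0:ℝ) < h := by linarith
    have hA : (Δ * (2 * k0) * 2 ^ Δ / h : ℝ) ≤ z ^ 6 := by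
      rw [div_le_iff₀ hhpos]
      have h1 := hfl 10
      rw [← hk0] at h1
      have h2 : (4 * (Δ * 2 ^ Δ) : ℝ) ≤ Z := by exact_mod_cast hD2
      calc (Δ * (2 * k0) * 2 ^ Δ : ℝ) = (4 * (Δ * 2 ^ Δ)) * (k0 / 2) := by ring
        _ ≤ Z * (t * z ^ 10 / 2) := by gcongr
        _ = (z * Z) * (t * z ^ 9 / 2) := by ring
        _ = z ^ 6 * (t * z ^ 3 / 2) := by rw [hzZ]; ring
        _ ≤ z ^ 6 * h := by gcongr
    have hA' : (1 + Δ * (2 * k0) * 2 ^ Δ / h : ℝ) ^ t ≤ Real.exp (t * z ^ 6) := by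
      rw [Real.exp_nat_mul]
      gcongr
      have := Real.add_one_le_exp (z ^ 6); linarith
    have hB : ((t:ℝ) ^ (Z ^ 4) + t) ≤ Real.exp ((Z ^ 4 + 1) * Real.log t) := by
      have e1 : ((Z:ℝ) ^ 4 + 1) = ((Z ^ 4 + 1 : ℕ) : ℝ) := by push_cast; ring
      rw [e1, Real.exp_nat_mul, Real.exp_log htR, pow_succ (t:ℝ) (Z^4)]
      have ht2 : (2:ℝ) ≤ t := by
        have := hbigt 0 (by norm_num); rw [pow_zero, mul_one] at this; linarith
      have h1 : (t:ℝ) ≤ t ^ (Z ^ 4) := by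
        apply le_self_pow₀ (by linarith) (by positivity)
      generalize (t:ℝ) ^ (Z ^ 4) = a at h1 ⊢
      nlinarith
    have hC : ((2:ℝ) ^ (Δ * (Δ * m))) ≤ Real.exp (t * z ^ 3 / 16) := by
      have h2e : (2:ℝ) ≤ Real.exp 1 := by have := Real.add_one_le_exp (1:ℝ); linarith
      calc ((2:ℝ) ^ (Δ * (Δ * m))) ≤ (Real.exp 1) ^ (Δ * (Δ * m)) := by gcongr
        _ = Real.exp ((Δ * (Δ * m) : ℕ) * 1) := by rw [Real.exp_nat_mul]
        _ ≤ _ := by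
          apply Real.exp_le_exp.2
          have h1 := hfl 4
          rw [← hm] at h1
          have h3 : 16 * (Δ * Δ) ≤ Z := by omega
          have h2 : (16 * (Δ * Δ) : ℝ) ≤ Z := by exact_mod_cast h3
          push_cast
          calc (Δ * (Δ * m) * 1 : ℝ) = (16 * (Δ * Δ)) * (m / 16) := by ring
            _ ≤ Z * (t * z ^ 4 / 16) := by gcongr
            _ = (z * Z) * (t * z ^ 3 / 16) := by ring
            _ = _ := by rw [hzZ]; ring
    have hD : Real.exp (h / 2) ≤ 2 ^ h := by
      have : (h / 2 : ℝ) = h * (1 / 2) := by ring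
      rw [this, Real.exp_nat_mul]
      gcongr
      have h1 := Real.exp_one_lt_d9
      have h2 : Real.exp (1/2) ^ 2 = Real.exp 1 := by rw [← Real.exp_nat_mul]; norm_num
      have h3 := Real.exp_pos (1/2)
      nlinarith
    refine le_trans ?_ hD
    calc _ ≤ Real.exp (t * z ^ 6) * (Real.exp ((Z ^ 4 + 1) * Real.log t) * Real.exp (t * z ^ 3 / 16)) := by
          gcongr
      _ = Real.exp (t * z ^ 6 + ((Z ^ 4 + 1) * Real.log t + t * z ^ 3 / 16)) := by
          rw [Real.exp_add, Real.exp_add]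
      _ ≤ _ := by
          apply Real.exp_le_exp.2
          have h1 : ((Z:ℝ) ^ 4 + 1) * Real.log t ≤ (2 * Z ^ 4) * (2 * (t * z ^ 8)) := by
            have h11 : (1:ℝ) ≤ Z ^ 4 := one_le_pow₀ (by linarith)
            have h12 : 0 ≤ Real.log t := Real.log_nonneg (by exact_mod_cast htpos)
            gcongr
            linarith
          have h2 : (2 * (Z:ℝ) ^ 4) * (2 * (t * z ^ 8)) = 4 * (t * z ^ 4) := by
            have : (Z:ℝ) ^ 4 * z ^ 4 = 1 := by rw [← mul_pow, mul_comm, hzZ, one_pow]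
            calc (2 * (Z:ℝ) ^ 4) * (2 * (t * z ^ 8)) = 4 * ((Z:ℝ) ^ 4 * z ^ 4) * (t * z ^ 4) := by ring
              _ = _ := by rw [this]; ring
          have h3 := hs 3; have h4 := hs 4; have h5 := hs 5
          norm_num at h3 h4 h5
          linarith
  · have h1 := hmono 2 3 (by norm_num)
    have : 2 * ((t / Z ^ 3 + Δ * (t / Z ^ 2)) * R ^ K) ≤ t := by
      calc 2 * ((t / Z ^ 3 + Δ * (t / Z ^ 2)) * R ^ K) ≤ 2 * ((t / Z ^ 2 + Δ * (t / Z ^ 2)) * Z) := by gcongr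
        _ = t / Z ^ 2 * (Z * (2 * (1 + Δ))) := by ring
        _ ≤ t / Z ^ 2 * (Z * Z) := by gcongr; omega
        _ = t / Z ^ 2 * Z ^ 2 := by ring
        _ ≤ t := hdm 2
    omega
  · have hRK' : ((R:ℝ) ^ K) ≤ Z := by exact_mod_cast hRK
    have hRK0 : (1:ℝ) ≤ (R:ℝ) ^ K := one_le_pow₀ (by exact_mod_cast hRpos)
    have hzR : z ≤ 1 / (R:ℝ) ^ K := one_div_le_one_div_of_le (by linarith) hRK'
    have h1R : (1:ℝ) / R ^ K ≤ 1 := by rw [div_le_one (by linarith)]; exact hRK0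
    have h1 : (1 - 1 / (R:ℝ) ^ K) ^ (Z ^ 4) ≤ Real.exp (-(Z:ℝ) ^ 3) := by
      have e1 : (-(Z:ℝ) ^ 3) = ((Z ^ 4 : ℕ) : ℝ) * (-z) := by
        push_cast
        calc (-(Z:ℝ) ^ 3) = -(Z:ℝ) ^ 3 * (z * Z) := by rw [hzZ, mul_one]
          _ = _ := by ring
      rw [e1, Real.exp_nat_mul]
      have h0 : 0 ≤ 1 - 1 / (R:ℝ) ^ K := by linarith
      have h00 : 1 - 1 / (R:ℝ) ^ K ≤ Real.exp (-z) := by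
        have := Real.add_one_le_exp (-z); linarith
      exact pow_le_pow_left₀ h0 h00 _
    set k0 := t / Z ^ 10 with hk0
    have h2 : (t:ℝ) < (k0 + 1) * Z ^ 10 := by
      have := Nat.lt_mul_div_succ t (b := Z ^ 10) (by positivity)
      have h3 : t < (k0 + 1) * Z ^ 10 := by rw [mul_comm]; exact this
      exact_mod_cast h3
    have h3 : ((Z:ℝ) ^ 10) ^ K * Real.exp (-(Z:ℝ) ^ 3) < 1 := by
      have hl : Real.log Z ≤ Z := by have := Real.log_le_sub_one_of_pos hZR0; linarith
      have e1 : ((Z:ℝ) ^ 10) ^ K = Real.exp ((10 * K : ℕ) * Real.log Z) := by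
        rw [Real.exp_nat_mul, Real.exp_log hZR0, ← pow_mul]
      rw [e1, ← Real.exp_add, Real.exp_lt_one_iff]
      have h4 : ((10 * K : ℕ) : ℝ) ≤ Z := by exact_mod_cast hK10
      have h6 : 0 ≤ Real.log Z := Real.log_nonneg (by linarith)
      have h5 : ((10 * K : ℕ) : ℝ) * Real.log Z ≤ Z * Z := mul_le_mul h4 hl h6 hZR0.le
      have h7 : (Z:ℝ) * Z * 1 < (Z:ℝ) * Z * Z :=
        mul_lt_mul_of_pos_left (by linarith) (mul_pos hZR0 hZR0)
      have h8 : (Z:ℝ) ^ 3 = Z * Z * Z := by ring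
      linarith
    have hk1 : (0:ℝ) < k0 + 1 := by positivity
    calc (t:ℝ) ^ K * (1 - 1 / (R:ℝ) ^ K) ^ (Z ^ 4)
        ≤ ((k0 + 1) * Z ^ 10) ^ K * Real.exp (-(Z:ℝ) ^ 3) := by
          gcongr
      _ = (k0 + 1) ^ K * (((Z:ℝ) ^ 10) ^ K * Real.exp (-(Z:ℝ) ^ 3)) := by rw [mul_pow]; ring
      _ < (k0 + 1) ^ K * 1 := by
          apply mul_lt_mul_of_pos_left h3 (by positivity)
      _ = _ := mul_one _

end Tiling

namespace Tiling
open Finset Classical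

variable {V ι : Type*}

lemma avg_sub (f : V → ℝ) (S : Finset V) : ∀ j, j ≤ #S → ∃ T ⊆ S, #T = #S - j ∧
    ((#S - j : ℕ) : ℝ) * ∑ x ∈ S, f x ≤ #S * ∑ x ∈ T, f x := by
  intro j
  induction j with
  | zero => intro _; exact ⟨S, subset_rfl, rfl, by simp⟩
  | succ j ih =>
    intro hj
    obtain ⟨T, hT, hc, hs⟩ := ih (by omega)
    have hne : T.Nonempty := by rw [← card_pos]; omega
    obtain ⟨x, hx, hmin⟩ := exists_min_image T f hne
    refine ⟨T.erase x, (erase_subset _ _).trans hT, by rw [card_erase_of_mem hx]; omega, ?_⟩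
    have h1 : (#T : ℝ) * f x ≤ ∑ y ∈ T, f y := by
      have := card_nsmul_le_sum T f (f x) hmin
      simpa using this
    have h2 := add_sum_erase T f hx
    obtain ⟨c, hc'⟩ : ∃ c, #S - j = c + 1 := ⟨#S - j - 1, by omega⟩
    have hc2 : #S - (j+1) = c := by omega
    rw [hc2]
    rw [hc'] at hs hc
    rw [hc] at h1
    push_cast at h1 hs
    have h3 : (c:ℝ) * ∑ y ∈ T, f y ≤ (c+1) * ∑ y ∈ T.erase x, f y := by
      have : ∑ y ∈ T.erase x, f y = ∑ y ∈ T, f y - f x := by linarith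
      rw [this]; linarith
    have hc0 : (0:ℝ) < c + 1 := by positivity
    have hc00 : (0:ℝ) ≤ c := by positivity
    have h4 : (c+1) * (c * ∑ x ∈ S, f x) ≤ (c+1) * (#S * ∑ y ∈ T.erase x, f y) := by
      calc (c+1) * (c * ∑ x ∈ S, f x) = c * ((c+1) * ∑ x ∈ S, f x) := by ring
        _ ≤ c * (#S * ∑ x ∈ T, f x) := by gcongr
        _ = #S * (c * ∑ x ∈ T, f x) := by ring
        _ ≤ #S * ((c+1) * ∑ y ∈ T.erase x, f y) := by gcongr
        _ = _ := by ring
    exact le_of_mul_le_mul_left h4 hc0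

lemma avg_ge (f : V → ℝ) (S : Finset V) (k : ℕ) (hk : k ≤ #S) : ∃ T ⊆ S, #T = k ∧
    (k : ℝ) * ∑ x ∈ S, f x ≤ #S * ∑ x ∈ T, f x := by
  obtain ⟨T, h1, h2, h3⟩ := avg_sub f S (#S - k) (by omega)
  have : #S - (#S - k) = k := by omega
  rw [this] at h2 h3
  exact ⟨T, h1, h2, h3⟩

lemma avg_le (f : V → ℝ) (S : Finset V) (k : ℕ) (hk : k ≤ #S) : ∃ T ⊆ S, #T = k ∧
    #S * ∑ x ∈ T, f x ≤ (k : ℝ) * ∑ x ∈ S, f x := by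
  obtain ⟨T, h1, h2, h3⟩ := avg_ge (fun x => - f x) S k hk
  refine ⟨T, h1, h2, ?_⟩
  simp only [sum_neg_distrib] at h3
  linarith

lemma dens_down (g : V → V → ℝ) (A B : Finset V) (k : ℕ) (d : ℝ) (hA : k ≤ #A) (hB : k ≤ #B)
    (hk : 0 < k) (hd : d * (#A * #B) ≤ ∑ x ∈ A, ∑ y ∈ B, g x y) :
    ∃ A' ⊆ A, ∃ B' ⊆ B, #A' = k ∧ #B' = k ∧ d * (k * k) ≤ ∑ x ∈ A', ∑ y ∈ B', g x y := by
  obtain ⟨A', hA', hcA, h1⟩ := avg_ge (fun x => ∑ y ∈ B, g x y) A k hA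
  obtain ⟨B', hB', hcB, h2⟩ := avg_ge (fun y => ∑ x ∈ A', g x y) B k hB
  refine ⟨A', hA', B', hB', hcA, hcB, ?_⟩
  rw [sum_comm (s := A') (t := B')]
  rw [sum_comm (s := B) (t := A')] at h2
  have hA0 : (0:ℝ) < #A := by exact_mod_cast (by omega : 0 < #A)
  have hB0 : (0:ℝ) < #B := by exact_mod_cast (by omega : 0 < #B)
  have hk0 : (0:ℝ) < k := by exact_mod_cast hk
  have : (#A * #B : ℝ) * (d * (k*k)) ≤ (#A * #B : ℝ) * ∑ y ∈ B', ∑ x ∈ A', g x y := by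
    calc (#A * #B : ℝ) * (d * (k*k)) = k * (k * (d * (#A * #B))) := by ring
      _ ≤ k * (k * ∑ x ∈ A, ∑ y ∈ B, g x y) := by gcongr
      _ ≤ k * (#A * ∑ x ∈ A', ∑ y ∈ B, g x y) := by gcongr
      _ = #A * (k * ∑ x ∈ A', ∑ y ∈ B, g x y) := by ring
      _ ≤ #A * (#B * ∑ y ∈ B', ∑ x ∈ A', g x y) := by gcongr
      _ = _ := by ring
  exact le_of_mul_le_mul_left this (by positivity)

lemma dens_step (g : V → V → ℝ) (A B : Finset V) (m k : ℕ) (d : ℝ) (hd0 : 0 ≤ d)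
    (hA : #A = m) (hB : #B = m) (hk : 0 < k) (hkm : 2 * k ≤ m)
    (hd : d * (m * m) ≤ ∑ x ∈ A, ∑ y ∈ B, g x y)
    (X Y : Finset V) (hX : X ⊆ A) (hY : Y ⊆ B) (hXk : #X = k) (hYk : #Y = k)
    (hXY : 2 * ∑ x ∈ X, ∑ y ∈ Y, g x y ≤ d * (k * k)) (δ : ℝ) (hδ : 0 ≤ δ)
    (hδ' : δ * (m * m) * 2 ≤ k * k) :
    ∃ A' ⊆ A, ∃ B' ⊆ B, #A' = k ∧ #B' = k ∧ d * (1 + δ) * (k * k) ≤ ∑ x ∈ A', ∑ y ∈ B', g x y := by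
  have hcA : #(A \ X) = m - k := by rw [card_sdiff_of_subset hX]; omega
  have hcB : #(B \ Y) = m - k := by rw [card_sdiff_of_subset hY]; omega
  have hcast : ((m - k : ℕ) : ℝ) = m - k := by rw [Nat.cast_sub (by omega)]
  have hs1 : ∑ x ∈ A, ∑ y ∈ B, g x y = ∑ x ∈ A \ X, ∑ y ∈ B, g x y + ∑ x ∈ X, ∑ y ∈ B, g x y :=
    (sum_sdiff hX).symm
  have hs2 : ∑ x ∈ X, ∑ y ∈ B, g x y = ∑ x ∈ X, ∑ y ∈ B \ Y, g x y + ∑ x ∈ X, ∑ y ∈ Y, g x y := by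
    rw [← sum_add_distrib]
    exact sum_congr rfl fun x _ => (sum_sdiff hY).symm
  by_cases h1 : d * (1 + δ) * (#(A \ X) * #B) ≤ ∑ x ∈ A \ X, ∑ y ∈ B, g x y
  · obtain ⟨A', hA', B', hB', h⟩ := dens_down g (A \ X) B k _ (by omega) (by omega) hk h1
    exact ⟨A', hA'.trans sdiff_subset, B', hB', h⟩
  by_cases h2 : d * (1 + δ) * (#X * #(B \ Y)) ≤ ∑ x ∈ X, ∑ y ∈ B \ Y, g x y
  · obtain ⟨A', hA', B', hB', h⟩ := dens_down g X (B \ Y) k _ (by omega) (by omega) hk h2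
    exact ⟨A', hA'.trans hX, B', hB'.trans sdiff_subset, h⟩
  exfalso
  push Not at h1 h2
  rw [hcA, hB, hcast] at h1
  rw [hcB, hXk, hcast] at h2
  have h3 : d * (δ * (m * m) * 2) ≤ d * (k * k) := by gcongr
  have h4 : 0 ≤ d * δ * (k * k) := by positivity
  nlinarith

/-- every pair of `k`-subsets has density at least `d/2` -/
def BiReg (g : V → V → ℝ) (X Y : Finset V) (k : ℕ) (d : ℝ) : Prop :=
  ∀ X' ⊆ X, ∀ Y' ⊆ Y, #X' = k → #Y' = k → d * (k * k) < 2 * ∑ x ∈ X', ∑ y ∈ Y', g x y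

lemma bireg_exists (g : V → V → ℝ) (hg : ∀ x y, g x y ≤ 1) (L : ℕ) (hL : 2 ≤ L) (δ : ℝ) (hδ : 0 ≤ δ)
    (hδ' : δ * (8 * L ^ 2) ≤ 1) (d0 : ℝ) :
    ∀ (N : ℕ) (d : ℝ) (A B : Finset V) (m : ℕ), #A = m → #B = m → 0 ≤ d → d0 ≤ d → L ^ (N + 1) ≤ m →
      1 < d * (1 + δ) ^ N → d * (m * m) ≤ ∑ x ∈ A, ∑ y ∈ B, g x y →
      ∃ X ⊆ A, ∃ Y ⊆ B, ∃ m', #X = m' ∧ #Y = m' ∧ m / L ^ N ≤ m' ∧ BiReg g X Y (m' / L) d0 := by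
  intro N
  induction N with
  | zero =>
    intro d A B m hA hB hd hd0 hm h1 hs
    exfalso
    have : ∑ x ∈ A, ∑ y ∈ B, g x y ≤ m * m := by
      calc ∑ x ∈ A, ∑ y ∈ B, g x y ≤ ∑ x ∈ A, ∑ y ∈ B, (1:ℝ) :=
            sum_le_sum fun x _ => sum_le_sum fun y _ => hg x y
        _ = m * m := by simp [hA, hB]
    have hm0 : (0:ℝ) < m := by
      have : 0 < L ^ (0+1) := by positivity
      exact_mod_cast (by omega : 0 < m)
    simp at h1
    have h2 : (1:ℝ) * (m*m) < d * (m*m) := by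
      apply mul_lt_mul_of_pos_right h1; positivity
    linarith
  | succ N ih =>
    intro d A B m hA hB hd hd0 hm h1 hs
    by_cases hreg : BiReg g A B (m / L) d0
    · exact ⟨A, subset_rfl, B, subset_rfl, m, hA, hB, Nat.div_le_self _ _, hreg⟩
    unfold BiReg at hreg
    push Not at hreg
    obtain ⟨X, hX, Y, hY, hXk, hYk, hXY⟩ := hreg
    have hkN : L ^ (N+1) ≤ m / L := by
      rw [Nat.le_div_iff_mul_le (by omega)]
      rw [pow_succ L (N+1)] at hm; exact hm
    have hk : 0 < m / L := lt_of_lt_of_le (by positivity) hkN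
    have hkL : m / L * L ≤ m := Nat.div_mul_le_self m L
    have hkL2 : m < (m / L + 1) * L := by
      have := Nat.lt_mul_div_succ m (b := L) (by omega)
      rw [mul_comm]; exact this
    generalize m / L = k at *
    have hmk : m ≤ 2 * k * L := by nlinarith
    have hmk' : (m:ℝ) ≤ 2 * k * L := by exact_mod_cast hmk
    obtain ⟨A', hA', B', hB', hA'k, hB'k, hs'⟩ := dens_step g A B m k d hd hA hB hk (by nlinarith) hs X Y hX hY hXk hYk
      (hXY.trans (by gcongr)) δ hδ (by
        calc δ * (m * m) * 2 ≤ δ * ((2 * k * L) * (2 * k * L)) * 2 := by gcongr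
          _ = (δ * (8 * L^2)) * (k * k) := by ring
          _ ≤ 1 * (k * k) := by gcongr
          _ = _ := one_mul _)
    obtain ⟨X1, hX1, Y1, hY1, m', h1', h2', h3', h4'⟩ := ih (d * (1+δ)) A' B' k hA'k hB'k (by positivity)
      (by nlinarith) hkN (by rw [mul_assoc, ← pow_succ' (1+δ) N]; exact h1) hs'
    refine ⟨X1, hX1.trans hA', Y1, hY1.trans hB', m', h1', h2', ?_, h4'⟩
    refine le_trans ?_ h3'
    rw [Nat.le_div_iff_mul_le (by positivity)]
    have h5 : m / L ^ (N+1) * L ^ (N+1) ≤ m := Nat.div_mul_le_self _ _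
    have h6 : m / L ^ (N+1) * L ^ N * L < (k + 1) * L := by
      calc _ = m / L ^ (N+1) * L ^ (N+1) := by ring
        _ ≤ m := h5
        _ < _ := hkL2
    have := Nat.lt_of_mul_lt_mul_right h6
    omega

lemma lr_of_bireg {G : V → V → Prop} {X Y : Finset V} {k r : ℕ} (hr : 0 < r) (hk : 0 < k)
    (h : BiReg (fun x y => if G x y then (1:ℝ) else 0) X Y k (1 / r)) : LowReg G X Y (4 * r) k := by
  intro X' hX' hkX
  by_contra hc
  push Not at hc
  obtain ⟨Y', hY', hY'k⟩ := exists_subset_card_eq hc.le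
  obtain ⟨X'', hX'', hX''k, hs⟩ := avg_le (fun x => ∑ y ∈ Y', if G x y then (1:ℝ) else 0) X' k hkX
  have h1 := h X'' (hX''.trans hX') Y' (hY'.trans (filter_subset _ _)) hX''k hY'k
  have h2 : ∑ x ∈ X', ∑ y ∈ Y', (if G x y then (1:ℝ) else 0) = ∑ y ∈ Y', (#{x ∈ X' | G x y} : ℝ) := by
    rw [sum_comm]
    exact sum_congr rfl fun y _ => by simp
  have h3 : ∑ y ∈ Y', (4 * r * #{x ∈ X' | G x y} : ℝ) ≤ ∑ y ∈ Y', (#X' : ℝ) := by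
    apply sum_le_sum
    intro y hy
    have := (mem_filter.1 (hY' hy)).2
    exact_mod_cast this.le
  rw [← mul_sum, ← h2, sum_const, hY'k, nsmul_eq_mul] at h3
  have hr0 : (0:ℝ) < r := by exact_mod_cast hr
  have hk0 : (0:ℝ) < k := by exact_mod_cast hk
  have hX0 : (0:ℝ) < #X' := by exact_mod_cast (by omega : 0 < #X')
  simp only at h1
  generalize ∑ x ∈ X'', ∑ y ∈ Y', (if G x y then (1:ℝ) else 0) = s at *
  generalize ∑ x ∈ X', ∑ y ∈ Y', (if G x y then (1:ℝ) else 0) = S at *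
  have h4 : (k * k : ℝ) < 2 * r * s := by
    have := mul_lt_mul_of_pos_left h1 hr0
    have e : (r:ℝ) * (1 / r * (k*k)) = k * k := by field_simp
    rw [e] at this; linarith
  have h5 : (#X' : ℝ) * (k * k) < #X' * (k * k) := by
    calc (#X' : ℝ) * (k * k) < #X' * (2 * r * s) := by gcongr
      _ = 2 * r * (#X' * s) := by ring
      _ ≤ 2 * r * (k * S) := by gcongr
      _ = k * (4 * r * S) / 2 := by ring
      _ ≤ k * (k * #X') / 2 := by gcongr
      _ ≤ #X' * (k * k) := by
        have : 0 < (#X' : ℝ) * (k * k) := by positivity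
        linarith
  exact lt_irrefl _ h5

lemma bireg_symm {g : V → V → ℝ} {X Y : Finset V} {k : ℕ} {d : ℝ} (h : BiReg g X Y k d) :
    BiReg (fun x y => g y x) Y X k d := by
  intro X' hX' Y' hY' h1 h2
  rw [sum_comm]
  exact h Y' hY' X' hX' h2 h1

lemma LowReg.mono {G : V → V → Prop} {X Y X' Y' : Finset V} {R R' k k' : ℕ} (h : LowReg G X Y R k)
    (hX : X' ⊆ X) (hY : Y' ⊆ Y) (hR : R ≤ R') (hk : k ≤ k') : LowReg G X' Y' R' k' := by
  intro X1 hX1 hk1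
  refine le_trans (card_le_card ?_) ((h X1 (hX1.trans hX) (by omega)).trans hk)
  intro y hy
  rw [mem_filter] at hy ⊢
  exact ⟨hY hy.1, lt_of_le_of_lt (Nat.mul_le_mul_right _ hR) hy.2⟩

lemma superset_card {S A : Finset V} {k : ℕ} (hS : S ⊆ A) (h1 : #S ≤ k) (h2 : k ≤ #A) :
    ∃ T, S ⊆ T ∧ T ⊆ A ∧ #T = k := exists_subsuperset_card_eq hS h1 h2

lemma prune_deg {G : V → V → Prop} {X Y Q : Finset V} {R k : ℕ} {x : V}
    (h : #Y ≤ R * #{y ∈ Y | G x y}) (hQ : #Q = k) : #Y ≤ R * (#{y ∈ Y \ Q | G x y} + k) := by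
  refine h.trans (Nat.mul_le_mul_left _ ?_)
  rw [← hQ]
  refine le_trans (card_le_card ?_) (card_union_le _ _)
  intro y hy
  simp only [mem_filter, mem_union, mem_sdiff] at hy ⊢
  tauto

lemma lowreg_exists {G : V → V → Prop} (A B : Finset V) (m r Z N : ℕ) (hr : 0 < r) (hZ : 1000 ≤ Z)
    (hA : #A = m) (hB : #B = m) (hN : 8 * r * Z ^ 22 ≤ N)
    (hm : (Z ^ 11) ^ (N + 1) ≤ m) (hd : m * m ≤ r * ∑ x ∈ A, #{y ∈ B | G x y}) :
    ∃ X ⊆ A, ∃ Y ⊆ B, ∃ t k, #X = t ∧ #Y = t ∧ m / (Z ^ 11) ^ N ≤ 2 * t ∧ k * (4 * Z ^ 10) ≤ t ∧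
      LowReg G X Y (4 * r) k ∧ (∀ x ∈ X, t ≤ 4 * r * (#{y ∈ Y | G x y} + k)) ∧
      (∀ y ∈ Y, t ≤ 4 * r * (#{x ∈ X | G x y} + k)) := by
  obtain ⟨g, hg⟩ : ∃ g : V → V → ℝ, g = fun x y => if G x y then (1:ℝ) else 0 := ⟨_, rfl⟩
  have hr0 : (0:ℝ) < r := by exact_mod_cast hr
  have hL : 2 ≤ Z ^ 11 := le_trans (by omega) (Nat.le_self_pow (by norm_num) Z)
  obtain ⟨δ, hδd⟩ : ∃ δ : ℝ, δ = 1 / (8 * ((Z ^ 11 : ℕ) : ℝ) ^ 2) := ⟨_, rfl⟩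
  have hZ0 : (0:ℝ) < ((Z ^ 11 : ℕ) : ℝ) := by exact_mod_cast (by omega : 0 < Z ^ 11)
  have hδ : 0 ≤ δ := by rw [hδd]; positivity
  have hδ1 : δ * (8 * ((Z ^ 11 : ℕ) : ℝ) ^ 2) = 1 := by rw [hδd]; field_simp
  obtain ⟨X, hX, Y, hY, m', hXm, hYm, hmm, hreg⟩ := bireg_exists g (by intro x y; rw [hg]; dsimp; split_ifs <;> norm_num)
    (Z ^ 11) hL δ hδ hδ1.le (1 / r) N (1/r) A B m hA hB (by positivity) le_rfl hm
    (by
      have h1 := one_add_mul_le_pow (a := δ) (by linarith) N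
      have h2 : (8 * r * (((Z ^ 11 : ℕ) : ℝ) ^ 2) : ℝ) ≤ N := by
        have e : 8 * r * Z ^ 22 = 8 * r * (Z ^ 11) ^ 2 := by ring
        rw [e] at hN
        exact_mod_cast hN
      have h3 : (r:ℝ) ≤ N * δ := by
        calc (r:ℝ) = (8 * r * (((Z ^ 11 : ℕ) : ℝ) ^ 2) : ℝ) * δ := by
              calc (r:ℝ) = r * (δ * (8 * ((Z ^ 11 : ℕ) : ℝ) ^ 2)) := by rw [hδ1, mul_one]
                _ = _ := by ring
          _ ≤ N * δ := by gcongr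
      have h4 : (r:ℝ) < (1+δ)^N := by linarith
      calc (1:ℝ) = 1 / r * r := by field_simp
        _ < _ := by gcongr)
    (by
      rw [hg]
      have e : ∑ x ∈ A, ∑ y ∈ B, (if G x y then (1:ℝ) else 0) = ((∑ x ∈ A, #{y ∈ B | G x y} : ℕ) : ℝ) := by
        push_cast
        exact sum_congr rfl fun y _ => by simp
      rw [e]
      have : ((m * m : ℕ) : ℝ) ≤ ((r * ∑ x ∈ A, #{y ∈ B | G x y} : ℕ) : ℝ) := by exact_mod_cast hd
      rw [Nat.cast_mul, Nat.cast_mul] at this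
      rw [one_div_mul_eq_div, div_le_iff₀ hr0]
      linarith)
  have hm'L : Z ^ 11 ≤ m' := by
    refine le_trans ?_ hmm
    rw [Nat.le_div_iff_mul_le (by positivity)]
    calc Z ^ 11 * (Z ^ 11) ^ N = (Z ^ 11) ^ (N+1) := by ring
      _ ≤ m := hm
  have hk : 0 < m' / Z ^ 11 := Nat.div_pos hm'L (by omega)
  have hkL : m' / Z ^ 11 * Z ^ 11 ≤ m' := Nat.div_mul_le_self _ _
  generalize m' / Z ^ 11 = k at *
  have hk2 : k * (4 * Z ^ 10) + k ≤ m' := by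
    calc k * (4 * Z ^ 10) + k ≤ k * (4 * Z ^ 10) + k * Z ^ 10 := by
          gcongr; exact Nat.le_mul_of_pos_right _ (by positivity)
      _ = k * (5 * Z ^ 10) := by ring
      _ ≤ k * (Z * Z ^ 10) := by gcongr; omega
      _ = k * Z ^ 11 := by ring
      _ ≤ m' := hkL
  have hk4 : k * 4 ≤ k * (4 * Z ^ 10) := by
    apply Nat.mul_le_mul_left; have : 0 < Z ^ 10 := by positivity
    omega
  rw [hg] at hreg
  have hl1 := lr_of_bireg hr hk hreg
  have hl2 := lr_of_bireg (G := fun x y => G y x) hr hk (bireg_symm hreg)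
  have hb1 := hl1 X subset_rfl (by omega)
  have hb2 := hl2 Y subset_rfl (by omega)
  obtain ⟨Q1, hQ1, hQ1Y, hQ1k⟩ := superset_card (filter_subset _ Y) hb1 (by omega)
  obtain ⟨Q2, hQ2, hQ2X, hQ2k⟩ := superset_card (filter_subset _ X) hb2 (by omega)
  refine ⟨X \ Q2, sdiff_subset.trans hX, Y \ Q1, sdiff_subset.trans hY, m' - k, k, ?_, ?_, ?_, ?_, ?_, ?_, ?_⟩
  · rw [card_sdiff_of_subset hQ2X]; omega
  · rw [card_sdiff_of_subset hQ1Y]; omega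
  · omega
  · omega
  · exact hl1.mono sdiff_subset sdiff_subset le_rfl le_rfl
  · intro x hx
    rw [mem_sdiff] at hx
    have : #Y ≤ 4 * r * #{y ∈ Y | G x y} := by
      by_contra hc
      exact hx.2 (hQ2 (mem_filter.2 ⟨hx.1, by simpa using hc⟩))
    have := prune_deg (X := X) this hQ1k
    omega
  · intro x hx
    rw [mem_sdiff] at hx
    have : #X ≤ 4 * r * #{y ∈ X | G y x} := by
      by_contra hc
      exact hx.2 (hQ1 (mem_filter.2 ⟨hx.1, by simpa using hc⟩))
    have := prune_deg (G := fun x y => G y x) (X := X) this hQ2k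
    omega

end Tiling

namespace Tiling
open Finset Classical

variable {V κ : Type*}

def IsTile (F : (i : ℕ) → SimpleGraph (Fin i)) (c : V → V → κ) (S : Finset V) : Prop :=
  ∃ (i : ℕ) (_ : 1 ≤ i) (col : κ) (f : Fin i → V), Function.Injective f ∧ univ.image f = S ∧
    ∀ a b, (F i).Adj a b → c (f a) (f b) = col

def Tileable (F : (i : ℕ) → SimpleGraph (Fin i)) (c : V → V → κ) (S : Finset V) (k : ℕ) : Prop :=
  ∃ P : Finset (Finset V), #P ≤ k ∧ (∀ p ∈ P, ∀ q ∈ P, p ≠ q → Disjoint p q) ∧ P.biUnion id = S ∧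
    ∀ p ∈ P, IsTile F c p

structure FOK (F : (i : ℕ) → SimpleGraph (Fin i)) (Δ : ℕ) : Prop where
  col : ∀ i, 1 ≤ i → (F i).Colorable 2
  deg : ∀ i, 1 ≤ i → DegLe (F i) Δ

section basics
variable {F : (i : ℕ) → SimpleGraph (Fin i)} {c : V → V → κ}

lemma Tileable.mono {S : Finset V} {k k' : ℕ} (h : Tileable F c S k) (hk : k ≤ k') : Tileable F c S k' := by
  obtain ⟨P, h1, h2⟩ := h
  exact ⟨P, h1.trans hk, h2⟩

lemma tileable_empty (k : ℕ) : Tileable F c ∅ k := ⟨∅, by simp, by simp, by simp, by simp⟩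

lemma tileable_tile {S : Finset V} (h : IsTile F c S) : Tileable F c S 1 :=
  ⟨{S}, by simp, by simp, by simp, by simpa using h⟩

lemma Tileable.union {S T : Finset V} {k l : ℕ} (hS : Tileable F c S k) (hT : Tileable F c T l)
    (h : Disjoint S T) : Tileable F c (S ∪ T) (k + l) := by
  obtain ⟨P, h1, h2, h3, h4⟩ := hS
  obtain ⟨Q, g1, g2, g3, g4⟩ := hT
  have hP : ∀ p ∈ P, p ⊆ S := fun p hp => by rw [← h3]; exact subset_biUnion_of_mem id hp
  have hQ : ∀ p ∈ Q, p ⊆ T := fun p hp => by rw [← g3]; exact subset_biUnion_of_mem id hp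
  refine ⟨P ∪ Q, (card_union_le _ _).trans (by omega), ?_, ?_, ?_⟩
  · intro p hp q hq hpq
    rw [mem_union] at hp hq
    rcases hp with hp | hp <;> rcases hq with hq | hq
    · exact h2 p hp q hq hpq
    · exact disjoint_of_subset_left (hP p hp) (disjoint_of_subset_right (hQ q hq) h)
    · exact disjoint_of_subset_left (hQ p hp) (disjoint_of_subset_right (hP q hq) h.symm)
    · exact g2 p hp q hq hpq
  · rw [union_biUnion, h3, g3]
  · intro p hp
    rw [mem_union] at hp
    rcases hp with hp | hp
    · exact h4 p hp
    · exact g4 p hp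

lemma isTile_singleton (v : V) : IsTile F c {v} := by
  refine ⟨1, le_rfl, c v v, fun _ => v, fun a b _ => Subsingleton.elim _ _, ?_, ?_⟩
  · ext x; simp [eq_comm]
  · intro a b _; rfl

lemma tileable_card (S : Finset V) : Tileable F c S #S := by
  induction S using Finset.induction_on with
  | empty => exact tileable_empty _
  | insert a S ha ih =>
    rw [card_insert_of_notMem ha, insert_eq, add_comm]
    exact (tileable_tile (isTile_singleton a)).union ih (by simpa using ha)

lemma tileable_of_card {S : Finset V} {k : ℕ} (h : #S ≤ k) : Tileable F c S k :=
  (tileable_card S).mono h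

lemma two_tiles {t : ℕ} (ht : 1 ≤ t) (hcol : (F t).Colorable 2) (hc : ∀ a b, c a b = c b a)
    {lam rho : Fin t → V} (hl : Function.Injective lam) (hr : Function.Injective rho)
    (hlr : ∀ u v, lam u ≠ rho v) (col : κ) (h : ∀ u v, (F t).Adj u v → c (lam u) (rho v) = col) :
    Tileable F c (univ.image lam ∪ univ.image rho) 2 := by
  obtain ⟨C⟩ := hcol
  have hχ : ∀ a b, (F t).Adj a b → (C a = 0 ↔ ¬ C b = 0) := by
    intro a b hab
    have h1 := C.valid hab
    have h2 : (C a) ≠ (C b) := h1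
    generalize C a = x at h2 ⊢
    generalize C b = y at h2 ⊢
    revert h2; revert x y; decide
  have key : ∀ (p : Fin t → Prop), (∀ a b, (F t).Adj a b → (p a ↔ ¬ p b)) →
      IsTile F c (univ.image (fun v => if p v then lam v else rho v)) := by
    intro p hp
    refine ⟨t, ht, col, _, ?_, rfl, ?_⟩
    · intro a b hab
      dsimp only at hab
      split_ifs at hab with h1 h2 h2
      · exact hl hab
      · exact absurd hab (hlr _ _)
      · exact absurd hab.symm (hlr _ _)
      · exact hr hab
    · intro a b hab
      have := hp a b hab
      by_cases h1 : p a
      · rw [if_pos h1, if_neg (this.1 h1)]; exact h a b hab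
      · have h2 : p b := by by_contra h2; exact h1 (this.2 h2)
        rw [if_neg h1, if_pos h2, hc]; exact h b a hab.symm
  have t1 := key (fun v => C v = 0) hχ
  have t2 := key (fun v => ¬ C v = 0) (fun a b hab => by have := hχ a b hab; tauto)
  have := (tileable_tile t1).union (tileable_tile t2) (by
    rw [disjoint_left]
    intro x hx hy
    rw [mem_image] at hx hy
    obtain ⟨a, -, rfl⟩ := hx
    obtain ⟨b, -, hb⟩ := hy
    by_cases h1 : C a = 0 <;> by_cases h2 : C b = 0
    · simp only [h1, h2, if_true, not_true, if_false] at hb; exact hlr _ _ hb.symm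
    · simp only [h1, h2, if_true, not_false_eq_true] at hb
      have := hl hb; rw [this] at h2; exact h2 h1
    · simp only [h1, h2, not_true, if_false] at hb
      have := hr hb; rw [this] at h2; exact h1 h2
    · simp only [h1, h2, not_false_eq_true, if_true, if_false] at hb; exact hlr _ _ hb)
  convert this using 1
  ext x
  simp only [mem_union, mem_image, mem_univ, true_and]
  constructor
  · rintro (⟨a, rfl⟩ | ⟨a, rfl⟩) <;> by_cases h1 : C a = 0
    · exact Or.inl ⟨a, by simp [h1]⟩
    · exact Or.inr ⟨a, by simp [h1]⟩
    · exact Or.inr ⟨a, by simp [h1]⟩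
    · exact Or.inl ⟨a, by simp [h1]⟩
  · rintro (⟨a, rfl⟩ | ⟨a, rfl⟩) <;> by_cases h1 : C a = 0
    · exact Or.inl ⟨a, by simp [h1]⟩
    · exact Or.inr ⟨a, by simp [h1]⟩
    · exact Or.inr ⟨a, by simp [h1]⟩
    · exact Or.inl ⟨a, by simp [h1]⟩

end basics

/-- if all common neighbourhoods are large, partners can be chosen greedily -/
lemma hall_big {ι : Type*} [Fintype ι] [Nonempty V] (N : ι → Finset V) (h : ∀ w, Fintype.card ι ≤ #(N w)) :
    ∃ f : ι → V, Function.Injective f ∧ ∀ w, f w ∈ N w := by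
  obtain ⟨f, h1, h2, -⟩ := hall_finset (univ : Finset ι) N (fun _ => Classical.arbitrary V) (by
    intro A _
    rcases A.eq_empty_or_nonempty with rfl | ⟨a, ha⟩
    · simp
    · exact (card_le_univ A).trans ((h a).trans (card_le_card (subset_biUnion_of_mem N ha))))
  exact ⟨f, fun a b hab => h1 (by simp) (by simp) hab, fun w => h2 w (mem_univ w)⟩

lemma sum_card_tuples {G : V → V → Prop} (A B : Finset V) (K : ℕ) :
    ∑ a ∈ Fintype.piFinset (fun _ : Fin K => A), #{b ∈ B | ∀ i, G (a i) b} =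
      ∑ b ∈ B, #{a ∈ A | G a b} ^ K := by
  simp only [card_filter]
  rw [sum_comm]
  apply sum_congr rfl
  intro b _
  rw [← card_filter, ← card_filter]
  have : {a ∈ Fintype.piFinset (fun _ : Fin K => A) | ∀ i, G (a i) b} =
      Fintype.piFinset (fun _ : Fin K => {a ∈ A | G a b}) := by
    ext a; simp only [mem_filter, Fintype.mem_piFinset]; exact ⟨fun h i => ⟨h.1 i, h.2 i⟩, fun h => ⟨fun i => (h i).1, fun i => (h i).2⟩⟩
  rw [this, Fintype.card_piFinset]; simp

lemma cn_tuple_card {G : V → V → Prop} (A : Finset V) (K k : ℕ) (q : Fin k → V) :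
    #{a ∈ Fintype.piFinset (fun _ : Fin K => A) | ∀ j i, G (a i) (q j)} = #(cn G A (univ.image q)) ^ K := by
  have : {a ∈ Fintype.piFinset (fun _ : Fin K => A) | ∀ j i, G (a i) (q j)} =
      Fintype.piFinset (fun _ : Fin K => cn G A (univ.image q)) := by
    ext a; simp only [mem_filter, Fintype.mem_piFinset, mem_cn, mem_image, mem_univ, true_and, forall_exists_index,
      forall_apply_eq_imp_iff]
    exact ⟨fun h i => ⟨h.1 i, fun j => h.2 j i⟩, fun h => ⟨fun i => (h i).1, fun j i => (h i).2 j⟩⟩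
  rw [this, Fintype.card_piFinset]; simp

/-- dependent random choice -/
lemma drc {G : V → V → Prop} (A B : Finset V) (m r K t : ℕ) (hr : 0 < r) (hK : 0 < K) (hm : 0 < m) (ht1 : 1 ≤ t)
    (hA : #A = m) (hB : #B = m) (hd : m * m ≤ r * ∑ b ∈ B, #{a ∈ A | G a b})
    (ht : t * (32 * K * r ^ (K + 1)) ≤ m) :
    ∃ S ⊆ B, m ≤ 2 * r ^ K * #S ∧
      #{q ∈ Fintype.piFinset (fun _ : Fin K => S) | #(cn G A (univ.image q)) < t} < (#S / (4 * K) + 1) ^ K := by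
  obtain ⟨S, hS⟩ : ∃ S : (Fin K → V) → Finset V, ∀ a, S a = {b ∈ B | ∀ i, G (a i) b} := ⟨_, fun _ => rfl⟩
  obtain ⟨bad, hbad⟩ : ∃ bad : (Fin K → V) → ℕ, ∀ a, bad a =
    #{q ∈ Fintype.piFinset (fun _ : Fin K => S a) | #(cn G A (univ.image q)) < t} := ⟨_, fun _ => rfl⟩
  have hm0 : (0:ℝ) < m := by exact_mod_cast hm
  have hr0 : (0:ℝ) < r := by exact_mod_cast hr
  have hK0 : (0:ℝ) < K := by exact_mod_cast hK
  obtain ⟨TT, hTT⟩ : ∃ TT, TT = Fintype.piFinset (fun _ : Fin K => A) := ⟨_, rfl⟩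
  have hTc : #TT = m ^ K := by rw [hTT, Fintype.card_piFinset]; simp [hA]
  -- first moment
  have h1 : (m:ℝ) ^ K * (m / r ^ K) ≤ ∑ a ∈ TT, (#(S a) : ℝ) := by
    have e : ∑ a ∈ TT, (#(S a) : ℝ) = ∑ b ∈ B, (#{a ∈ A | G a b} : ℝ) ^ K := by
      have := sum_card_tuples (G := G) A B K
      rw [← hTT] at this
      simp only [← hS] at this
      exact_mod_cast this
    rw [e]
    obtain ⟨K', rfl⟩ : ∃ K', K = K' + 1 := ⟨K - 1, by omega⟩
    refine le_trans ?_ (pow_sum_div_card_le_sum_pow (fun i _ => by positivity) K')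
    rw [hB, le_div_iff₀ (by positivity)]
    have h2 : (m * m / r : ℝ) ≤ ∑ b ∈ B, (#{a ∈ A | G a b} : ℝ) := by
      rw [div_le_iff₀ hr0]
      have : ((m * m : ℕ) : ℝ) ≤ ((r * ∑ b ∈ B, #{a ∈ A | G a b} : ℕ) : ℝ) := by exact_mod_cast hd
      push_cast at this
      linarith
    calc (m:ℝ) ^ (K'+1) * (m / r ^ (K'+1)) * m ^ K' = (m * m / r) ^ (K'+1) := by
          rw [div_pow, mul_pow]; ring
      _ ≤ _ := by gcongr
  -- bad tuples
  have h2 : ∑ a ∈ TT, (bad a : ℝ) ≤ (m:ℝ) ^ K * (t:ℝ) ^ K := by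
    have : ∑ a ∈ TT, bad a ≤ m ^ K * t ^ K := by
      have e1 : ∀ a, bad a = ∑ q ∈ Fintype.piFinset (fun _ : Fin K => B) with #(cn G A (univ.image q)) < t,
          if ∀ j i, G (a i) (q j) then 1 else 0 := by
        intro a
        rw [hbad, ← card_filter]
        congr 1
        ext q
        simp only [mem_filter, Fintype.mem_piFinset, hS]
        constructor
        · rintro ⟨h, h'⟩; exact ⟨⟨fun j => (h j).1, h'⟩, fun j => (h j).2⟩
        · rintro ⟨⟨h, h'⟩, h''⟩; exact ⟨fun j => ⟨h j, h'' j⟩, h'⟩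
      simp only [e1]
      rw [sum_comm]
      calc _ ≤ ∑ q ∈ Fintype.piFinset (fun _ : Fin K => B) with #(cn G A (univ.image q)) < t, t ^ K := by
            apply sum_le_sum
            intro q hq
            rw [← card_filter, hTT, cn_tuple_card]
            exact Nat.pow_le_pow_left (mem_filter.1 hq).2.le _
        _ ≤ m ^ K * t ^ K := by
            rw [sum_const, smul_eq_mul]
            gcongr
            refine (card_le_card (filter_subset _ _)).trans ?_
            rw [Fintype.card_piFinset]; simp [hB]
    exact_mod_cast this
  -- averaging
  have ht00 : (0:ℝ) < (t:ℝ) ^ K := by positivity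
  have hp : (0:ℝ) < m / r ^ K := by positivity
  have hTne : TT.Nonempty := by rw [← card_pos, hTc]; positivity
  obtain ⟨a, ha, h⟩ := exists_le_of_sum_le (f := fun a => (m / r ^ K / 2 : ℝ) * (t:ℝ) ^ K + (m / r ^ K / 2) * bad a)
      (g := fun a => (#(S a) : ℝ) * (t:ℝ)^K) hTne (by
        rw [← sum_mul, sum_add_distrib, ← mul_sum, ← mul_sum, sum_const, hTc, nsmul_eq_mul]
        push_cast
        calc m / r ^ K / 2 * ((m:ℝ) ^ K * t ^ K) + m / r ^ K / 2 * ∑ a ∈ TT, (bad a : ℝ) ≤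
            m / r ^ K / 2 * ((m:ℝ) ^ K * t ^ K) + m / r ^ K / 2 * ((m:ℝ) ^ K * (t:ℝ) ^ K) := by gcongr
          _ = (m:ℝ) ^ K * (m / r ^ K) * t ^ K := by ring
          _ ≤ (∑ i ∈ TT, (#(S i) : ℝ)) * (t:ℝ) ^ K := by gcongr)
  have hcm : (#(S a) : ℝ) ≤ m := by
    rw [← hB]; exact_mod_cast card_le_card (by rw [hS]; exact filter_subset _ _)
  have hSbig : (m / r ^ K / 2 : ℝ) ≤ #(S a) := by
    have : (m / r ^ K / 2 : ℝ) * (t:ℝ) ^ K ≤ #(S a) * (t:ℝ) ^ K := by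
      have : 0 ≤ (m / r ^ K / 2 : ℝ) * bad a := by positivity
      linarith
    exact le_of_mul_le_mul_right this ht00
  have hSn : m ≤ 2 * r ^ K * #(S a) := by
    rw [div_div, div_le_iff₀ (by positivity)] at hSbig
    have : (m:ℝ) ≤ ((2 * r ^ K * #(S a) : ℕ) : ℝ) := by push_cast; linarith
    exact_mod_cast this
  have hbn : bad a ≤ 2 * r ^ K * t ^ K := by
    have h5 : (m / r ^ K / 2 : ℝ) * bad a ≤ m * t ^ K := by
      calc (m / r ^ K / 2 : ℝ) * bad a ≤ #(S a) * (t:ℝ) ^ K := by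
            have : 0 ≤ (m / r ^ K / 2 : ℝ) * t ^ K := by positivity
            linarith
        _ ≤ _ := by gcongr
    have h6 : (bad a : ℝ) ≤ 2 * r ^ K * t ^ K := by
      have e : (m:ℝ) * t ^ K = (m / r ^ K / 2 : ℝ) * (2 * r ^ K * t ^ K) := by field_simp
      rw [e] at h5
      exact le_of_mul_le_mul_left h5 (by positivity)
    exact_mod_cast h6
  refine ⟨S a, by rw [hS]; exact filter_subset _ _, hSn, ?_⟩
  rw [← hbad]
  have h7 : #(S a) < 4 * K * (#(S a) / (4 * K) + 1) := Nat.lt_mul_div_succ _ (by omega)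
  generalize #(S a) / (4 * K) + 1 = e at *
  have h8 : 4 * r * t < e := by
    have h9 : (8 * K * r ^ K) * (4 * r * t) < (8 * K * r ^ K) * e := by
      calc (8 * K * r ^ K) * (4 * r * t) = t * (32 * K * r ^ (K+1)) := by ring
        _ ≤ m := ht
        _ ≤ 2 * r ^ K * #(S a) := hSn
        _ < 2 * r ^ K * (4 * K * e) := by gcongr
        _ = _ := by ring
    exact lt_of_mul_lt_mul_left h9 (by positivity)
  calc bad a ≤ 2 * r ^ K * t ^ K := hbn
    _ ≤ 4 ^ K * r ^ K * t ^ K := by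
      gcongr
      calc 2 ≤ 4 ^ 1 := by norm_num
        _ ≤ 4 ^ K := Nat.pow_le_pow_right (by norm_num) hK
    _ = (4 * r * t) ^ K := by rw [mul_pow, mul_pow]
    _ < e ^ K := Nat.pow_lt_pow_left h8 hK.ne'

lemma good_empty {S : Finset V} {e : ℕ} {g0 : Finset V → Prop} {K : ℕ} (bad : (Fin K → V) → Prop)
    (hb : ∀ q, ¬ g0 (univ.image q) → bad q)
    (h : #{q ∈ Fintype.piFinset (fun _ : Fin K => S) | bad q} < (e + 1) ^ K) : Good S e g0 K ∅ := by
  intro hl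
  rw [card_empty, Nat.sub_zero] at hl
  obtain ⟨ok, hok⟩ : ∃ ok : ℕ → Finset V → Prop, ∀ k P, ok k P := ⟨fun _ _ => True, fun _ _ => trivial⟩
  have h1 := lost_count ok (e1 := 0) (by intro k P _; simp [hok]) K ∅ (hok _ _) hl
  rw [Nat.sub_zero] at h1
  have : (e+1)^K ≤ #{q ∈ Fintype.piFinset (fun _ : Fin K => S) | bad q} := by
    refine h1.trans (card_le_card ?_)
    intro q hq
    rw [mem_filter] at hq ⊢
    exact ⟨hq.1, hb q (by simpa using hq.2.2)⟩
  omega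

lemma anti_cn {G : V → V → Prop} {A : Finset V} {t : ℕ} : ∀ P Q, P ⊆ Q → t ≤ #(cn G A Q) → t ≤ #(cn G A P) :=
  fun _ _ h h' => h'.trans (card_le_card (cn_anti h))

lemma pt_univ_mem {ι : Type*} [Fintype ι] {F : SimpleGraph ι} {σ : ι → V} {u v : ι} (h : F.Adj u v) :
    σ v ∈ pt F univ σ u := by
  unfold pt; exact mem_image_of_mem _ (by simpa using h)

lemma drc_embed {G : V → V → Prop} (A B : Finset V) (m r Δ t : ℕ) (hr : 0 < r) (hm : 0 < m) (ht1 : 1 ≤ t)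
    (hA : #A = m) (hB : #B = m) (hd : m * m ≤ r * ∑ b ∈ B, #{a ∈ A | G a b})
    (ht : t * (32 * (Δ + 2) * r ^ (Δ + 2 + 1)) ≤ m) {F : SimpleGraph (Fin t)} (hF : DegLe F Δ) :
    ∃ lam rho : Fin t → V, Function.Injective lam ∧ Function.Injective rho ∧ (∀ u, lam u ∈ A) ∧
      (∀ u, rho u ∈ B) ∧ ∀ u v, F.Adj u v → G (lam u) (rho v) := by
  obtain ⟨S, hSB, hS, hbad⟩ := drc (G := G) A B m r (Δ + 2) t hr (by omega) hm ht1 hA hB hd ht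
  have hSt : 16 * t ≤ #S := by
    have : (2 * r ^ (Δ + 2)) * (16 * t) ≤ (2 * r ^ (Δ + 2)) * #S := by
      refine le_trans ?_ hS
      refine le_trans ?_ ht
      calc (2 * r ^ (Δ + 2)) * (16 * t) = t * (32 * 1 * r ^ (Δ + 2) * 1) := by ring
        _ ≤ t * (32 * (Δ + 2) * r ^ (Δ+2) * r) := by gcongr <;> omega
        _ = _ := by ring
    exact le_of_mul_le_mul_left this (by positivity)
  have he : #S / (4 * (Δ+2)) * (4 * (Δ + 2)) ≤ #S := Nat.div_mul_le_self _ _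
  generalize #S / (4 * (Δ+2)) = e at *
  obtain ⟨good, hgood⟩ : ∃ good : Finset V → Prop, good = Good S e (fun P => t ≤ #(cn G A P)) (Δ+2) := ⟨_, rfl⟩
  have hg0 : good ∅ := by
    rw [hgood]
    exact good_empty (fun q => #(cn G A (univ.image q)) < t) (fun q h => by simpa using h) (by convert hbad)
  have hV : Nonempty V := by
    obtain ⟨x, -⟩ := card_pos.1 (by omega : 0 < #S); exact ⟨x⟩
  obtain ⟨σ, -, hσ⟩ := greedy_embed (e := e) hF (Gr := fun _ => S) (good := fun _ => good) (D0 := ∅)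
    (σ0 := fun _ => Classical.arbitrary V)
    ⟨by simp, by simp, fun w => by simpa [pt] using hg0⟩
    (fun u w _ _ P hP h => by rw [hgood] at h ⊢; exact good_ext (by omega) h)
    (fun u _ => by
      rw [Fintype.card_fin]
      nlinarith)
  obtain ⟨h1, h2, h3⟩ := hσ
  obtain ⟨lam, hl1, hl2⟩ := hall_big (fun w => cn G A (pt F univ σ w)) (by
    intro w
    rw [Fintype.card_fin]
    have := h3 w
    rw [hgood] at this
    exact good_final anti_cn (by nlinarith) this)
  refine ⟨lam, σ, hl1, fun a b hab => h1 (by simp) (by simp) hab, fun u => (mem_cn.1 (hl2 u)).1,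
    fun u => hSB (h2 u (mem_univ u)), fun u v huv => (mem_cn.1 (hl2 u)).2 _ (pt_univ_mem huv)⟩

/-- majority colour -/
lemma majority {r : ℕ} (c : V → V → Fin r) (A B : Finset V) :
    (#A * #B = 0 ∧ r = 0) ∨ ∃ col : Fin r, #A * #B ≤ r * ∑ b ∈ B, #{a ∈ A | c a b = col} := by
  rcases Nat.eq_zero_or_pos r with hr | hr
  · left
    refine ⟨?_, hr⟩
    rcases A.eq_empty_or_nonempty with h | ⟨a, -⟩
    · simp [h]
    · subst hr; exact (c a a).elim0
  right
  by_contra hc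
  push Not at hc
  have h1 : ∑ col : Fin r, (r * ∑ b ∈ B, #{a ∈ A | c a b = col}) < ∑ col : Fin r, #A * #B := by
    apply sum_lt_sum_of_nonempty
    · exact ⟨⟨0, hr⟩, mem_univ _⟩
    · intro col _; exact hc col
  rw [← mul_sum, sum_comm] at h1
  have h2 : ∀ b ∈ B, ∑ col : Fin r, #{a ∈ A | c a b = col} = #A := by
    intro b _
    exact (card_eq_sum_card_fiberwise (f := fun a => c a b) (t := univ) (by simp [Set.MapsTo])).symm
  rw [sum_congr rfl h2, sum_const, sum_const, card_univ, Fintype.card_fin, smul_eq_mul, smul_eq_mul] at h1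
  rw [mul_comm #B #A] at h1
  exact lt_irrefl _ h1

lemma drc_step {r Δ Z : ℕ} (hr : 0 < r) {F : (i : ℕ) → SimpleGraph (Fin i)} (hF : FOK F Δ)
    {c : V → V → Fin r} (hc : ∀ a b, c a b = c b a) (hZ : 400 * (Δ + 2) * r ^ (Δ + 3) ≤ Z)
    (W : Finset V) (hW : Z ≤ #W) : ∃ U ⊆ W, Tileable F c U 2 ∧ #W ≤ Z * #U := by
  obtain ⟨Q, hQ⟩ : ∃ Q, Q = (Δ + 2) * r ^ (Δ + 3) := ⟨_, rfl⟩
  have hQ0 : 0 < Q := by rw [hQ]; positivity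
  have hZQ : 400 * Q ≤ Z := by rw [hQ, ← mul_assoc]; exact hZ
  obtain ⟨m, hm⟩ : ∃ m, m = #W / 2 := ⟨_, rfl⟩
  obtain ⟨A, hAW, hA⟩ := exists_subset_card_eq (s := W) (n := m) (by omega)
  obtain ⟨B, hBW, hB⟩ := exists_subset_card_eq (s := W \ A) (n := m) (by
    rw [card_sdiff_of_subset hAW]; omega)
  have hmpos : 200 * Q ≤ m := by omega
  obtain ⟨col, hcol⟩ : ∃ col : Fin r, #A * #B ≤ r * ∑ b ∈ B, #{a ∈ A | c a b = col} := by
    rcases majority c A B with h | h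
    · omega
    · exact h
  rw [hA, hB] at hcol
  have ht : m / (32 * Q) * (32 * Q) ≤ m := Nat.div_mul_le_self _ _
  have ht2 : m < 32 * Q * (m / (32 * Q) + 1) := Nat.lt_mul_div_succ _ (by omega)
  have ht1 : 1 ≤ m / (32 * Q) := Nat.div_pos (by omega) (by omega)
  generalize m / (32 * Q) = t at *
  obtain ⟨lam, rho, h1, h2, h3, h4, h5⟩ := drc_embed (G := fun a b => c a b = col) A B m r Δ t hr (by omega) ht1 hA hB (by convert hcol)
    (by rw [hQ] at ht; refine le_trans (le_of_eq ?_) ht; ring) (hF.deg t ht1)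
  have hdisj : ∀ u v, lam u ≠ rho v := by
    intro u v h
    have := hBW (h4 v)
    rw [mem_sdiff, ← h] at this
    exact this.2 (h3 u)
  refine ⟨univ.image lam ∪ univ.image rho, ?_, two_tiles ht1 (hF.col t ht1) hc h1 h2 hdisj col h5, ?_⟩
  · intro x hx
    simp only [mem_union, mem_image, mem_univ, true_and] at hx
    rcases hx with ⟨u, rfl⟩ | ⟨u, rfl⟩
    · exact hAW (h3 u)
    · exact (mem_sdiff.1 (hBW (h4 u))).1
  · have : t ≤ #(univ.image lam ∪ univ.image rho) := by
      refine le_trans ?_ (card_le_card subset_union_left)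
      rw [card_image_of_injective _ h1]; simp
    have h6 : #W ≤ 2 * m + 1 := by omega
    have h7 : m < 32 * Q * (2 * t) := lt_of_lt_of_le ht2 (Nat.mul_le_mul_left _ (by omega))
    calc #W ≤ 400 * Q * t := by nlinarith
      _ ≤ Z * _ := by gcongr

lemma drc_iter {r Δ Z : ℕ} (hr : 0 < r) {F : (i : ℕ) → SimpleGraph (Fin i)} (hF : FOK F Δ)
    {c : V → V → Fin r} (hc : ∀ a b, c a b = c b a) (hZ : 400 * (Δ + 2) * r ^ (Δ + 3) ≤ Z) (T : ℕ) :
    ∀ (W : Finset V), ∃ U ⊆ W, Tileable F c U (2 * T + Z) ∧ #(W \ U) * Z ^ T ≤ (Z - 1) ^ T * #W := by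
  induction T with
  | zero => intro W; exact ⟨∅, by simp, tileable_empty _, by simp⟩
  | succ T ih =>
    intro W
    by_cases hW : Z ≤ #W
    · obtain ⟨U1, hU1, h1, h2⟩ := drc_step hr hF hc hZ W hW
      obtain ⟨U2, hU2, h3, h4⟩ := ih (W \ U1)
      refine ⟨U1 ∪ U2, union_subset hU1 (hU2.trans sdiff_subset), (h1.union h3 ?_).mono (by omega), ?_⟩
      · exact disjoint_of_subset_right hU2 disjoint_sdiff
      · have e0 : W \ (U1 ∪ U2) = (W \ U1) \ U2 := by ext x; simp only [mem_sdiff, mem_union]; tauto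
        rw [e0]
        have hz : 0 < Z := lt_of_lt_of_le (by positivity) hZ
        obtain ⟨z, rfl⟩ : ∃ z, Z = z + 1 := ⟨Z - 1, by omega⟩
        rw [Nat.add_sub_cancel] at h4 ⊢
        have hcd : #(W \ U1) + #U1 = #W := card_sdiff_add_card_eq_card hU1
        have h5 : #(W \ U1) * (z+1) ≤ z * #W := by nlinarith
        calc #((W \ U1) \ U2) * (z+1)^(T+1) = #((W \ U1) \ U2) * (z+1)^T * (z+1) := by ring
          _ ≤ z ^ T * #(W \ U1) * (z+1) := by gcongr
          _ = z ^ T * (#(W \ U1) * (z+1)) := by ring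
          _ ≤ z ^ T * (z * #W) := by gcongr
          _ = _ := by ring
    · exact ⟨W, subset_rfl, tileable_of_card (by omega), by simp⟩

end Tiling

namespace Tiling
open Finset Classical

variable {V κ : Type*}

def CovAll (F : (i : ℕ) → SimpleGraph (Fin i)) (c : V → V → κ) (B A : Finset V) (θ k : ℕ) : Prop :=
  ∀ Zf : Finset V, #Zf + #B ≤ θ → ∃ H ⊆ A \ Zf, #H ≤ #B ∧ #B ≤ #H + k ∧ Tileable F c (B ∪ H) k

section cov
variable {F : (i : ℕ) → SimpleGraph (Fin i)} {c : V → V → κ}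

lemma CovAll.mono {B A : Finset V} {θ k k' : ℕ} (h : CovAll F c B A θ k) (hk : k ≤ k') :
    CovAll F c B A θ k' := by
  intro Zf hZ
  obtain ⟨H, h1, h2, h3, h4⟩ := h Zf hZ
  exact ⟨H, h1, h2, by omega, h4.mono hk⟩

lemma covAll_card (B A : Finset V) (θ : ℕ) : CovAll F c B A θ #B := by
  intro Zf _
  exact ⟨∅, by simp, by simp, by simp, by simpa using tileable_card B⟩

lemma CovAll.union {B1 B2 A : Finset V} {θ k1 k2 : ℕ} (h1 : CovAll F c B1 A θ k1)
    (h2 : CovAll F c B2 A θ k2) (hd : Disjoint B1 B2) (hA : Disjoint (B1 ∪ B2) A) :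
    CovAll F c (B1 ∪ B2) A θ (k1 + k2) := by
  intro Zf hZ
  rw [card_union_of_disjoint hd] at hZ ⊢
  obtain ⟨H1, a1, a2, a3, a4⟩ := h1 Zf (by omega)
  obtain ⟨H2, b1, b2, b3, b4⟩ := h2 (Zf ∪ H1) (by have := card_union_le Zf H1; omega)
  have hHd : Disjoint H1 H2 := by
    rw [disjoint_left]; intro x hx hy
    have := b1 hy; simp [hx] at this
  have m1 : ∀ x ∈ H1, x ∈ A := fun x hx => (mem_sdiff.1 (a1 hx)).1
  have m2 : ∀ x ∈ H2, x ∈ A := fun x hx => (mem_sdiff.1 (b1 hx)).1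
  refine ⟨H1 ∪ H2, ?_, ?_, ?_, ?_⟩
  · refine union_subset a1 (b1.trans ?_)
    intro x hx; simp only [mem_sdiff, mem_union] at hx ⊢; tauto
  · rw [card_union_of_disjoint hHd]; omega
  · rw [card_union_of_disjoint hHd]; omega
  · have := a4.union b4 (by
      rw [disjoint_left] at hd hA hHd ⊢
      intro x hx hy
      rw [mem_union] at hx hy
      rcases hx with hx | hx <;> rcases hy with hy | hy
      · exact hd hx hy
      · exact hA (mem_union_left _ hx) (m2 x hy)
      · exact hA (mem_union_right _ hy) (m1 x hx)
      · exact hHd hx hy)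
    convert this using 1
    ext x; simp only [mem_union]; tauto

lemma covAll_biUnion {ι : Type*} {A : Finset V} {θ k : ℕ} (I : Finset ι) (B : ι → Finset V)
    (h : ∀ i ∈ I, CovAll F c (B i) A θ k) (hd : ∀ i ∈ I, ∀ j ∈ I, i ≠ j → Disjoint (B i) (B j))
    (hA : ∀ i ∈ I, Disjoint (B i) A) : CovAll F c (I.biUnion B) A θ (#I * k) := by
  induction I using Finset.induction_on with
  | empty =>
    have := covAll_card (F := F) (c := c) (∅ : Finset V) A θ
    simpa using this
  | insert a I ha ih =>
    rw [biUnion_insert, card_insert_of_notMem ha, Nat.succ_mul, add_comm]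
    apply (h a (mem_insert_self _ _)).union
    · exact ih (fun i hi => h i (mem_insert_of_mem hi))
        (fun i hi j hj => hd i (mem_insert_of_mem hi) j (mem_insert_of_mem hj))
        (fun i hi => hA i (mem_insert_of_mem hi))
    · rw [disjoint_biUnion_right]
      intro i hi
      exact hd a (mem_insert_self _ _) i (mem_insert_of_mem hi) (by rintro rfl; exact ha hi)
    · rw [← biUnion_insert, disjoint_biUnion_left]
      exact hA

lemma covAll_tile {t : ℕ} (ht : 1 ≤ t) (hcol : (F t).Colorable 2) (hc : ∀ a b, c a b = c b a)
    {A C : Finset V} {θ : ℕ} {σ : Fin t → V} (hσ : Function.Injective σ) (hC : univ.image σ = C)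
    (hCA : Disjoint C A) (col : κ) (h : ∀ w, θ ≤ #(cn (fun a b => c a b = col) A (pt (F t) univ σ w))) :
    CovAll F c C A θ 2 := by
  intro Zf hZ
  have hCt : #C = t := by rw [← hC, card_image_of_injective _ hσ]; simp
  have hV : Nonempty V := ⟨σ ⟨0, by omega⟩⟩
  obtain ⟨lam, hl1, hl2⟩ := hall_big (fun w => cn (fun a b => c a b = col) A (pt (F t) univ σ w) \ Zf) (by
    intro w
    rw [Fintype.card_fin]
    have h1 := h w
    have h2 := le_card_sdiff Zf (cn (fun a b => c a b = col) A (pt (F t) univ σ w))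
    omega)
  have hl3 : ∀ w, lam w ∈ A ∧ lam w ∉ Zf := fun w => by
    have := hl2 w; rw [mem_sdiff, mem_cn] at this; exact ⟨this.1.1, this.2⟩
  have hcard : #(univ.image lam) = t := by rw [card_image_of_injective _ hl1]; simp
  refine ⟨univ.image lam, ?_, by omega, by omega, ?_⟩
  · intro x hx
    rw [mem_image] at hx
    obtain ⟨w, -, rfl⟩ := hx
    exact mem_sdiff.2 (hl3 w)
  · rw [union_comm, ← hC]
    refine two_tiles ht hcol hc hl1 hσ ?_ col ?_
    · intro u v huv
      have h1 := (hl3 u).1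
      rw [huv] at h1
      exact disjoint_left.1 hCA (by rw [← hC]; exact mem_image_of_mem _ (mem_univ v)) h1
    · intro u v huv
      have := (mem_sdiff.1 (hl2 u)).1
      exact (mem_cn.1 this).2 _ (pt_univ_mem huv)

end cov

/-- number of bad completions of `b` inside `S` -/
noncomputable def nbad (G : V → V → Prop) (A : Finset V) (θ k : ℕ) (S : Finset V) (b : V) : ℕ :=
  #{q ∈ Fintype.piFinset (fun _ : Fin k => S) | #(cn G A (insert b (univ.image q))) < θ}

lemma nbad_mono {G : V → V → Prop} {A : Finset V} {θ k : ℕ} {S T : Finset V} (h : S ⊆ T) (b : V) :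
    nbad G A θ k S b ≤ nbad G A θ k T b := by
  unfold nbad
  apply card_le_card
  intro q hq
  simp only [mem_filter, Fintype.mem_piFinset] at hq ⊢
  exact ⟨fun i => h (hq.1 i), hq.2⟩

lemma good_single0 {S : Finset V} {k e : ℕ} {b : V} {g0 : Finset V → Prop} (bad : (Fin k → V) → Prop)
    (hb : ∀ q, ¬ g0 (insert b (univ.image q)) → bad q)
    (h : #{q ∈ Fintype.piFinset (fun _ : Fin k => S) | bad q} < (e + 1) ^ k) : Good S e g0 (k + 1) {b} := by
  intro hl
  rw [card_singleton, Nat.add_sub_cancel] at hl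
  obtain ⟨ok, hok⟩ : ∃ ok : ℕ → Finset V → Prop, ∀ k P, ok k P := ⟨fun _ _ => True, fun _ _ => trivial⟩
  have h1 := lost_count ok (e1 := 0) (by intro k P _; simp [hok]) k {b} (hok _ _) hl
  rw [Nat.sub_zero] at h1
  have : (e+1)^k ≤ #{q ∈ Fintype.piFinset (fun _ : Fin k => S) | bad q} := by
    refine h1.trans (card_le_card ?_)
    intro q hq
    rw [mem_filter] at hq ⊢
    exact ⟨hq.1, hb q hq.2.2⟩
  omega

lemma good_single {G : V → V → Prop} {A S : Finset V} {θ k e : ℕ} {b : V}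
    (h : nbad G A θ k S b < (e + 1) ^ k) : Good S e (fun P => θ ≤ #(cn G A P)) (k + 1) {b} :=
  good_single0 (fun q => #(cn G A (insert b (univ.image q))) < θ) (fun q hq => by simpa using hq)
    (by unfold nbad at h; convert h)

lemma good_empty' {G : V → V → Prop} {A S : Finset V} {θ k e : ℕ}
    (h : ∀ b ∈ S, nbad G A θ k S b < (e + 1) ^ k) : Good S e (fun P => θ ≤ #(cn G A P)) (k + 1) ∅ := by
  intro hl
  rw [card_empty, Nat.sub_zero] at hl
  simp only [lost] at hl
  obtain ⟨y, hy⟩ := card_pos.1 (lt_of_le_of_lt (Nat.zero_le _) hl)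
  rw [mem_filter] at hy
  refine good_single (h y hy.1) ?_
  rw [card_singleton, Nat.add_sub_cancel]
  simpa using hy.2

lemma eng_num {Δ R K Z t e : ℕ} (hz : ZOK Δ R K Z) (htZ : Z ^ 16 ≤ t) (he : e * Z ^ 10 ≤ t) :
    (1 + Δ * e * 2 ^ Δ / (t / Z ^ 2 : ℕ) : ℝ) ^ t * t ≤ 2 ^ (t / Z ^ 2) := by
  have hbig := hz.big
  have hD2 := hz.D2
  have hZ0 : (0:ℝ) < Z := by exact_mod_cast (by omega : 0 < Z)
  obtain ⟨z, hzd⟩ : ∃ z : ℝ, z = 1 / Z := ⟨_, rfl⟩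
  have hz0 : 0 < z := by rw [hzd]; positivity
  have hzZ : z * Z = 1 := by rw [hzd]; field_simp
  have hz1 : z ≤ 1 / 1000 := by
    rw [hzd]; apply one_div_le_one_div_of_le (by norm_num); exact_mod_cast hbig
  have htR : (Z:ℝ) ^ 16 ≤ t := by exact_mod_cast htZ
  have ht0 : (0:ℝ) < t := lt_of_lt_of_le (by positivity) htR
  have hlog := log_small hbig htZ
  rw [← hzd] at hlog
  have ht2 : 2 ≤ t * z ^ 2 := by
    have h1 : (Z:ℝ) ^ 16 * z ^ 2 ≤ t * z ^ 2 := by gcongr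
    have h2 : (Z:ℝ) ^ 16 * z ^ 2 = Z ^ 14 * (z * Z) ^ 2 := by ring
    have h3 : (Z:ℝ) ^ 1 ≤ Z ^ 14 := pow_le_pow_right₀ (by exact_mod_cast (by omega : 1 ≤ Z)) (by norm_num)
    have h4 : (1000:ℝ) ≤ Z := by exact_mod_cast hbig
    rw [h2, hzZ] at h1
    linarith
  have hh : t * z ^ 2 / 2 ≤ ((t / Z ^ 2 : ℕ) : ℝ) := by
    have h1 : t < Z ^ 2 * (t / Z ^ 2 + 1) := Nat.lt_mul_div_succ _ (by positivity)
    have h2 : (t:ℝ) < (Z:ℝ) ^ 2 * ((t / Z ^ 2 : ℕ) + 1) := by exact_mod_cast h1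
    have h3 : (t:ℝ) * z ^ 2 < ((Z:ℝ) ^ 2 * ((t / Z ^ 2 : ℕ) + 1)) * z ^ 2 := by gcongr
    have h4 : ((Z:ℝ) ^ 2 * ((t / Z ^ 2 : ℕ) + 1)) * z ^ 2 = (z * Z) ^ 2 * ((t / Z ^ 2 : ℕ) + 1) := by ring
    rw [h4, hzZ] at h3
    linarith
  generalize t / Z ^ 2 = h at *
  have hh0 : (0:ℝ) < h := by linarith
  have heR : (e:ℝ) ≤ t * z ^ 10 := by
    have h1 : (e:ℝ) * Z ^ 10 ≤ t := by exact_mod_cast he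
    have h2 : (e:ℝ) * Z ^ 10 * z ^ 10 ≤ t * z ^ 10 := by gcongr
    have h3 : (e:ℝ) * Z ^ 10 * z ^ 10 = e * (z * Z) ^ 10 := by ring
    rw [h3, hzZ] at h2
    linarith
  have hA : (Δ * e * 2 ^ Δ / h : ℝ) ≤ z ^ 6 := by
    rw [div_le_iff₀ hh0]
    have h2 : (4 * (Δ * 2 ^ Δ) : ℝ) ≤ Z := by exact_mod_cast hD2
    calc (Δ * e * 2 ^ Δ : ℝ) = (4 * (Δ * 2 ^ Δ)) * (e / 4) := by ring
      _ ≤ Z * (t * z ^ 10 / 4) := by gcongr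
      _ = (z * Z) * (t * z ^ 8 * (z / 4)) := by ring
      _ ≤ (z * Z) * (t * z ^ 8 * (1 / 2)) := by
        have : z / 4 ≤ 1 / 2 := by linarith
        gcongr
      _ = z ^ 6 * (t * z ^ 2 / 2) := by rw [hzZ]; ring
      _ ≤ z ^ 6 * h := by gcongr
  have hA' : (1 + Δ * e * 2 ^ Δ / h : ℝ) ^ t ≤ Real.exp (t * z ^ 6) := by
    rw [Real.exp_nat_mul]
    gcongr
    have := Real.add_one_le_exp (z ^ 6); linarith
  have hD : Real.exp (h / 2) ≤ 2 ^ h := by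
    have : (h / 2 : ℝ) = h * (1 / 2) := by ring
    rw [this, Real.exp_nat_mul]
    gcongr
    have h1 := Real.exp_one_lt_d9
    have h2 : Real.exp (1/2) ^ 2 = Real.exp 1 := by rw [← Real.exp_nat_mul]; norm_num
    have h3 := Real.exp_pos (1/2)
    nlinarith
  refine le_trans ?_ hD
  calc _ ≤ Real.exp (t * z ^ 6) * Real.exp (Real.log t) := by
        rw [Real.exp_log ht0]; gcongr
    _ = Real.exp (t * z ^ 6 + Real.log t) := by rw [Real.exp_add]
    _ ≤ _ := by
      apply Real.exp_le_exp.2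
      have h6 : t * z ^ 6 ≤ t * z ^ 2 * (1/1000) := by
        calc t * z ^ 6 = t * z ^ 2 * (z * z ^ 3) := by ring
          _ ≤ t * z ^ 2 * ((1/1000) * 1) := by
            gcongr
            exact pow_le_one₀ hz0.le (by linarith)
          _ = _ := by ring
      have h8 : t * z ^ 8 ≤ t * z ^ 2 * (1/1000) := by
        calc t * z ^ 8 = t * z ^ 2 * (z * z ^ 5) := by ring
          _ ≤ t * z ^ 2 * ((1/1000) * 1) := by
            gcongr
            exact pow_le_one₀ hz0.le (by linarith)
          _ = _ := by ring
      linarith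

lemma exact_cluster {Δ R Z t e θ : ℕ} (hz : ZOK Δ R (Δ + 2) Z) {F : SimpleGraph (Fin t)} (hF : DegLe F Δ)
    {G : V → V → Prop} {A Y : Finset V} (hY : #Y = t) (htZ : Z ^ 16 ≤ t) (he : e * Z ^ 10 ≤ t)
    (hb : ∀ b ∈ Y, nbad G A θ (Δ + 1) Y b < (e + 1) ^ (Δ + 1)) :
    ∃ σ : Fin t → V, Function.Injective σ ∧ univ.image σ = Y ∧ ∀ w, θ ≤ #(cn G A (pt F univ σ w)) := by
  have hbig := hz.big
  have hDD := hz.DD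
  have hZ0 : 0 < Z := by omega
  have h16 : Z ^ 2 ≤ t := (Nat.pow_le_pow_right hZ0 (by norm_num)).trans htZ
  have htpos : 0 < t := lt_of_lt_of_le (by positivity) htZ
  have hd1 : t / Z * Z ≤ t := Nat.div_mul_le_self _ _
  have hd1' : t < Z * (t / Z + 1) := Nat.lt_mul_div_succ _ (by omega)
  have hd2 : t / Z ^ 2 * Z ^ 2 ≤ t := Nat.div_mul_le_self _ _
  have hg : 0 < t / Z ^ 2 := Nat.div_pos h16 (by positivity)
  have het : e * Z ≤ t / Z := by
    rw [Nat.le_div_iff_mul_le hZ0]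
    calc e * Z * Z = e * Z ^ 2 := by ring
      _ ≤ e * Z ^ 10 := by gcongr <;> omega
      _ ≤ t := he
  have het2 : t / Z ^ 2 * 2 ≤ t / Z := by
    rw [Nat.le_div_iff_mul_le hZ0]
    calc t / Z ^ 2 * 2 * Z = t / Z ^ 2 * (2 * Z) := by ring
      _ ≤ t / Z ^ 2 * (Z * Z) := by gcongr; omega
      _ = t / Z ^ 2 * Z ^ 2 := by ring
      _ ≤ t := hd2
  have hΔe : Δ * e * 2 ≤ t / Z := by
    calc Δ * e * 2 = e * (2 * Δ) := by ring
      _ ≤ e * Z := by gcongr; omega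
      _ ≤ _ := het
  have het3 : e < t := by
    have : e * 1000 ≤ t := le_trans (Nat.mul_le_mul_left _ (hbig.trans (Nat.le_self_pow (by norm_num) Z))) he
    omega
  obtain ⟨J, -, hJc, hJ⟩ := exists_indep2 hF univ (t / Z) (by
    rw [card_univ, Fintype.card_fin]
    calc t / Z * (Δ * Δ + 1) ≤ t / Z * Z := by gcongr; omega
      _ ≤ t := hd1)
  obtain ⟨y0, -⟩ := card_pos.1 (by omega : 0 < #Y)
  obtain ⟨good, hgood⟩ : ∃ good : Finset V → Prop, good = Good Y e (fun P => θ ≤ #(cn G A P)) (Δ+1+1) := ⟨_, rfl⟩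
  obtain ⟨σ, -, ⟨h1, h2, h3⟩, -⟩ := engine (e := e) (g := t / Z ^ 2) (h := t / Z ^ 2) hF (Y := Y) (good := good) hg
    (D0 := ∅) (σ0 := fun _ => y0)
    ⟨by simp, by simp, fun w => by
      have : good ∅ := by rw [hgood]; exact good_empty' hb
      simpa [pt] using this⟩
    (by rw [hY, Fintype.card_fin])
    (fun P hP h => by rw [hgood] at h ⊢; exact good_ext (by omega) h)
    (fun y hy => by rw [hgood]; exact good_single (hb y hy))
    hJ (by simp) (by omega) (by omega) (∅ : Finset Unit) (fun _ _ => True) (by simp) (by simp)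
    (by
      rw [Fintype.card_fin]
      simpa using eng_num hz htZ he)
  have hinj : Function.Injective σ := fun a b hab => h1 (by simp) (by simp) hab
  refine ⟨σ, hinj, ?_, ?_⟩
  · apply eq_of_subset_of_card_le
    · intro x hx
      obtain ⟨u, -, rfl⟩ := mem_image.1 hx
      exact h2 u (mem_univ u)
    · rw [card_image_of_injective _ hinj]; simp [hY]
  · intro w
    have := h3 w
    rw [hgood] at this
    exact good_final anti_cn (by omega) this

end Tiling

namespace Tiling
open Finset Classical

variable {V κ : Type*}

lemma exists_bij {ι : Type*} [Nonempty V] (J : Finset ι) (E : Finset V) (h : #J = #E) :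
    ∃ f : ι → V, Set.InjOn f J ∧ J.image f = E := by
  let e := Finset.equivOfCardEq h
  refine ⟨fun u => if hu : u ∈ J then (e ⟨u, hu⟩ : V) else Classical.arbitrary V, ?_, ?_⟩
  · intro a ha b hb hab
    have ha' : a ∈ J := ha
    have hb' : b ∈ J := hb
    simp only [ha', hb', dif_pos] at hab
    have := e.injective (Subtype.ext hab)
    simpa using this
  · ext x
    simp only [mem_image]
    constructor
    · rintro ⟨a, ha, rfl⟩
      simp only [ha, dif_pos]
      exact (e ⟨a, ha⟩).2
    · intro hx
      refine ⟨e.symm ⟨x, hx⟩, (e.symm ⟨x, hx⟩).2, ?_⟩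
      simp

lemma special_tile {Δ Z t e θ : ℕ} {F : SimpleGraph (Fin t)} (hF : DegLe F Δ)
    {G : V → V → Prop} {A S E : Finset V} (hSE : Disjoint S E) (ht : t = Z * #E) (hE0 : 0 < #E)
    (hZ4 : (Δ * Δ + 1) * (Δ * Δ + 1) ≤ Z) (hcard : ∀ S' : Finset V, #S ≤ Z * #S' → t + Δ * e < #S')
    (hcardS : t + Δ * e < #S) (hDelta : 0 < Δ)
    (hb : ∀ b ∈ S, nbad G A θ (Δ + 1) S b < (e + 1) ^ (Δ + 1))
    (hE : ∀ b ∈ E, ∃ S' ⊆ S, #S ≤ Z * #S' ∧ nbad G A θ (Δ + 1) S' b < (e + 1) ^ (Δ + 1)) :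
    ∃ σ : Fin t → V, Function.Injective σ ∧ E ⊆ univ.image σ ∧ univ.image σ ⊆ S ∪ E ∧
      ∀ w, θ ≤ #(cn G A (pt F univ σ w)) := by
  have heΔ : e ≤ Δ * e := Nat.le_mul_of_pos_left _ hDelta
  obtain ⟨J, hJc, hJ⟩ := exists_indep4 hF #E (by
    rw [Fintype.card_fin, ht, mul_comm]; exact Nat.mul_le_mul_right _ hZ4)
  choose! SS hSS1 hSS2 hSS3 using hE
  have hV : Nonempty V := by obtain ⟨x, -⟩ := card_pos.1 hE0; exact ⟨x⟩
  obtain ⟨σ0, hσ0, hσE⟩ := exists_bij J E hJc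
  have hσm : ∀ a ∈ J, σ0 a ∈ E := fun a ha => by rw [← hσE]; exact mem_image_of_mem _ ha
  have hnear : ∀ u : Fin t, ∃ N : Finset V, (∀ a ∈ J, rel2 F a u → N = SS (σ0 a)) ∧
      ((∀ a ∈ J, ¬ rel2 F a u) → N = S) := by
    intro u
    by_cases h : ∃ a ∈ J, rel2 F a u
    · obtain ⟨a, ha, hau⟩ := h
      refine ⟨SS (σ0 a), fun b hb hbu => ?_, fun h => absurd hau (h a ha)⟩
      rw [hJ a ha b hb ⟨u, hau, rel2_symm hbu⟩]
    · push Not at h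
      exact ⟨S, fun a ha hau => absurd hau (h a ha), fun _ => rfl⟩
  have hgr : ∀ u : Fin t, ∃ N : Finset V, (∀ a ∈ J, F.Adj u a → N = SS (σ0 a)) ∧
      ((∀ a ∈ J, ¬ F.Adj u a) → N = S) := by
    intro u
    by_cases h : ∃ a ∈ J, F.Adj u a
    · obtain ⟨a, ha, hau⟩ := h
      refine ⟨SS (σ0 a), fun b hb hbu => ?_, fun h => absurd hau (h a ha)⟩
      rw [hJ a ha b hb ⟨b, Or.inr ⟨u, hau.symm, hbu.symm⟩, Or.inl rfl⟩]
    · push Not at h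
      exact ⟨S, fun a ha hau => absurd hau (h a ha), fun _ => rfl⟩
  choose near hn1 hn2 using hnear
  choose gr hg1 hg2 using hgr
  have hnS : ∀ u, near u ⊆ S ∧ t + Δ * e < #(near u) := by
    intro u
    by_cases h : ∃ a ∈ J, rel2 F a u
    · obtain ⟨a, ha, hau⟩ := h
      rw [hn1 u a ha hau]
      exact ⟨hSS1 _ (hσm a ha), hcard _ (hSS2 _ (hσm a ha))⟩
    · push Not at h
      rw [hn2 u h]; exact ⟨subset_rfl, hcardS⟩
  have hgS : ∀ u, e < #(gr u) := by
    intro u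
    by_cases h : ∃ a ∈ J, F.Adj u a
    · obtain ⟨a, ha, hau⟩ := h
      rw [hg1 u a ha hau]
      have := hcard _ (hSS2 _ (hσm a ha))
      omega
    · push Not at h
      rw [hg2 u h]; omega
  obtain ⟨Gr, hGr⟩ : ∃ Gr : Fin t → Finset V, ∀ u, Gr u = if u ∈ J then {σ0 u} else near u := ⟨_, fun _ => rfl⟩
  obtain ⟨good, hgood⟩ : ∃ good : Fin t → Finset V → Prop, ∀ w, good w =
    Good (gr w) e (fun P => θ ≤ #(cn G A P)) (Δ+1+1) := ⟨_, fun _ => rfl⟩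
  have hinit : State F Gr good J σ0 := by
    refine ⟨hσ0, fun u hu => by rw [hGr, if_pos hu]; simp, ?_⟩
    intro w
    rw [hgood]
    by_cases h : ∃ a ∈ J, F.Adj w a
    · obtain ⟨a, ha, hwa⟩ := h
      have : pt F J σ0 w = {σ0 a} := by
        unfold pt
        have : J.filter (F.Adj w) = {a} := by
          ext b
          simp only [mem_filter, mem_singleton]
          constructor
          · rintro ⟨hb, hwb⟩
            exact (hJ a ha b hb ⟨b, Or.inr ⟨w, hwa.symm, hwb.symm⟩, Or.inl rfl⟩).symm
          · rintro rfl; exact ⟨ha, hwa⟩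
        rw [this, image_singleton]
      rw [this, hg1 w a ha hwa]
      exact good_single (hSS3 _ (hσm a ha))
    · push Not at h
      have : pt F J σ0 w = ∅ := by
        unfold pt
        rw [filter_false_of_mem h, image_empty]
      rw [this, hg2 w h]
      exact good_empty' hb
  obtain ⟨σ, hσ1, h1, h2, h3⟩ := greedy_embed (e := e) hF hinit
    (by
      intro u w hu hwu P hP hP2
      rw [hGr, if_neg hu]
      rw [hgood] at hP2
      have h5 := good_ext (by omega) hP2
      refine le_trans (card_le_card ?_) h5
      intro y hy
      rw [mem_filter] at hy ⊢
      rw [hgood] at hy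
      refine ⟨?_, hy.2⟩
      by_cases h : ∃ a ∈ J, F.Adj w a
      · obtain ⟨a, ha, hwa⟩ := h
        rw [hg1 w a ha hwa]
        rw [hn1 u a ha (Or.inr ⟨w, hwa.symm, hwu.symm⟩)] at hy
        exact hy.1
      · push Not at h
        rw [hg2 w h]
        exact (hnS u).1 hy.1)
    (by
      intro u hu
      rw [hGr, if_neg hu, Fintype.card_fin]
      exact (hnS u).2)
  refine ⟨σ, fun a b hab => h1 (by simp) (by simp) hab, ?_, ?_, ?_⟩
  · intro x hx
    rw [← hσE, mem_image] at hx
    obtain ⟨a, ha, rfl⟩ := hx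
    rw [← hσ1 a ha]
    exact mem_image_of_mem _ (mem_univ a)
  · intro x hx
    obtain ⟨u, -, rfl⟩ := mem_image.1 hx
    have := h2 u (mem_univ u)
    rw [hGr] at this
    split_ifs at this with hu
    · rw [mem_singleton.1 this]
      exact mem_union_right _ (hσm u hu)
    · exact mem_union_left _ ((hnS u).1 this)
  · intro w
    have := h3 w
    rw [hgood] at this
    exact good_final anti_cn (hgS w) this

lemma cluster {Δ R Z e θ : ℕ} (hz : ZOK Δ R (Δ + 2) Z) (hDelta : 0 < Δ) {F : (i : ℕ) → SimpleGraph (Fin i)} (hF : FOK F Δ)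
    {c : V → V → κ} (hc : ∀ a b, c a b = c b a) (col : κ) (hZ4 : (Δ * Δ + 1) * (Δ * Δ + 1) ≤ Z)
    {A S E : Finset V} (hSE : Disjoint S E) (hA : Disjoint (S ∪ E) A)
    (hS : 2 * Z ^ 16 ≤ #S) (hES : #E * Z ^ 3 ≤ #S) (he : e * (2 * Z ^ 10) ≤ #S)
    (hb : ∀ b ∈ S, nbad (fun a b => c a b = col) A θ (Δ + 1) S b < (e + 1) ^ (Δ + 1))
    (hE : ∀ b ∈ E, ∃ S' ⊆ S, #S ≤ Z * #S' ∧
      nbad (fun a b => c a b = col) A θ (Δ + 1) S' b < (e + 1) ^ (Δ + 1)) :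
    CovAll F c (S ∪ E) A θ 4 := by
  have hbig := hz.big
  have hDD := hz.DD
  have hZ0 : 0 < Z := by omega
  have main : ∀ Y ⊆ S, #S ≤ 2 * #Y → CovAll F c Y A θ 2 := by
    intro Y hY hYc
    have ht16 : Z ^ 16 ≤ #Y := by omega
    have ht1 : 1 ≤ #Y := le_trans (Nat.one_le_pow _ _ hZ0) ht16
    obtain ⟨σ, h1, h2, h3⟩ := exact_cluster (e := e) (θ := θ) (A := A) (G := fun a b => c a b = col) hz (hF.deg _ ht1) rfl ht16 (by nlinarith) (fun b hb' =>
      lt_of_le_of_lt (nbad_mono hY b) (hb b (hY hb')))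
    exact covAll_tile ht1 (hF.col _ ht1) hc h1 h2
      (disjoint_of_subset_left (hY.trans subset_union_left) hA) col h3
  rcases Nat.eq_zero_or_pos #E with hE0 | hE0
  · rw [card_eq_zero.1 hE0, union_empty]
    exact (main S subset_rfl (by omega)).mono (by norm_num)
  have ht1 : 1 ≤ Z * #E := Nat.mul_pos hZ0 hE0
  have hS0 : 0 < #S := lt_of_lt_of_le (by positivity) hS
  have hZE : Z ^ 2 * (Z * #E) ≤ #S := by
    calc Z ^ 2 * (Z * #E) = #E * Z ^ 3 := by ring
      _ ≤ _ := hES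
  have hDe : Z ^ 2 * (Δ * e) ≤ #S := by
    calc Z ^ 2 * (Δ * e) ≤ Z ^ 2 * (Z * e) := by gcongr; omega
      _ = e * Z ^ 3 := by ring
      _ ≤ e * (2 * Z ^ 10) := by
        gcongr
        calc Z ^ 3 ≤ Z ^ 10 := Nat.pow_le_pow_right hZ0 (by norm_num)
          _ ≤ _ := by omega
      _ ≤ _ := he
  have hcard : ∀ S' : Finset V, #S ≤ Z * #S' → Z * #E + Δ * e < #S' := by
    intro S' hS'
    have h1 : Z ^ 2 * (Z * #E + Δ * e) ≤ 2 * #S := by rw [mul_add]; omega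
    have h2 : Z ^ 2 * (Z * #E + Δ * e) < Z ^ 2 * #S' := by
      calc Z ^ 2 * (Z * #E + Δ * e) ≤ 2 * #S := h1
        _ < Z * #S := by gcongr; omega
        _ ≤ Z * (Z * #S') := by gcongr
        _ = _ := by ring
    exact lt_of_mul_lt_mul_left h2 (by positivity)
  obtain ⟨σ, h1, h2, h3, h4⟩ := special_tile (F := F (Z * #E)) (A := A) (θ := θ) (G := fun a b => c a b = col) (hF.deg _ ht1) hSE rfl hE0 hZ4
    hcard (hcard S (Nat.le_mul_of_pos_left _ hZ0)) hDelta hb hE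
  have hcov1 := covAll_tile ht1 (hF.col _ ht1) hc h1 rfl (disjoint_of_subset_left h3 hA) col h4
  have hcov2 := main (S \ univ.image σ) sdiff_subset (by
    have h5 := le_card_sdiff (univ.image σ) S
    rw [card_image_of_injective _ h1, card_univ, Fintype.card_fin] at h5
    have h6 := hcard S (Nat.le_mul_of_pos_left _ hZ0)
    have h7 : 2 * (Z * #E) ≤ #S := by
      refine le_trans ?_ hZE
      apply Nat.mul_le_mul_right
      calc 2 ≤ Z := by omega
        _ ≤ Z ^ 2 := Nat.le_self_pow (by norm_num) Z
    omega)
  have hu : S ∪ E = univ.image σ ∪ (S \ univ.image σ) := by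
    ext x
    have m2 := @h2 x
    have m3 := @h3 x
    simp only [mem_union, mem_sdiff] at m3 ⊢
    tauto
  rw [hu]
  exact hcov1.union hcov2 disjoint_sdiff (by rw [← hu]; exact hA)

end Tiling

namespace Tiling
open Finset Classical

variable {V κ α : Type*}

lemma family_exists (A0 : Finset α) (S : α → Finset V) (B : Finset V) (L : ℕ)
    (hSB : ∀ a ∈ A0, S a ⊆ B) (hB : 0 < #B) :
    ∃ T : Finset (Finset V), #T ≤ L ∧ (∀ p ∈ T, ∀ q ∈ T, p ≠ q → Disjoint p q) ∧
      (∀ p ∈ T, #B ≤ L * #p ∧ ∃ a ∈ A0, p ⊆ S a) ∧ ∀ a ∈ A0, L * #(S a \ T.biUnion id) < #B := by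
  obtain ⟨ok, hok⟩ : ∃ ok : Finset (Finset V) → Prop, ∀ T, ok T ↔ (∀ p ∈ T, ∀ q ∈ T, p ≠ q → Disjoint p q) ∧
      (∀ p ∈ T, #B ≤ L * #p ∧ ∃ a ∈ A0, p ⊆ S a) := ⟨_, fun _ => Iff.rfl⟩
  have hle : ∀ T, ok T → #T ≤ L := by
    intro T hT
    rw [hok] at hT
    have h1 : #(T.biUnion id) ≤ #B := by
      apply card_le_card
      rw [biUnion_subset]
      intro p hp
      obtain ⟨-, a, ha, hpa⟩ := hT.2 p hp
      exact hpa.trans (hSB a ha)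
    rw [card_biUnion (s := T) (t := id) (fun p hp q hq hpq => hT.1 p hp q hq hpq)] at h1
    have h2 : #T * #B ≤ L * ∑ p ∈ T, #(id p) := by
      rw [mul_sum, ← smul_eq_mul, ← sum_const]
      exact sum_le_sum fun p hp => (hT.2 p hp).1
    have h3 : #T * #B ≤ L * #B := h2.trans (Nat.mul_le_mul_left _ h1)
    exact Nat.le_of_mul_le_mul_right h3 hB
  have hne : ∃ k, ∃ T, ok T ∧ #T = L - k := by
    refine ⟨L, ∅, ?_, by simp⟩
    rw [hok]; simp
  obtain ⟨T, hT, hTk⟩ := Nat.find_spec hne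
  have hmax : ∀ T', ok T' → #T' ≤ #T := by
    intro T' hT'
    have h1 := hle T' hT'
    have h2 := Nat.find_min' hne (m := L - #T') ⟨T', hT', by omega⟩
    omega
  refine ⟨T, hle T hT, ((hok T).1 hT).1, ((hok T).1 hT).2, ?_⟩
  intro a ha
  by_contra hc
  push Not at hc
  obtain ⟨N, hN⟩ : ∃ N, N = S a \ T.biUnion id := ⟨_, rfl⟩
  rw [← hN] at hc
  have hNd : ∀ p ∈ T, Disjoint N p := by
    intro p hp
    rw [hN]
    exact disjoint_of_subset_right (subset_biUnion_of_mem id hp) sdiff_disjoint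
  have hNne : N.Nonempty := by
    rw [← card_pos]
    by_contra h0
    have : #N = 0 := by omega
    rw [this] at hc; omega
  have hNT : N ∉ T := by
    intro h
    have := hNd N h
    rw [disjoint_self] at this
    exact hNne.ne_empty this
  have := hmax (insert N T) (by
    have hT2 := (hok T).1 hT
    rw [hok]
    refine ⟨?_, ?_⟩
    · intro p hp q hq hpq
      rw [mem_insert] at hp hq
      rcases hp with rfl | hp <;> rcases hq with rfl | hq
      · exact absurd rfl hpq
      · exact hNd q hq
      · exact (hNd p hp).symm
      · exact hT2.1 p hp q hq hpq
    · intro p hp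
      rw [mem_insert] at hp
      rcases hp with rfl | hp
      · exact ⟨hc, a, ha, by rw [hN]; exact sdiff_subset⟩
      · exact hT2.2 p hp)
  rw [card_insert_of_notMem hNT] at this
  omega

lemma cluster_partition (A0 : Finset α) (S : α → Finset V) (B B1 : Finset V) (n r Z : ℕ) (hn : 0 < n)
    (hr : 0 < r) (hA0 : #A0 ≤ n) (hSB : ∀ a ∈ A0, S a ⊆ B) (hS : ∀ a ∈ A0, #B ≤ 8 * r * #(S a))
    (hB1 : ∀ b ∈ B1, n ≤ 16 * r ^ 2 * #{a ∈ A0 | b ∈ S a}) 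
    (hZ : 1000 ≤ Z) (hZr : 1024 * r ^ 3 ≤ Z) (hβ : Z ^ 8 ≤ #B) :
    ∃ (T : Finset (Finset V)) (Ef : Finset V → Finset V), #T ≤ Z ^ 5 ∧
      (∀ p ∈ T, ∀ q ∈ T, p ≠ q → Disjoint p q) ∧
      (∀ p ∈ T, #B ≤ Z ^ 5 * #p ∧ ∃ a ∈ A0, p ⊆ S a) ∧ (∀ p, Ef p ⊆ B1) ∧
      (∀ p, ∀ q ∈ T, Disjoint (Ef p) q) ∧ (∀ p q, p ≠ q → Disjoint (Ef p) (Ef q)) ∧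
      (∀ p ∈ T, #(Ef p) * Z ^ 3 ≤ #p) ∧
      (∀ p ∈ T, ∀ e ∈ Ef p, ∃ a ∈ A0, e ∈ S a ∧ #p ≤ Z * #(S a ∩ p)) ∧
      B1 ⊆ T.biUnion (fun p => p ∪ Ef p) := by
  have hZ0 : 0 < Z := by omega
  have hr3 : r ≤ r ^ 3 := Nat.le_self_pow (by norm_num) r
  have hB0 : 0 < #B := lt_of_lt_of_le (by positivity) hβ
  obtain ⟨T, hTL, hTd, hT2, hTr⟩ := family_exists A0 S B (Z ^ 5) hSB hB0
  obtain ⟨D, hD⟩ : ∃ D, D = T.biUnion id := ⟨_, rfl⟩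
  rw [← hD] at hTr
  obtain ⟨E, hE⟩ : ∃ E, E = B1 \ D := ⟨_, rfl⟩
  have hDc : #D = ∑ p ∈ T, #p := by rw [hD, card_biUnion (s := T) (t := id) (fun p hp q hq hpq => hTd p hp q hq hpq)]; rfl
  have hDB : #D ≤ #B := by
    rw [hD]
    apply card_le_card
    rw [biUnion_subset]
    intro p hp
    obtain ⟨-, a, ha, hpa⟩ := hT2 p hp
    exact hpa.trans (hSB a ha)
  -- bound on the leftover
  have hEc : #E * Z ^ 5 ≤ 16 * r ^ 2 * #B := by
    have h1 : ∑ a ∈ A0, #{e ∈ E | e ∈ S a} = ∑ e ∈ E, #{a ∈ A0 | e ∈ S a} := by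
      simp only [card_filter]; rw [sum_comm]
    have h2 : (∑ a ∈ A0, #{e ∈ E | e ∈ S a}) * Z ^ 5 ≤ n * #B := by
      rw [sum_mul]
      calc ∑ a ∈ A0, #{e ∈ E | e ∈ S a} * Z ^ 5 ≤ ∑ a ∈ A0, #B := by
            apply sum_le_sum
            intro a ha
            refine le_trans ?_ (hTr a ha).le
            rw [mul_comm]
            apply Nat.mul_le_mul_left
            apply card_le_card
            intro e he
            rw [mem_filter, hE, mem_sdiff] at he
            exact mem_sdiff.2 ⟨he.2, he.1.2⟩
        _ = #A0 * #B := by rw [sum_const, smul_eq_mul]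
        _ ≤ _ := Nat.mul_le_mul_right _ hA0
    have h3 : #E * n ≤ 16 * r ^ 2 * ∑ e ∈ E, #{a ∈ A0 | e ∈ S a} := by
      rw [mul_sum, ← smul_eq_mul, ← sum_const]
      apply sum_le_sum
      intro e he
      rw [hE] at he
      exact hB1 e (mem_sdiff.1 he).1
    rw [h1] at h2
    have h4 : n * (#E * Z ^ 5) ≤ n * (16 * r ^ 2 * #B) := by
      calc n * (#E * Z ^ 5) = (#E * n) * Z ^ 5 := by ring
        _ ≤ (16 * r ^ 2 * ∑ e ∈ E, #{a ∈ A0 | e ∈ S a}) * Z ^ 5 := by gcongr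
        _ = 16 * r ^ 2 * ((∑ e ∈ E, #{a ∈ A0 | e ∈ S a}) * Z ^ 5) := by ring
        _ ≤ 16 * r ^ 2 * (n * #B) := by gcongr
        _ = _ := by ring
    exact Nat.le_of_mul_le_mul_left h4 hn
  obtain ⟨cap, hcap⟩ : ∃ cap : Finset V → ℕ, ∀ p, cap p = #p / Z ^ 3 := ⟨_, fun _ => rfl⟩
  obtain ⟨H, hH⟩ : ∃ H : α → Finset (Finset V), ∀ a, H a = {p ∈ T | #p ≤ Z * #(S a ∩ p)} := ⟨_, fun _ => rfl⟩
  have hcap2 : ∀ p ∈ T, #p ≤ 2 * Z ^ 3 * cap p := by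
    intro p hp
    have h1 : Z ^ 3 ≤ #p := by
      have : Z ^ 5 * Z ^ 3 ≤ Z ^ 5 * #p := by
        calc Z ^ 5 * Z ^ 3 = Z ^ 8 := by ring
          _ ≤ #B := hβ
          _ ≤ _ := (hT2 p hp).1
      exact Nat.le_of_mul_le_mul_left this (by positivity)
    have h2 : 1 ≤ cap p := by rw [hcap]; exact Nat.div_pos h1 (by positivity)
    have h3 : #p < Z ^ 3 * (cap p + 1) := by rw [hcap]; exact Nat.lt_mul_div_succ _ (by positivity)
    nlinarith [Nat.mul_le_mul_left (Z ^ 3) h2]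
  have hmass : ∀ a ∈ A0, #B ≤ 16 * r * ∑ p ∈ H a, #p := by
    intro a ha
    have h1 : #(S a) ≤ #(S a ∩ D) + #(S a \ D) := by rw [card_inter_add_card_sdiff]
    have h2 : Z * #(S a ∩ D) ≤ Z * ∑ p ∈ H a, #p + #B := by
      have h3 : #(S a ∩ D) ≤ ∑ p ∈ T, #(S a ∩ p) := by
        have : S a ∩ D = T.biUnion (fun p => S a ∩ p) := by rw [hD, inter_biUnion]; rfl
        rw [this]; exact card_biUnion_le
      calc Z * #(S a ∩ D) ≤ Z * ∑ p ∈ T, #(S a ∩ p) := Nat.mul_le_mul_left _ h3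
        _ = ∑ p ∈ T, Z * #(S a ∩ p) := mul_sum _ _ _
        _ ≤ ∑ p ∈ T, ((if #p ≤ Z * #(S a ∩ p) then Z * #p else 0) + #p) := by
          apply sum_le_sum
          intro p _
          split_ifs with h
          · have := Nat.mul_le_mul_left Z (card_le_card (inter_subset_right : S a ∩ p ⊆ p)); omega
          · omega
        _ = Z * ∑ p ∈ H a, #p + #D := by
          rw [sum_add_distrib, ← hDc, hH, mul_sum, sum_filter]
        _ ≤ _ := by omega
    have h4 := hTr a ha
    have h5 := hS a ha
    have h6 : 8 * r * Z ≤ Z ^ 5 := by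
      calc 8 * r * Z ≤ Z * Z := by gcongr; omega
        _ = Z ^ 2 := by ring
        _ ≤ Z ^ 5 := Nat.pow_le_pow_right hZ0 (by norm_num)
    have h7 : 8 * r * Z * #(S a \ D) ≤ #B := (Nat.mul_le_mul_right _ h6).trans h4.le
    generalize ∑ p ∈ H a, #p = M at *
    have h8 : Z * #B ≤ 8 * r * Z * M + (8 * r + 1) * #B := by
      calc Z * #B ≤ Z * (8 * r * #(S a)) := by gcongr
        _ ≤ Z * (8 * r * (#(S a ∩ D) + #(S a \ D))) := by gcongr
        _ = 8 * r * (Z * #(S a ∩ D)) + 8 * r * Z * #(S a \ D) := by ring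
        _ ≤ 8 * r * (Z * M + #B) + #B := by gcongr
        _ = _ := by ring
    have h9 : 2 * ((8 * r + 1) * #B) ≤ Z * #B := by
      rw [← mul_assoc]; gcongr; omega
    have h10 : Z * #B ≤ Z * (16 * r * M) := by nlinarith
    exact Nat.le_of_mul_le_mul_left h10 hZ0
  have hslots : ∀ a ∈ A0, #E ≤ ∑ p ∈ H a, cap p := by
    intro a ha
    have h1 : ∑ p ∈ H a, #p ≤ 2 * Z ^ 3 * ∑ p ∈ H a, cap p := by
      rw [mul_sum]
      apply sum_le_sum
      intro p hp
      rw [hH, mem_filter] at hp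
      exact hcap2 p hp.1
    have h2 := hmass a ha
    generalize ∑ p ∈ H a, cap p = Q at *
    have h3 : Z ^ 5 * #E ≤ Z ^ 5 * Q := by
      calc Z ^ 5 * #E = #E * Z ^ 5 := by ring
        _ ≤ 16 * r ^ 2 * #B := hEc
        _ ≤ 16 * r ^ 2 * (16 * r * (2 * Z ^ 3 * Q)) := by
          gcongr; exact h2.trans (Nat.mul_le_mul_left _ h1)
        _ = (512 * r ^ 3) * Z ^ 3 * Q := by ring
        _ ≤ (Z * Z) * Z ^ 3 * Q := by gcongr <;> omega
        _ = _ := by ring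
    exact Nat.le_of_mul_le_mul_left h3 (by positivity)
  have hpick : ∀ e : E, ∃ a ∈ A0, e.1 ∈ S a := by
    intro e
    have he : e.1 ∈ B1 ∧ e.1 ∉ D := by
      obtain ⟨x, hx⟩ := e
      rw [hE, mem_sdiff] at hx
      exact hx
    have h1 := hB1 _ he.1
    have : 0 < #{a ∈ A0 | e.1 ∈ S a} := by
      by_contra h0
      have : #{a ∈ A0 | e.1 ∈ S a} = 0 := by omega
      rw [this] at h1; omega
    obtain ⟨a, ha⟩ := card_pos.1 this
    rw [mem_filter] at ha
    exact ⟨a, ha⟩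
  choose pk hpk1 hpk2 using hpick
  have hne : Nonempty (Σ _ : Finset V, ℕ) := ⟨⟨∅, 0⟩⟩
  obtain ⟨f, hf1, hf2⟩ := hall_big (fun e : E => (H (pk e)).sigma (fun p => range (cap p))) (by
    intro e
    rw [card_sigma, Fintype.card_coe]
    simp only [card_range]
    exact hslots _ (hpk1 e))
  obtain ⟨Ef, hEf⟩ : ∃ Ef : Finset V → Finset V, ∀ p, Ef p = (univ.filter (fun e : E => (f e).1 = p)).image (fun e => e.1) :=
    ⟨_, fun _ => rfl⟩
  have hEfm : ∀ p x, x ∈ Ef p ↔ ∃ h : x ∈ E, (f ⟨x, h⟩).1 = p := by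
    intro p x
    rw [hEf]
    simp only [mem_image, mem_filter, mem_univ, true_and, Subtype.exists]
    constructor
    · rintro ⟨a, ha, h, rfl⟩; exact ⟨ha, h⟩
    · rintro ⟨h, h'⟩; exact ⟨x, h, h', rfl⟩
  refine ⟨T, Ef, hTL, hTd, hT2, ?_, ?_, ?_, ?_, ?_, ?_⟩
  · intro p x hx
    obtain ⟨h, -⟩ := (hEfm p x).1 hx
    rw [hE] at h
    exact (mem_sdiff.1 h).1
  · intro p q hq
    rw [disjoint_left]
    intro x hx hxq
    obtain ⟨h, -⟩ := (hEfm p x).1 hx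
    rw [hE, mem_sdiff, hD] at h
    exact h.2 (mem_biUnion.2 ⟨q, hq, hxq⟩)
  · intro p q hpq
    rw [disjoint_left]
    intro x hx hxq
    obtain ⟨h, h1⟩ := (hEfm p x).1 hx
    obtain ⟨h', h2⟩ := (hEfm q x).1 hxq
    exact hpq (h1.symm.trans h2)
  · intro p hp
    have h1 : #(Ef p) ≤ cap p := by
      rw [hEf]
      refine card_image_le.trans ?_
      rw [← card_range (cap p)]
      apply card_le_card_of_injOn (fun e => (f e).2)
      · intro e he
        have he' : (f e).1 = p := by simpa using he
        have := hf2 e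
        rw [mem_sigma] at this
        rw [← he']
        exact this.2
      · intro e he e' he' hee
        have h1 : (f e).1 = p := by simpa using he
        have h2 : (f e').1 = p := by simpa using he'
        apply hf1
        apply Sigma.ext
        · rw [h1, h2]
        · exact heq_of_eq hee
    calc #(Ef p) * Z ^ 3 ≤ cap p * Z ^ 3 := Nat.mul_le_mul_right _ h1
      _ ≤ #p := by rw [hcap]; exact Nat.div_mul_le_self _ _
  · intro p hp x hx
    obtain ⟨h, h1⟩ := (hEfm p x).1 hx
    have := hf2 ⟨x, h⟩
    rw [mem_sigma, h1, hH, mem_filter] at this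
    exact ⟨_, hpk1 ⟨x, h⟩, hpk2 ⟨x, h⟩, this.1.2⟩
  · intro x hx
    rw [mem_biUnion]
    by_cases hxD : x ∈ D
    · rw [hD, mem_biUnion] at hxD
      obtain ⟨p, hp, hxp⟩ := hxD
      exact ⟨p, hp, mem_union_left _ hxp⟩
    · have hxE : x ∈ E := by rw [hE]; exact mem_sdiff.2 ⟨hx, hxD⟩
      have := hf2 ⟨x, hxE⟩
      rw [mem_sigma, hH, mem_filter] at this
      exact ⟨_, this.1.1, mem_union_right _ ((hEfm _ x).2 ⟨hxE, rfl⟩)⟩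

end Tiling

namespace Tiling
open Finset Classical

variable {V κ α : Type*}


lemma atyp_bound (G : V → V → Prop) (A B Q : Finset V) (θ k e : ℕ) (b : V) (hQA : Q ⊆ A)
    (hQ : ∀ a ∈ Q, G a b ∧ (e + 1) ^ k ≤ nbad G A θ k (B.filter (fun y => G a y)) b) :
    #Q * (e + 1) ^ k ≤ θ * #B ^ k := by
  obtain ⟨bad, hbad⟩ : ∃ bad : (Fin k → V) → Prop, ∀ q, bad q ↔ #(cn G A (insert b (univ.image q))) < θ :=
    ⟨_, fun _ => Iff.rfl⟩
  obtain ⟨rel, hrel⟩ : ∃ rel : V → (Fin k → V) → Prop, ∀ a q, rel a q ↔ (bad q ∧ ∀ i, G a (q i)) :=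
    ⟨_, fun _ _ => Iff.rfl⟩
  have h1 : #Q * (e + 1) ^ k ≤ ∑ a ∈ Q, #{q ∈ Fintype.piFinset (fun _ : Fin k => B) | rel a q} := by
    rw [← smul_eq_mul, ← sum_const]
    apply sum_le_sum
    intro a ha
    refine (hQ a ha).2.trans (card_le_card ?_)
    intro q hq
    rw [mem_filter, Fintype.mem_piFinset] at hq ⊢
    refine ⟨fun i => (mem_filter.1 (hq.1 i)).1, (hrel _ _).2 ⟨(hbad _).2 hq.2, fun i => (mem_filter.1 (hq.1 i)).2⟩⟩
  have h2 : ∑ a ∈ Q, #{q ∈ Fintype.piFinset (fun _ : Fin k => B) | rel a q}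
      = ∑ q ∈ Fintype.piFinset (fun _ : Fin k => B), #{a ∈ Q | rel a q} :=
    sum_card_bipartiteAbove_eq_sum_card_bipartiteBelow rel
  have h3 : ∑ q ∈ Fintype.piFinset (fun _ : Fin k => B), #{a ∈ Q | rel a q}
      ≤ ∑ q ∈ Fintype.piFinset (fun _ : Fin k => B), θ := by
    apply sum_le_sum
    intro q _
    by_cases hb : bad q
    · have := (hbad q).1 hb
      refine le_trans (card_le_card ?_) this.le
      intro a ha
      rw [mem_filter, hrel] at ha
      rw [mem_cn]
      refine ⟨hQA ha.1, ?_⟩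
      intro z hz
      rw [mem_insert, mem_image] at hz
      rcases hz with rfl | ⟨i, -, rfl⟩
      · exact (hQ a ha.1).1
      · exact ha.2.2 i
    · rw [filter_false_of_mem]
      · simp
      · intro a _ h; exact hb ((hrel _ _).1 h).1
  rw [sum_const, Fintype.card_piFinset, smul_eq_mul] at h3
  simp only [prod_const, card_univ, Fintype.card_fin] at h3
  rw [mul_comm (#B ^ k)] at h3
  omega

lemma core {Δ R Z r θ : ℕ} (hz : ZOK Δ R (Δ + 2) Z) (hDelta : 0 < Δ) (hr : 0 < r)
    {F : (i : ℕ) → SimpleGraph (Fin i)} (hF : FOK F Δ)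
    {c : V → V → κ} (hc : ∀ a b, c a b = c b a) (col : κ) (hZ4 : (Δ * Δ + 1) * (Δ * Δ + 1) ≤ Z)
    (hZr : 1024 * r ^ 3 ≤ Z) {A A' B B1 : Finset V} (hA' : A' ⊆ A) (hBA : Disjoint B A)
    (hβ : 2 * Z ^ 21 ≤ #B) (hn0 : 0 < #A) (hn : θ * (2 * Z ^ 15) ^ (Δ + 1) * Z ^ 4 ≤ #A)
    (hN : ∀ a ∈ A', #B ≤ 4 * r * #(B.filter (fun b => c a b = col))) (hB1B : B1 ⊆ B)
    (hB1 : ∀ b ∈ B1, #A ≤ 8 * r ^ 2 * #(A'.filter (fun a => c a b = col))) :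
    ∃ C, B1 ⊆ C ∧ C ⊆ B ∧ CovAll F c C A θ (4 * Z ^ 5) := by
  obtain ⟨G, hG⟩ : ∃ G : V → V → Prop, G = fun a b => c a b = col := ⟨_, rfl⟩
  have hGi : ∀ a b, G a b ↔ c a b = col := by intro a b; rw [hG]
  have hbig := hz.big
  have hZ0 : 0 < Z := by omega
  have hr3 : r ≤ r ^ 3 := Nat.le_self_pow (by norm_num) r
  have hr23 : r ^ 2 ≤ r ^ 3 := Nat.pow_le_pow_right hr (by norm_num)
  obtain ⟨e, he⟩ : ∃ e, e = #B / (2 * Z ^ 15) := ⟨_, rfl⟩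
  have he1 : e * (2 * Z ^ 15) ≤ #B := by rw [he]; exact Nat.div_mul_le_self _ _
  have he2 : #B ≤ (2 * Z ^ 15) * (e + 1) := by
    rw [he]; exact (Nat.lt_mul_div_succ _ (by positivity)).le
  have hB0 : 0 < #B := lt_of_lt_of_le (by positivity) hβ
  obtain ⟨N, hNd⟩ : ∃ N : V → Finset V, ∀ a, N a = B.filter (fun y => G a y) := ⟨_, fun _ => rfl⟩
  obtain ⟨At, hAt⟩ : ∃ At : V → V → Prop, ∀ a b, At a b ↔ (G a b ∧ (e + 1) ^ (Δ + 1) ≤ nbad G A θ (Δ + 1) (N a) b) :=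
    ⟨_, fun _ _ => Iff.rfl⟩
  have hAtc : ∀ b, #{a ∈ A | At a b} * Z ^ 4 ≤ #A := by
    intro b
    have h1 := atyp_bound G A B (A.filter (fun a => At a b)) θ (Δ + 1) e b (filter_subset _ _) (by
      intro a ha
      have := (hAt a b).1 (mem_filter.1 ha).2
      rw [hNd] at this
      exact this)
    have h2 : #{a ∈ A | At a b} * (e + 1) ^ (Δ + 1) ≤ (θ * (2 * Z ^ 15) ^ (Δ + 1)) * (e + 1) ^ (Δ + 1) := by
      refine h1.trans ?_
      calc θ * #B ^ (Δ + 1) ≤ θ * ((2 * Z ^ 15) * (e + 1)) ^ (Δ + 1) := by gcongr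
        _ = _ := by rw [mul_pow, mul_assoc]
    have h3 := Nat.le_of_mul_le_mul_right h2 (by positivity)
    exact (Nat.mul_le_mul_right _ h3).trans hn
  obtain ⟨A0, hA0⟩ : ∃ A0, A0 = A'.filter (fun a => 8 * r * #{b ∈ B | At a b} ≤ #B) := ⟨_, rfl⟩
  have hdiff : #(A' \ A0) * Z ^ 4 ≤ 8 * r * #A := by
    have h1 : #(A' \ A0) * #B ≤ ∑ a ∈ A' \ A0, 8 * r * #{b ∈ B | At a b} := by
      rw [← smul_eq_mul, ← sum_const]
      apply sum_le_sum
      intro a ha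
      rw [mem_sdiff, hA0, mem_filter] at ha
      by_contra h
      exact ha.2 ⟨ha.1, by omega⟩
    rw [← mul_sum] at h1
    have h2 : ∑ a ∈ A' \ A0, #{b ∈ B | At a b} = ∑ b ∈ B, #{a ∈ A' \ A0 | At a b} :=
      sum_card_bipartiteAbove_eq_sum_card_bipartiteBelow At
    have h3 : (∑ b ∈ B, #{a ∈ A' \ A0 | At a b}) * Z ^ 4 ≤ #B * #A := by
      rw [sum_mul, ← smul_eq_mul (#B), ← sum_const]
      apply sum_le_sum
      intro b _
      refine le_trans (Nat.mul_le_mul_right _ (card_le_card ?_)) (hAtc b)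
      apply filter_subset_filter
      exact sdiff_subset.trans hA'
    rw [h2] at h1
    have h4 : (#(A' \ A0) * Z ^ 4) * #B ≤ (8 * r * #A) * #B := by
      calc (#(A' \ A0) * Z ^ 4) * #B = (#(A' \ A0) * #B) * Z ^ 4 := by ring
        _ ≤ (8 * r * ∑ b ∈ B, #{a ∈ A' \ A0 | At a b}) * Z ^ 4 := by gcongr
        _ = 8 * r * ((∑ b ∈ B, #{a ∈ A' \ A0 | At a b}) * Z ^ 4) := by ring
        _ ≤ 8 * r * (#B * #A) := by gcongr
        _ = _ := by ring
    exact Nat.le_of_mul_le_mul_right h4 hB0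
  obtain ⟨S, hS⟩ : ∃ S : V → Finset V, ∀ a, S a = (N a).filter (fun b => ¬ At a b) := ⟨_, fun _ => rfl⟩
  have hSm : ∀ a b, b ∈ S a ↔ (b ∈ B ∧ G a b) ∧ ¬ At a b := by
    intro a b; rw [hS, mem_filter, hNd, mem_filter]
  have hA0A : A0 ⊆ A' := by rw [hA0]; exact filter_subset _ _
  obtain ⟨T, Ef, t1, t2, t3, t4, t5, t6, t7, t8, t9⟩ := cluster_partition A0 S B B1 #A r Z hn0 hr
    (card_le_card (hA0A.trans hA'))
    (by intro a _ b hb; exact ((hSm _ _).1 hb).1.1)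
    (by
      intro a ha
      rw [hA0, mem_filter] at ha
      have h1 := hN a ha.1
      have h2 : #(B.filter (fun b => c a b = col)) ≤ #(S a) + #{b ∈ B | At a b} := by
        rw [← card_filter_add_card_filter_not (s := B.filter (fun b => c a b = col)) (At a), add_comm]
        apply add_le_add
        · apply card_le_card
          intro b hb
          rw [mem_filter, mem_filter] at hb
          exact (hSm _ _).2 ⟨⟨hb.1.1, (hGi _ _).2 hb.1.2⟩, hb.2⟩
        · apply card_le_card
          intro b hb
          rw [mem_filter, mem_filter] at hb
          rw [mem_filter]; exact ⟨hb.1.1, hb.2⟩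
      have h3 := Nat.mul_le_mul_left (8 * r) h2
      rw [mul_add] at h3
      have h4 : 2 * #B ≤ 8 * r * #(B.filter (fun b => c a b = col)) := by nlinarith
      have h5 := ha.2
      omega)
    (by
      intro b hb
      have h1 := hB1 b hb
      have h2 : #(A'.filter (fun a => c a b = col)) ≤ #{a ∈ A0 | b ∈ S a} + #(A' \ A0) + #{a ∈ A | At a b} := by
        refine le_trans (card_le_card (t := ((A0.filter (fun a => b ∈ S a)) ∪ (A' \ A0)) ∪ (A.filter (fun a => At a b))) ?_) ?_
        · intro a ha
          rw [mem_filter] at ha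
          simp only [mem_union, mem_filter, mem_sdiff, hSm, hGi]
          have := hA' ha.1
          have := hB1B hb
          tauto
        · refine (card_union_le _ _).trans ?_
          gcongr
          exact card_union_le _ _
      have h3 := hAtc b
      generalize #(A'.filter (fun a => c a b = col)) = x at *
      generalize #{a ∈ A0 | b ∈ S a} = y at *
      generalize #(A' \ A0) = u at *
      generalize #{a ∈ A | At a b} = v at *
      have h4 : 16 * r ^ 2 * (u + v) ≤ #A := by
        have : (16 * r ^ 2 * (u + v)) * Z ^ 4 ≤ #A * Z ^ 4 := by
          calc (16 * r ^ 2 * (u + v)) * Z ^ 4 = 16 * r ^ 2 * (u * Z ^ 4) + 16 * r ^ 2 * (v * Z ^ 4) := by ring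
            _ ≤ 16 * r ^ 2 * (8 * r * #A) + 16 * r ^ 2 * #A := by gcongr
            _ = #A * (128 * r ^ 3 + 16 * r ^ 2) := by ring
            _ ≤ #A * Z := by gcongr; omega
            _ ≤ #A * Z ^ 4 := by gcongr; exact Nat.le_self_pow (by norm_num) Z
        exact Nat.le_of_mul_le_mul_right this (by positivity)
      have h5 : 2 * #A ≤ 16 * r ^ 2 * (y + u + v) := by
        calc 2 * #A ≤ 2 * (8 * r ^ 2 * x) := by gcongr
          _ = 16 * r ^ 2 * x := by ring
          _ ≤ _ := by gcongr
      nlinarith) hbig hZr (by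
        refine le_trans ?_ hβ
        have : Z ^ 8 ≤ Z ^ 21 := Nat.pow_le_pow_right hZ0 (by norm_num)
        omega)
  have hpB : ∀ p ∈ T, p ⊆ B := by
    intro p hp
    obtain ⟨-, a, ha, hpa⟩ := t3 p hp
    intro b hb
    exact ((hSm _ _).1 (hpa hb)).1.1
  have hpEB : ∀ p ∈ T, p ∪ Ef p ⊆ B := fun p hp => union_subset (hpB p hp) ((t4 p).trans hB1B)
  refine ⟨T.biUnion (fun p => p ∪ Ef p), t9, ?_, ?_⟩
  · rw [biUnion_subset]; exact hpEB
  have hnb : ∀ a b, b ∈ S a → nbad G A θ (Δ + 1) (S a) b < (e + 1) ^ (Δ + 1) := by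
    intro a b hb
    have h1 := (hSm a b).1 hb
    have h2 : S a ⊆ N a := by rw [hS]; exact filter_subset _ _
    refine lt_of_le_of_lt (nbad_mono h2 b) ?_
    by_contra h
    exact h1.2 ((hAt _ _).2 ⟨h1.1.2, by omega⟩)
  have hcov : ∀ p ∈ T, CovAll F c (p ∪ Ef p) A θ 4 := by
    intro p hp
    obtain ⟨q1, a, ha, hpa⟩ := t3 p hp
    refine cluster (e := e) (θ := θ) hz hDelta hF hc col hZ4 (t5 p p hp).symm
      (disjoint_of_subset_left (hpEB p hp) hBA) ?_ (t7 p hp) ?_ ?_ ?_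
    · have : Z ^ 5 * (2 * Z ^ 16) ≤ Z ^ 5 * #p := by
        refine le_trans (le_of_eq ?_) (hβ.trans q1)
        ring
      exact Nat.le_of_mul_le_mul_left this (by positivity)
    · have : Z ^ 5 * (e * (2 * Z ^ 10)) ≤ Z ^ 5 * #p := by
        refine le_trans (le_of_eq ?_) (he1.trans q1)
        ring
      exact Nat.le_of_mul_le_mul_left this (by positivity)
    · intro b hb
      rw [← hG]
      exact lt_of_le_of_lt (nbad_mono hpa b) (hnb a b (hpa hb))
    · intro b hb
      obtain ⟨a', ha', hb', hpc⟩ := t8 p hp b hb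
      rw [← hG]
      exact ⟨S a' ∩ p, inter_subset_right, hpc, lt_of_le_of_lt (nbad_mono inter_subset_left b) (hnb a' b hb')⟩
  refine (covAll_biUnion T (fun p => p ∪ Ef p) hcov ?_ ?_).mono ?_
  · intro p hp q hq hpq
    rw [disjoint_union_left, disjoint_union_right, disjoint_union_right]
    exact ⟨⟨t2 p hp q hq hpq, (t5 q p hp).symm⟩, t5 p q hq, t6 p q hpq⟩
  · intro p hp
    exact disjoint_of_subset_left (hpEB p hp) hBA
  · rw [mul_comm]; exact Nat.mul_le_mul_left _ t1

end Tiling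

namespace Tiling
open Finset Classical

variable {V κ α : Type*}

lemma level {Δ R Z r θ : ℕ} (hz : ZOK Δ R (Δ + 2) Z) (hDelta : 0 < Δ) (hr : 0 < r)
    {F : (i : ℕ) → SimpleGraph (Fin i)} (hF : FOK F Δ)
    {c : V → V → κ} (hc : ∀ a b, c a b = c b a) (col : κ) (hZ4 : (Δ * Δ + 1) * (Δ * Δ + 1) ≤ Z)
    (hZr : 1024 * r ^ 3 ≤ Z) {A : Finset V} 
    (hn0 : 0 < #A) (hn : θ * (2 * Z ^ 15) ^ (Δ + 1) * Z ^ 4 ≤ #A) : ∀ (j : ℕ) (B Ac : Finset V),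
    Ac ⊆ A → Disjoint B A → 4 * r * #Ac ≤ j * #A →
    (∀ b ∈ B, (4 * r + j) * #A ≤ 8 * r ^ 2 * #(Ac.filter (fun a => c a b = col))) →
    CovAll F c B A θ (j * (4 * Z ^ 5) + 2 * Z ^ 21) := by
  intro j
  induction j with
  | zero =>
    intro B Ac hAc hBA h1 h2
    have hAc0 : #Ac = 0 := by
      have h3 : 4 * r * #Ac = 0 := by omega
      rcases Nat.mul_eq_zero.1 h3 with h | h
      · omega
      · exact h
    have hB : B = ∅ := by
      rw [eq_empty_iff_forall_notMem]
      intro b hb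
      have := h2 b hb
      rw [card_eq_zero.1 hAc0] at this
      simp at this
      rcases this with h | h
      · omega
      · rw [h] at hn0; simp at hn0
    rw [hB]
    exact (covAll_card _ _ _).mono (by simp)
  | succ j ih =>
    intro B Ac hAc hBA h1 h2
    rcases Nat.lt_or_ge #B (2 * Z ^ 21) with hβ | hβ
    · exact (covAll_card _ _ _).mono (by omega)
    have hbig := hz.big
    have hB0 : 0 < #B := lt_of_lt_of_le (Nat.mul_pos (by norm_num) (pow_pos (by omega) _)) hβ
    obtain ⟨G, hGi⟩ : ∃ G : V → V → Prop, ∀ a b, G a b ↔ c a b = col := ⟨_, fun _ _ => Iff.rfl⟩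
    have hNe : ∀ a, B.filter (fun b => c a b = col) = B.filter (fun b => G a b) := by
      intro a; ext b; simp only [mem_filter, hGi]
    have hDe : ∀ (X : Finset V) b, X.filter (fun a => c a b = col) = X.filter (fun a => G a b) := by
      intro X b; ext a; simp only [mem_filter, hGi]
    simp only [hDe] at h2 ih
    obtain ⟨A', hA'⟩ : ∃ A', A' = Ac.filter (fun a => #B ≤ 4 * r * #(B.filter (fun b => G a b))) := ⟨_, rfl⟩
    have hA'c : A' ⊆ Ac := by rw [hA']; exact filter_subset _ _
    have hsum : ∑ a ∈ Ac, #{b ∈ B | G a b} = ∑ b ∈ B, #{a ∈ Ac | G a b} :=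
      sum_card_bipartiteAbove_eq_sum_card_bipartiteBelow G
    have hs1 : #B * ((4 * r + (j + 1)) * #A) ≤ 8 * r ^ 2 * ∑ a ∈ Ac, #{b ∈ B | G a b} := by
      rw [hsum, mul_sum, ← smul_eq_mul (#B), ← sum_const]
      exact sum_le_sum h2
    have hs2 : 4 * r * ∑ a ∈ Ac, #{b ∈ B | G a b} ≤ #Ac * #B + 4 * r * (#A' * #B) := by
      rw [← smul_eq_mul (#Ac), ← sum_const, mul_sum, hA', card_filter, sum_mul, mul_sum, ← sum_add_distrib]
      apply sum_le_sum
      intro a _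
      split_ifs with h
      · have : #{b ∈ B | G a b} ≤ #B := card_filter_le _ _
        have := Nat.mul_le_mul_left (4 * r) this
        rw [one_mul]
        omega
      · omega
    have hA'n : #A ≤ 4 * r * #A' := by
      have h3 : (4 * r * #A) * #B ≤ (8 * r ^ 2 * #A') * #B := by
        nlinarith [Nat.mul_le_mul_left (2 * r) hs2, Nat.mul_le_mul_right #B h1, Nat.zero_le ((j + 1) * #A * #B)]
      have h4 := Nat.le_of_mul_le_mul_right h3 hB0
      have h5 : (4 * r) * #A ≤ (4 * r) * (2 * r * #A') := by refine h4.trans (le_of_eq ?_); ring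
      have h6 := Nat.le_of_mul_le_mul_left h5 (by omega)
      nlinarith
    obtain ⟨C, hC1, hC2, hC3⟩ := core (θ := θ) hz hDelta hr hF hc col hZ4 hZr (A := A) (A' := A') (B := B)
      (B1 := B.filter (fun b => #A ≤ 8 * r ^ 2 * #(A'.filter (fun a => G a b)))) (hA'c.trans hAc) hBA hβ hn0 hn
      (by intro a ha; rw [hA', mem_filter] at ha; rw [hNe]; exact ha.2) (filter_subset _ _)
      (by intro b hb; rw [hDe]; exact (mem_filter.1 hb).2)
    have hrem := ih (B \ C) (Ac \ A') (sdiff_subset.trans hAc) (disjoint_of_subset_left sdiff_subset hBA)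
      (by
        have := card_sdiff_add_card_eq_card hA'c
        have h5 : 4 * r * #(Ac \ A') + 4 * r * #A' ≤ (j + 1) * #A := by rw [← mul_add, this]; exact h1
        rw [add_mul j 1, one_mul] at h5
        omega)
      (by
        intro b hb
        rw [mem_sdiff] at hb
        have h3 := h2 b hb.1
        have h4 : 8 * r ^ 2 * #(A'.filter (fun a => G a b)) < #A := by
          by_contra h
          exact hb.2 (hC1 (mem_filter.2 ⟨hb.1, by omega⟩))
        have h5 : #(Ac.filter (fun a => G a b)) ≤ #((Ac \ A').filter (fun a => G a b)) + #(A'.filter (fun a => G a b)) := by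
          refine le_trans (card_le_card ?_) (card_union_le _ _)
          intro a ha
          simp only [mem_union, mem_filter, mem_sdiff] at ha ⊢
          tauto
        have h6 := Nat.mul_le_mul_left (8 * r ^ 2) h5
        rw [mul_add] at h6
        rw [← add_assoc, Nat.succ_mul] at h3
        omega)
    have hun : C ∪ B \ C = B := union_sdiff_of_subset hC2
    have := hC3.union hrem disjoint_sdiff (by rw [hun]; exact hBA)
    rw [hun] at this
    exact this.mono (le_of_eq (by ring))

/-- cover a set `B` by using vertices of `A` -/
lemma absorb {Δ R Z r θ : ℕ} (hz : ZOK Δ R (Δ + 2) Z) (hDelta : 0 < Δ) (hr : 0 < r)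
    {F : (i : ℕ) → SimpleGraph (Fin i)} (hF : FOK F Δ)
    {c : V → V → Fin r} (hc : ∀ a b, c a b = c b a) (hZ4 : (Δ * Δ + 1) * (Δ * Δ + 1) ≤ Z)
    (hZr : 1024 * r ^ 3 ≤ Z) {A B : Finset V} 
    (hn0 : 0 < #A) (hn : θ * (2 * Z ^ 15) ^ (Δ + 1) * Z ^ 4 ≤ #A) (hBA : Disjoint B A) :
    CovAll F c B A θ (Z ^ 23) := by
  have hbig := hz.big
  have hZ0 : 0 < Z := by omega
  have hcol : ∀ b, ∃ col : Fin r, #A ≤ r * #(A.filter (fun a => c a b = col)) := by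
    intro b
    by_contra h
    push Not at h
    have h1 : #A = ∑ col : Fin r, #(A.filter (fun a => c a b = col)) :=
      card_eq_sum_card_fiberwise (fun a _ => mem_univ _)
    have h2 : r * #A < r * #A := by
      calc r * #A = ∑ col : Fin r, r * #(A.filter (fun a => c a b = col)) := by rw [h1, mul_sum]
        _ < ∑ col : Fin r, #A := by
          apply sum_lt_sum_of_nonempty ⟨⟨0, hr⟩, mem_univ _⟩
          intro i _; exact h i
        _ = r * #A := by simp
    omega
  choose cl hcl using hcol
  have h1 := covAll_biUnion (F := F) (c := c) (A := A) (θ := θ) (k := (4 * r) * (4 * Z ^ 5) + 2 * Z ^ 21)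
    (univ : Finset (Fin r)) (fun i => B.filter (fun b => cl b = i))
    (by
      intro i _
      refine level hz hDelta hr hF hc i hZ4 hZr hn0 hn (4 * r) _ A subset_rfl
        (disjoint_of_subset_left (filter_subset _ _) hBA) le_rfl ?_
      intro b hb
      have h2 := hcl b
      rw [(mem_filter.1 hb).2] at h2
      have h3 : ∀ x, #A ≤ r * x → (4 * r + 4 * r) * #A ≤ 8 * r ^ 2 * x := by
        intro x hx
        have h3 := Nat.mul_le_mul_left (8 * r) hx
        calc (4 * r + 4 * r) * #A = 8 * r * #A := by ring
          _ ≤ _ := h3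
          _ = _ := by ring
      exact h3 _ (by convert h2))
    (by
      intro i _ j _ hij
      rw [disjoint_left]
      intro b hb hb'
      exact hij ((mem_filter.1 hb).2.symm.trans (mem_filter.1 hb').2))
    (by intro i _; exact disjoint_of_subset_left (filter_subset _ _) hBA)
  have h2 : (univ : Finset (Fin r)).biUnion (fun i => B.filter (fun b => cl b = i)) = B := by
    ext b; simp
  rw [h2, card_univ, Fintype.card_fin] at h1
  refine h1.mono ?_
  have hr3 : r ≤ r ^ 3 := Nat.le_self_pow (by norm_num) r
  have hr23 : r ^ 2 ≤ r ^ 3 := Nat.pow_le_pow_right hr (by norm_num)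
  calc r * (4 * r * (4 * Z ^ 5) + 2 * Z ^ 21) = 16 * r ^ 2 * Z ^ 5 + 2 * r * Z ^ 21 := by ring
    _ ≤ Z * Z ^ 21 + Z * Z ^ 21 := by
      gcongr
      · omega
      · norm_num
      · omega
    _ = 2 * Z ^ 22 := by ring
    _ ≤ Z * Z ^ 22 := by gcongr; omega
    _ = _ := by ring

end Tiling

namespace Tiling
open Finset Classical

variable {V κ α : Type*}

lemma two_pow_bound (Z : ℕ) (hZ : 1 ≤ Z) : 2 * (Z - 1) ^ Z ≤ Z ^ Z := by
  obtain ⟨w, rfl⟩ : ∃ w, Z = w + 1 := ⟨Z - 1, by omega⟩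
  rw [Nat.add_sub_cancel]
  have h1 : ∀ n : ℕ, w ^ n + n * w ^ (n - 1) ≤ (w + 1) ^ n := by
    intro n
    induction n with
    | zero => simp
    | succ n ih =>
      rw [Nat.add_sub_cancel, pow_succ (w + 1) n]
      have h2 : n * w ^ n = n * w ^ (n - 1) * w := by
        rcases n with _ | n
        · simp
        · rw [Nat.add_sub_cancel, pow_succ]; ring
      calc w ^ (n + 1) + (n + 1) * w ^ n = w ^ n * w + n * w ^ n + w ^ n := by ring
        _ = w ^ n * w + n * w ^ (n - 1) * w + w ^ n := by rw [h2]
        _ ≤ (w ^ n + n * w ^ (n - 1)) * (w + 1) := by nlinarith [Nat.zero_le (n * w ^ (n-1))]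
        _ ≤ _ := by gcongr
  have h2 := h1 (w + 1)
  rw [Nat.add_sub_cancel] at h2
  have h3 : w ^ (w + 1) ≤ (w + 1) * w ^ w := by rw [pow_succ]; nlinarith [Nat.zero_le (w ^ w)]
  omega

lemma drc_pow {r Δ Z : ℕ} (hr : 0 < r) {F : (i : ℕ) → SimpleGraph (Fin i)} (hF : FOK F Δ)
    {c : V → V → Fin r} (hc : ∀ a b, c a b = c b a) (hZ : 400 * (Δ + 2) * r ^ (Δ + 3) ≤ Z) (hZ2 : 2 ≤ Z)
    (s : ℕ) (W : Finset V) : ∃ U ⊆ W, Tileable F c U (2 * (Z * s) + Z) ∧ #(W \ U) * 2 ^ s ≤ #W := by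
  obtain ⟨U, h1, h2, h3⟩ := drc_iter hr hF hc hZ (Z * s) W
  refine ⟨U, h1, h2, ?_⟩
  have h4 : 2 ^ s * (Z - 1) ^ (Z * s) ≤ Z ^ (Z * s) := by
    rw [pow_mul, pow_mul, ← mul_pow]
    exact Nat.pow_le_pow_left (two_pow_bound Z (by omega)) s
  have h5 : (#(W \ U) * 2 ^ s) * (Z - 1) ^ (Z * s) ≤ #W * (Z - 1) ^ (Z * s) := by
    calc (#(W \ U) * 2 ^ s) * (Z - 1) ^ (Z * s) = #(W \ U) * (2 ^ s * (Z - 1) ^ (Z * s)) := by ring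
      _ ≤ #(W \ U) * Z ^ (Z * s) := by gcongr
      _ ≤ _ := h3
      _ = _ := by ring
  exact Nat.le_of_mul_le_mul_right h5 (pow_pos (by omega) _)

lemma final_pair {Δ Z r t t' k : ℕ} (hz : ZOK Δ (8 * r) (Δ + 2) Z) (hr : 0 < r)
    {F : (i : ℕ) → SimpleGraph (Fin i)} (hF : FOK F Δ)
    {c : V → V → κ} (hc : ∀ a b, c a b = c b a) (col : κ) (hZr : 1024 * r ^ 3 ≤ Z)
    {G : V → V → Prop} (hG : ∀ a b, G a b → c a b = col)
    {X Y X' Y' : Finset V} (hXY : Disjoint X Y) (hX : #X = t) (hY : #Y = t) (hX' : X' ⊆ X) (hY' : Y' ⊆ Y)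
    (hXc : #X' = t') (hYc : #Y' = t') (hk : k * (4 * Z ^ 10) ≤ t) (hLR : LowReg G X Y (4 * r) k)
    (hdx : ∀ x ∈ X, t ≤ 4 * r * (#{y ∈ Y | G x y} + k))
    (hdy : ∀ y ∈ Y, t ≤ 4 * r * (#{x ∈ X | G x y} + k)) (htt : (t - t') * Z ^ 10 ≤ t)
    (ht : 2 * Z ^ 16 ≤ t) : Tileable F c (X' ∪ Y') 2 := by
  have hbig := hz.big
  have hZ0 : 0 < Z := by omega
  have hr3 : r ≤ r ^ 3 := Nat.le_self_pow (by norm_num) r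
  have htt' : t' ≤ t := by rw [← hXc, ← hX]; exact card_le_card hX'
  obtain ⟨u, hu⟩ : ∃ u, t = t' + u := ⟨t - t', by omega⟩
  have hu' : t - t' = u := by omega
  rw [hu'] at htt
  have hZ10 : Z ≤ Z ^ 10 := Nat.le_self_pow (by norm_num) Z
  have h8 : 8 * r * (u + k) ≤ t := by
    have : (8 * r * (u + k)) * Z ^ 10 ≤ t * Z ^ 10 := by
      calc (8 * r * (u + k)) * Z ^ 10 = 8 * r * (u * Z ^ 10 + k * Z ^ 10) := by ring
        _ ≤ 8 * r * (t + t) := by gcongr; nlinarith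
        _ = t * (16 * r) := by ring
        _ ≤ t * Z ^ 10 := by gcongr; omega
    exact Nat.le_of_mul_le_mul_right this (by positivity)
  have h2u : 2 * u ≤ t := by
    have : u * 2 ≤ u * Z ^ 10 := Nat.mul_le_mul_left _ (by omega)
    omega
  have ht16 : Z ^ 16 ≤ t' := by omega
  have ht1 : 1 ≤ t' := le_trans (Nat.one_le_pow _ _ hZ0) ht16
  have hkt : k ≤ t' / Z ^ 10 := by
    rw [Nat.le_div_iff_mul_le (by positivity)]
    have : k * (4 * Z ^ 10) = 4 * (k * Z ^ 10) := by ring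
    omega
  have fin : ∀ D D0, D0 ≤ D + u → t ≤ 4 * r * (D0 + k) → t' ≤ 8 * r * D := by
    intro D D0 h1 h2
    have h3 : 4 * r * (D0 + k) ≤ 4 * r * (D + u + k) := Nat.mul_le_mul_left _ (by omega)
    have h4 : 2 * (4 * r * (D + u + k)) = 8 * r * D + 8 * r * (u + k) := by ring
    omega
  have hsd : ∀ (W W' : Finset V) (p : V → Prop), W' ⊆ W → #W = t → #W' = t' → #(W.filter p) ≤ #(W'.filter p) + u := by
    intro W W' p hW h1 h2
    have h3 : W.filter p ⊆ W'.filter p ∪ (W \ W') := by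
      intro x hx
      simp only [mem_union, mem_filter, mem_sdiff] at hx ⊢
      tauto
    have h4 := (card_le_card h3).trans (card_union_le _ _)
    rw [card_sdiff_of_subset hW] at h4
    omega
  obtain ⟨lam, σ, h1, h2, h3, h4, h5⟩ := spanning (F := F t') (hF.deg _ ht1) hz (Fintype.card_fin t') hXc hYc ht16
    (hLR.mono hX' hY' (by omega) hkt)
    (fun x hx => fin _ _ (hsd Y Y' (fun y => G x y) hY' hY hYc) (hdx x (hX' hx)))
    (fun y hy => fin _ _ (hsd X X' (fun x => G x y) hX' hX hXc) (hdy y (hY' hy)))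
  have e1 : univ.image lam = X' := by
    apply eq_of_subset_of_card_le
    · intro x hx; obtain ⟨i, -, rfl⟩ := mem_image.1 hx; exact h3 i
    · rw [card_image_of_injective _ h1]; simp [hXc]
  have e2 : univ.image σ = Y' := by
    apply eq_of_subset_of_card_le
    · intro x hx; obtain ⟨i, -, rfl⟩ := mem_image.1 hx; exact h4 i
    · rw [card_image_of_injective _ h2]; simp [hYc]
  rw [← e1, ← e2]
  refine two_tiles ht1 (hF.col _ ht1) hc h1 h2 ?_ col (fun u v h => hG _ _ (h5 u v h))
  intro u v huv
  exact disjoint_left.1 hXY (hX' (h3 u)) (huv ▸ hY' (h4 v))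

set_option maxHeartbeats 400000 in
lemma absorb_pair {Δ Z r t k : ℕ} (hz : ZOK Δ (8 * r) (Δ + 2) Z) (hDelta : 0 < Δ) (hr : 0 < r)
    {F : (i : ℕ) → SimpleGraph (Fin i)} (hF : FOK F Δ)
    {c : V → V → Fin r} (hc : ∀ a b, c a b = c b a) (col : Fin r) (hZ4 : (Δ * Δ + 1) * (Δ * Δ + 1) ≤ Z)
    (hZr : 1024 * r ^ 3 ≤ Z)
    {G : V → V → Prop} (hG : ∀ a b, G a b → c a b = col)
    {X Y B : Finset V} (hXY : Disjoint X Y) (hX : #X = t) (hY : #Y = t) (hk : k * (4 * Z ^ 10) ≤ t)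
    (hLR : LowReg G X Y (4 * r) k)
    (hdx : ∀ x ∈ X, t ≤ 4 * r * (#{y ∈ Y | G x y} + k))
    (hdy : ∀ y ∈ Y, t ≤ 4 * r * (#{x ∈ X | G x y} + k))
    (ht : 2 * Z ^ 16 ≤ t) (hB : Disjoint B (X ∪ Y)) (hBc : #B * ((2 * Z ^ 15) ^ (Δ + 1) * Z ^ 20) ≤ t) :
    Tileable F c (B ∪ (X ∪ Y)) (5 * Z ^ 23) := by
  have hbig := hz.big
  have hZ0 : 0 < Z := by omega
  obtain ⟨B1, hB1, hB1c⟩ := exists_subset_card_eq (show #B / 2 ≤ #B by omega)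
  obtain ⟨B2, hB2⟩ : ∃ B2, B2 = B \ B1 := ⟨_, rfl⟩
  have hB2c : #B2 = #B - #B / 2 := by rw [hB2, card_sdiff_of_subset hB1, hB1c]
  have hB2s : B2 ⊆ B := by rw [hB2]; exact sdiff_subset
  have hBu : B = B1 ∪ B2 := by rw [hB2, union_sdiff_of_subset hB1]
  have hBd : Disjoint B1 B2 := by rw [hB2]; exact disjoint_sdiff
  rw [disjoint_union_right] at hB
  have ht0 : 0 < t := lt_of_lt_of_le (by positivity) ht
  have hsmall : ∀ b, b ≤ #B → b * (2 * Z ^ 15) ^ (Δ + 1) * Z ^ 4 ≤ t := by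
    intro b hb
    refine le_trans ?_ hBc
    rw [mul_assoc]
    gcongr
    norm_num
  have hBs : #B * Z ^ 10 ≤ t := by
    refine le_trans ?_ hBc
    gcongr
    calc Z ^ 10 ≤ 1 * Z ^ 20 := by rw [one_mul]; exact Nat.pow_le_pow_right hZ0 (by norm_num)
      _ ≤ _ := by gcongr; exact Nat.one_le_pow _ _ (by positivity)
  obtain ⟨H1, a1, a2, a3, a4⟩ := absorb (θ := #B1) hz hDelta hr hF hc hZ4 hZr (A := X) (B := B1) (by omega)
    (by rw [hX]; exact hsmall _ (by omega)) (disjoint_of_subset_left hB1 hB.1) ∅ (by simp)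
  obtain ⟨H2, b1, b2, b3, b4⟩ := absorb (θ := #B2) hz hDelta hr hF hc hZ4 hZr (A := Y) (B := B2) (by omega)
    (by rw [hY]; exact hsmall _ (by omega)) (disjoint_of_subset_left hB2s hB.2) ∅ (by simp)
  rw [sdiff_empty] at a1 b1
  obtain ⟨h, hh⟩ : ∃ h, h = max #H1 #H2 := ⟨_, rfl⟩
  have hBt : #B ≤ t := by
    have : #B * 1 ≤ #B * Z ^ 10 := Nat.mul_le_mul_left _ (Nat.one_le_pow _ _ hZ0)
    omega
  have hZ23 : 1000 ≤ Z ^ 23 := hbig.trans (Nat.le_self_pow (by norm_num) Z)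
  have hhB : h ≤ #B := by omega
  have c1 : #(X \ H1) = t - #H1 := by rw [card_sdiff_of_subset a1, hX]
  have c2 : #(Y \ H2) = t - #H2 := by rw [card_sdiff_of_subset b1, hY]
  obtain ⟨X', hX', hX'c⟩ := exists_subset_card_eq (show t - h ≤ #(X \ H1) by omega)
  obtain ⟨Y', hY', hY'c⟩ := exists_subset_card_eq (show t - h ≤ #(Y \ H2) by omega)
  have p1 := final_pair hz hr hF hc col hZr hG hXY hX hY (hX'.trans sdiff_subset) (hY'.trans sdiff_subset)
    hX'c hY'c hk hLR hdx hdy (by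
      refine le_trans (Nat.mul_le_mul_right _ ?_) hBs
      omega) ht
  have p2 : Tileable F c ((X \ H1) \ X') (Z ^ 23 + 1) := tileable_of_card (by
    rw [card_sdiff_of_subset hX']; omega)
  have p3 : Tileable F c ((Y \ H2) \ Y') (Z ^ 23 + 1) := tileable_of_card (by
    rw [card_sdiff_of_subset hY']; omega)
  have mX' : ∀ x, x ∈ X' → x ∈ X ∧ x ∉ H1 := fun x hx => mem_sdiff.1 (hX' hx)
  have mY' : ∀ x, x ∈ Y' → x ∈ Y ∧ x ∉ H2 := fun x hx => mem_sdiff.1 (hY' hx)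
  have mH1 : ∀ x, x ∈ H1 → x ∈ X := fun x hx => a1 hx
  have mH2 : ∀ x, x ∈ H2 → x ∈ Y := fun x hx => b1 hx
  have mB1 : ∀ x, x ∈ B1 → x ∉ X ∧ x ∉ Y ∧ x ∉ B2 := fun x hx =>
    ⟨disjoint_left.1 hB.1 (hB1 hx), disjoint_left.1 hB.2 (hB1 hx), disjoint_left.1 hBd hx⟩
  have mB2 : ∀ x, x ∈ B2 → x ∉ X ∧ x ∉ Y := fun x hx =>
    ⟨disjoint_left.1 hB.1 (hB2s hx), disjoint_left.1 hB.2 (hB2s hx)⟩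
  have mXY : ∀ x, x ∈ X → x ∉ Y := fun x hx => disjoint_left.1 hXY hx
  have q1 := a4.union b4 (by
    rw [disjoint_left]; intro x; simp only [mem_union]
    have := mH1 x; have := mH2 x; have := mB1 x; have := mB2 x; have := mXY x
    grind)
  have q2 := p2.union p3 (by
    rw [disjoint_left]; intro x; simp only [mem_sdiff]
    have := mXY x
    grind)
  have q3 := q1.union q2 (by
    rw [disjoint_left]; intro x; simp only [mem_union, mem_sdiff]
    have := mH1 x; have := mH2 x; have := mB1 x; have := mB2 x; have := mXY x
    grind)
  have q4 := q3.union p1 (by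
    rw [disjoint_left]; intro x; simp only [mem_union, mem_sdiff]
    have := mH1 x; have := mH2 x; have := mB1 x; have := mB2 x; have := mXY x; have := mX' x; have := mY' x
    grind)
  have e : ((B1 ∪ H1) ∪ (B2 ∪ H2)) ∪ (((X \ H1) \ X') ∪ ((Y \ H2) \ Y')) ∪ (X' ∪ Y') = B ∪ (X ∪ Y) := by
    ext x
    rw [hBu]
    simp only [mem_union, mem_sdiff]
    have := mH1 x; have := mH2 x; have := mX' x; have := mY' x
    grind
  rw [e] at q4
  exact q4.mono (by omega)

end Tiling

namespace Tiling
open Finset Classical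

variable {V κ α : Type*}

lemma num_bound {Δ Z r : ℕ} (hbig : 1000 ≤ Z) (hDD : 16 * (Δ * Δ + Δ + 1) ≤ Z) (hDelta : 0 < Δ)
    (hZr : 1024 * r ^ 3 ≤ Z) :
    36 * ((Z ^ 11) ^ (8 * r * Z ^ 22) * ((2 * Z ^ 15) ^ (Δ + 1) * Z ^ 20)) ≤ 2 ^ (Z ^ 25) := by
  have hr3 : r ≤ r ^ 3 := Nat.le_self_pow (by norm_num) r
  have hZ0 : 0 < Z := by omega
  have hZ2 : Z ≤ 2 ^ Z := Nat.lt_two_pow_self.le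
  have h1 : (Z ^ 11) ^ (8 * r * Z ^ 22) ≤ 2 ^ (Z ^ 24) := by
    calc (Z ^ 11) ^ (8 * r * Z ^ 22) = Z ^ (11 * (8 * r * Z ^ 22)) := by rw [← pow_mul]
      _ ≤ (2 ^ Z) ^ (11 * (8 * r * Z ^ 22)) := Nat.pow_le_pow_left hZ2 _
      _ = 2 ^ (Z * (11 * (8 * r * Z ^ 22))) := by rw [← pow_mul]
      _ ≤ 2 ^ (Z ^ 24) := by
        apply Nat.pow_le_pow_right (by norm_num)
        calc Z * (11 * (8 * r * Z ^ 22)) = (88 * r) * Z ^ 23 := by ring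
          _ ≤ Z * Z ^ 23 := by gcongr; omega
          _ = _ := by ring
  have h2 : (2 * Z ^ 15) ^ (Δ + 1) ≤ 2 ^ (Z ^ 2) := by
    calc (2 * Z ^ 15) ^ (Δ + 1) ≤ (Z * Z ^ 15) ^ (Δ + 1) := by gcongr; omega
      _ = Z ^ (16 * (Δ + 1)) := by rw [pow_mul]; ring
      _ ≤ Z ^ Z := by
        apply Nat.pow_le_pow_right hZ0
        have : 0 ≤ Δ * Δ := Nat.zero_le _
        omega
      _ ≤ (2 ^ Z) ^ Z := Nat.pow_le_pow_left hZ2 _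
      _ = _ := by rw [← pow_mul]; ring
  have h3 : Z ^ 20 ≤ 2 ^ (Z ^ 2) := by
    calc Z ^ 20 ≤ Z ^ Z := Nat.pow_le_pow_right hZ0 (by omega)
      _ ≤ (2 ^ Z) ^ Z := Nat.pow_le_pow_left hZ2 _
      _ = _ := by rw [← pow_mul]; ring
  calc 36 * ((Z ^ 11) ^ (8 * r * Z ^ 22) * ((2 * Z ^ 15) ^ (Δ + 1) * Z ^ 20))
      ≤ 2 ^ 6 * (2 ^ (Z ^ 24) * (2 ^ (Z ^ 2) * 2 ^ (Z ^ 2))) := by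
        gcongr; norm_num
    _ = 2 ^ (6 + (Z ^ 24 + (Z ^ 2 + Z ^ 2))) := by rw [pow_add, pow_add, pow_add]
    _ ≤ 2 ^ (Z ^ 25) := by
      apply Nat.pow_le_pow_right (by norm_num)
      have e1 : Z ^ 2 ≤ Z ^ 24 := Nat.pow_le_pow_right hZ0 (by norm_num)
      have e2 : 1000 * Z ^ 24 ≤ Z ^ 25 := by
        rw [pow_succ' Z 24]; gcongr
      have e3 : Z ≤ Z ^ 24 := Nat.le_self_pow (by norm_num) Z
      omega

lemma main_tile [Fintype V] {Δ Z r : ℕ} (hz : ZOK Δ (8 * r) (Δ + 2) Z) (hDelta : 0 < Δ) (hr : 0 < r)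
    {F : (i : ℕ) → SimpleGraph (Fin i)} (hF : FOK F Δ)
    {c : V → V → Fin r} (hc : ∀ a b, c a b = c b a) (hZ4 : (Δ * Δ + 1) * (Δ * Δ + 1) ≤ Z)
    (hZr : 1024 * r ^ 3 ≤ Z) (hZ5 : 400 * (Δ + 2) * r ^ (Δ + 3) ≤ Z) :
    Tileable F c (univ : Finset V) (Z ^ 28) := by
  have hbig := hz.big
  have hZ0 : 0 < Z := by omega
  have hcount : 2 * (Z * Z ^ 25) + Z + 5 * Z ^ 23 ≤ Z ^ 28 := by
    have e1 : Z * Z ^ 25 = Z ^ 26 := by ring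
    have e2 : Z ≤ Z ^ 26 := Nat.le_self_pow (by norm_num) Z
    have e3 : Z ^ 23 ≤ Z ^ 26 := Nat.pow_le_pow_right hZ0 (by norm_num)
    have e4 : Z ^ 27 ≤ Z ^ 28 := Nat.pow_le_pow_right hZ0 (by norm_num)
    have e5 : 1000 * Z ^ 26 ≤ Z ^ 27 := by rw [pow_succ' Z 26]; gcongr
    rw [e1]
    omega
  obtain ⟨n, hn⟩ : ∃ n, n = Fintype.card V := ⟨_, rfl⟩
  rcases Nat.lt_or_ge n (2 ^ (Z ^ 25)) with hlt | hge
  · obtain ⟨U, -, h2, h3⟩ := drc_pow hr hF hc hZ5 (by omega) (Z ^ 25) (univ : Finset V)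
    rw [card_univ, ← hn] at h3
    have h4 : #(univ \ U) = 0 := by
      by_contra h
      have := Nat.mul_le_mul_right (2 ^ (Z ^ 25)) (Nat.one_le_iff_ne_zero.2 h)
      rw [one_mul] at this
      generalize 2 ^ (Z ^ 25) = P at *
      omega
    have h5 : U = univ := by
      rw [card_eq_zero, sdiff_eq_empty_iff_subset] at h4
      exact univ_subset_iff.1 h4
    rw [← h5]
    exact h2.mono (by omega)
  have hnum := num_bound hbig hz.DD hDelta hZr
  obtain ⟨N, hN⟩ : ∃ N, N = 8 * r * Z ^ 22 := ⟨_, rfl⟩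
  obtain ⟨L, hL⟩ : ∃ L, L = (Z ^ 11) ^ N := ⟨_, rfl⟩
  obtain ⟨Q, hQ⟩ : ∃ Q, Q = (2 * Z ^ 15) ^ (Δ + 1) * Z ^ 20 := ⟨_, rfl⟩
  obtain ⟨s2, hs2⟩ : ∃ s2, s2 = 2 ^ (Z ^ 25) := ⟨_, rfl⟩
  rw [← hN, ← hL, ← hQ, ← hs2] at hnum
  rw [← hs2] at hge
  have hL0 : 0 < L := by rw [hL]; positivity
  have hQZ : Z ^ 20 ≤ Q := by
    rw [hQ]
    calc Z ^ 20 = 1 * Z ^ 20 := (one_mul _).symm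
      _ ≤ _ := by gcongr; exact Nat.one_le_pow _ _ (by positivity)
  have hQ0 : 0 < Q := lt_of_lt_of_le (by positivity) hQZ
  have hLQ : L ≤ L * Q := Nat.le_mul_of_pos_right _ hQ0
  obtain ⟨m, hm⟩ : ∃ m, m = n / 2 := ⟨_, rfl⟩
  obtain ⟨A, -, hAc⟩ := exists_subset_card_eq (show m ≤ #(univ : Finset V) by rw [card_univ]; omega)
  obtain ⟨B, hB, hBc⟩ := exists_subset_card_eq (show m ≤ #(univ \ A) by
    rw [card_sdiff_of_subset (subset_univ _), card_univ]; omega)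
  have hAB : Disjoint A B := disjoint_of_subset_right hB disjoint_sdiff
  obtain ⟨col, hcol⟩ : ∃ col : Fin r, m * m ≤ r * ∑ a ∈ A, #{b ∈ B | c b a = col} := by
    rcases majority c B A with h | ⟨col, h⟩
    · omega
    · refine ⟨col, ?_⟩
      rw [hAc, hBc] at h
      convert h
  obtain ⟨G, hG⟩ : ∃ G : V → V → Prop, ∀ a b, G a b ↔ c b a = col := ⟨_, fun _ _ => Iff.rfl⟩
  have hGe : ∀ a, B.filter (fun b => c b a = col) = B.filter (fun b => G a b) := by
    intro a; ext b; simp only [mem_filter, hG]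
  simp only [hGe] at hcol
  have hMm : (Z ^ 11) ^ (N + 1) ≤ m := by
    rw [pow_succ, ← hL]
    have h1 : L * Z ^ 11 ≤ L * Q := by
      gcongr
      exact le_trans (Nat.pow_le_pow_right hZ0 (by norm_num)) hQZ
    omega
  obtain ⟨X, hX, Y, hY, t, k, x1, x2, x3, x4, x5, x6, x7⟩ := lowreg_exists (G := G) A B m r Z N hr hbig hAc hBc hN.ge
    hMm hcol
  have hXY : Disjoint X Y := disjoint_of_subset_left hX (disjoint_of_subset_right hY hAB)
  have hnt : n ≤ 9 * L * t := by
    rw [← hL] at x3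
    have h1 : m < L * (m / L + 1) := Nat.lt_mul_div_succ _ hL0
    have h2 : L * (m / L + 1) ≤ L * (2 * t + 1) := Nat.mul_le_mul_left _ (by omega)
    have h3 : 1 ≤ t := by
      by_contra h
      have h4 : t = 0 := by omega
      rw [h4] at h2
      omega
    have h4 : L * (2 * t + 1) ≤ L * (3 * t) := Nat.mul_le_mul_left _ (by omega)
    have h5 : L * (3 * t) = 3 * (L * t) := by ring
    have h6 : 9 * L * t = 9 * (L * t) := by ring
    have h7 : 1 ≤ m := by omega
    omega
  have ht : 2 * Z ^ 16 ≤ t := by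
    have h1 : (9 * L) * (4 * Q) ≤ (9 * L) * t := by
      refine le_trans (le_of_eq ?_) (hnum.trans (hge.trans hnt))
      ring
    have h2 := Nat.le_of_mul_le_mul_left h1 (by omega)
    have h3 : Z ^ 16 ≤ Z ^ 20 := Nat.pow_le_pow_right hZ0 (by norm_num)
    omega
  obtain ⟨U, hU, u2, u3⟩ := drc_pow hr hF hc hZ5 (by omega) (Z ^ 25) (univ \ (X ∪ Y))
  obtain ⟨D, hD⟩ : ∃ D, D = (univ \ (X ∪ Y)) \ U := ⟨_, rfl⟩
  rw [← hD, ← hs2] at u3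
  have hDc : #D * Q ≤ t := by
    have h1 : #(univ \ (X ∪ Y)) ≤ n := by rw [hn]; exact card_le_univ _
    have h2 : (9 * L) * (#D * Q) ≤ (9 * L) * t := by
      calc (9 * L) * (#D * Q) = #D * (9 * (L * Q)) := by ring
        _ ≤ #D * s2 := by gcongr; omega
        _ ≤ 9 * L * t := by omega
    exact Nat.le_of_mul_le_mul_left h2 (by omega)
  rw [hQ] at hDc
  have fin := absorb_pair hz hDelta hr hF hc col hZ4 hZr (G := G) (fun a b h => by rw [hc]; exact (hG a b).1 h)
    hXY x1 x2 x4 x5 x6 x7 ht (B := D) (by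
      rw [hD]; exact disjoint_of_subset_left sdiff_subset disjoint_sdiff.symm) hDc
  have hall := u2.union fin (by
    rw [disjoint_union_right]
    constructor
    · rw [hD]; exact disjoint_sdiff
    · exact disjoint_of_subset_left hU disjoint_sdiff.symm)
  have e : U ∪ (D ∪ (X ∪ Y)) = univ := by
    rw [eq_univ_iff_forall]
    intro x
    rw [hD]
    simp only [mem_union, mem_sdiff, mem_univ, true_and]
    by_cases h1 : x ∈ U <;> by_cases h2 : x ∈ X <;> by_cases h3 : x ∈ Y <;> simp [h1, h2, h3]
  rw [e] at hall
  exact hall.mono hcount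

end Tiling

namespace Tiling
open Finset Classical

lemma z_ok {r Δ : ℕ} (hr : 0 < r) (hD : 0 < Δ) :
    ZOK Δ (8 * r) (Δ + 2) ((1024 * r) ^ (8 * Δ)) ∧
    (Δ * Δ + 1) * (Δ * Δ + 1) ≤ (1024 * r) ^ (8 * Δ) ∧ 1024 * r ^ 3 ≤ (1024 * r) ^ (8 * Δ) ∧
    400 * (Δ + 2) * r ^ (Δ + 3) ≤ (1024 * r) ^ (8 * Δ) := by
  obtain ⟨b, hb⟩ : ∃ b, b = 1024 * r := ⟨_, rfl⟩
  rw [← hb]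
  have hb0 : 0 < b := by omega
  have up : ∀ k, k ≤ 8 * Δ → b ^ k ≤ b ^ (8 * Δ) := fun k hk => Nat.pow_le_pow_right hb0 hk
  have b1 : b ≤ b ^ (8 * Δ) := by simpa using up 1 (by omega)
  have h2 : Δ + 1 ≤ 2 ^ Δ := Nat.lt_two_pow_self
  have h4 : (Δ + 1) * (Δ + 1) ≤ 4 ^ Δ := by
    calc (Δ + 1) * (Δ + 1) ≤ 2 ^ Δ * 2 ^ Δ := by gcongr
      _ = 4 ^ Δ := by rw [← mul_pow]; norm_num
  have hlow : ∀ a, a ≤ b → a ^ Δ ≤ b ^ Δ := fun a ha => Nat.pow_le_pow_left ha _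
  have hs : ∀ x a : ℕ, x ≤ b → a ≤ b → x * a ^ Δ ≤ b ^ (8 * Δ) := by
    intro x a hx ha
    calc x * a ^ Δ ≤ b * b ^ Δ := by gcongr
      _ = b ^ (Δ + 1) := by ring
      _ ≤ _ := up _ (by omega)
  have hr2 : r ^ (Δ + 3) ≤ b ^ (Δ + 3) := Nat.pow_le_pow_left (by omega) _
  refine ⟨⟨by omega, by omega, by omega, ?_, by omega, ?_, ?_, ?_, ?_⟩, ?_, ?_, ?_⟩
  · calc (8 * r) ^ (Δ + 2) ≤ b ^ (Δ + 2) := Nat.pow_le_pow_left (by omega) _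
      _ ≤ _ := up _ (by omega)
  · have := hs 2 (2 * (8 * r)) (by omega) (by omega)
    exact this
  · refine le_trans ?_ (hs 4 4 (by omega) (by omega))
    calc 4 * (Δ * 2 ^ Δ) ≤ 4 * (2 ^ Δ * 2 ^ Δ) := by gcongr; omega
      _ = 4 * 4 ^ Δ := by rw [← mul_pow]; norm_num
  · refine le_trans ?_ (hs 16 4 (by omega) (by omega))
    nlinarith
  · refine le_trans ?_ (hs 30 2 (by omega) (by omega))
    omega
  · refine le_trans ?_ (hs 1 16 (by omega) (by omega))
    calc (Δ * Δ + 1) * (Δ * Δ + 1) ≤ ((Δ + 1) * (Δ + 1)) * ((Δ + 1) * (Δ + 1)) := by gcongr <;> nlinarith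
      _ ≤ 4 ^ Δ * 4 ^ Δ := by gcongr
      _ = 1 * 16 ^ Δ := by rw [← mul_pow, one_mul]; norm_num
  · refine le_trans ?_ (up 3 (by omega))
    rw [hb, mul_pow]
    gcongr
    norm_num
  · have h5 : 400 * (Δ + 2) ≤ b * b ^ Δ := by
      calc 400 * (Δ + 2) ≤ 800 * 2 ^ Δ := by omega
        _ ≤ b * b ^ Δ := Nat.mul_le_mul (by omega) (hlow 2 (by omega))
    calc 400 * (Δ + 2) * r ^ (Δ + 3) ≤ (b * b ^ Δ) * b ^ (Δ + 3) := Nat.mul_le_mul h5 hr2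
      _ = b ^ (2 * Δ + 4) := by ring
      _ ≤ _ := up _ (by omega)

lemma Tileable.unpack {V κ : Type*} [Fintype V] {F : (i : ℕ) → SimpleGraph (Fin i)} {c : V → V → κ} {k : ℕ}
    (h : Tileable F c (univ : Finset V) k) :
    ∃ P : Finset (Finset V), #P ≤ k ∧ (∀ p ∈ P, ∀ q ∈ P, p ≠ q → Disjoint p q) ∧ (∀ x, ∃ p ∈ P, x ∈ p) ∧
      ∀ p ∈ P, ∃ (i : ℕ) (_ : 1 ≤ i) (col : κ) (f : Fin i → V), Function.Injective f ∧
        (∀ x, (∃ a, f a = x) ↔ x ∈ p) ∧ ∀ a b, (F i).Adj a b → c (f a) (f b) = col := by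
  obtain ⟨P, p1, p2, p3, p4⟩ := h
  refine ⟨P, p1, p2, ?_, ?_⟩
  · intro x
    have hx := mem_univ x
    rw [← p3, mem_biUnion] at hx
    exact hx
  · intro p hp
    obtain ⟨i, hi, col, f, hf, hfi, hfa⟩ := p4 p hp
    refine ⟨i, hi, col, f, hf, ?_, hfa⟩
    intro x
    rw [← hfi, mem_image]
    simp

end Tiling

theorem stmt_16 (r : ℕ) (hr : 0 < r) :
    ∃ C : ℝ, ∀ Δ : ℕ, 0 < Δ →
      ∀ F : (i : ℕ) → SimpleGraph (Fin i),
        (∀ i, 1 ≤ i → (F i).Colorable 2) →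
        (∀ i, 1 ≤ i → ∀ v, ((F i).neighborSet v).ncard ≤ Δ) →
        ∀ (n : ℕ) (c : Fin n → Fin n → Fin r), (∀ a b, c a b = c b a) →
          ∃ (s : ℕ) (parts : Fin s → Finset (Fin n)),
            (s : ℝ) ≤ Real.exp (C * Δ) ∧
            (∀ j j', j ≠ j' → Disjoint (parts j) (parts j')) ∧
            Finset.univ.biUnion parts = Finset.univ ∧
            ∀ j, ∃ (i : ℕ) (_ : 1 ≤ i) (col : Fin r) (f : Fin i ↪ Fin n),
              Finset.univ.map f = parts j ∧
              ∀ a b, (F i).Adj a b → c (f a) (f b) = col := by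
  classical
  refine ⟨224 * Real.log (1024 * r), ?_⟩
  intro Δ hD F hcol hdeg n c hc
  obtain ⟨hz, h1, h2, h3⟩ := Tiling.z_ok hr hD
  have hF : Tiling.FOK F Δ := by
    refine ⟨hcol, ?_⟩
    intro i hi w
    refine le_trans (le_of_eq ?_) (hdeg i hi w)
    rw [← Set.ncard_coe_finset]
    congr 1
    ext x
    simp [SimpleGraph.mem_neighborSet]
  obtain ⟨P, p1, p2, p3, p4⟩ := (Tiling.main_tile hz hD hr hF hc h1 h2 h3).unpack
  refine ⟨P.card, fun j => (P.equivFin.symm j).1, ?_, ?_, ?_, ?_⟩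
  · have hr0 : (0:ℝ) < 1024 * r := by
      have : (0:ℝ) < r := by exact_mod_cast hr
      positivity
    calc ((P.card : ℕ) : ℝ) ≤ ((((1024 * r) ^ (8 * Δ)) ^ 28 : ℕ) : ℝ) := by exact_mod_cast p1
      _ = (1024 * (r:ℝ)) ^ (224 * Δ) := by
        push_cast
        rw [← pow_mul]
        congr 1
        ring
      _ = Real.exp (224 * Real.log (1024 * r) * Δ) := by
        rw [← Real.exp_log (pow_pos hr0 (224 * Δ)), Real.log_pow]
        congr 1
        push_cast
        ring
      _ ≤ _ := le_rfl
  · intro j j' hj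
    apply p2 _ (P.equivFin.symm j).2 _ (P.equivFin.symm j').2
    intro h
    exact hj (P.equivFin.symm.injective (Subtype.ext h))
  · ext x
    constructor
    · intro _; exact Finset.mem_univ x
    · intro _
      obtain ⟨p, hp, hxp⟩ := p3 x
      refine Finset.mem_biUnion.2 ⟨P.equivFin ⟨p, hp⟩, Finset.mem_univ _, ?_⟩
      rw [Equiv.symm_apply_apply]
      exact hxp
  · intro j
    obtain ⟨i, hi, col, f, hf, hfi, hfa⟩ := p4 _ (P.equivFin.symm j).2
    refine ⟨i, hi, col, ⟨f, hf⟩, ?_, hfa⟩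
    ext x
    have h := hfi x
    rw [← h, Finset.mem_map]
    simp
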